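/- There exist constants c > 0 and d₀ ∈ ℕ such that for every dimension d ≥ d₀ and every convex body K ⊂ ℝ^d, the Hadwiger covering number satisfies N(K) ≤ exp(−c·d/(log d)^8) · 4^d. -/

import Mathlib

open MeasureTheory Pointwise

/-- The Hadwiger covering number of `K`: the least `N` such that `K` can be covered by
`N` translates of its interior. -/
noncomputable def coveringNumber {d : ℕ} (K : Set (EuclideanSpace ℝ (Fin d))) : ℕ :=
  sInf {N : ℕ | ∃ x : Fin N → EuclideanSpace ℝ (Fin d), K ⊆ ⋃ i, (x i +ᵥ interior K)}

open scoped ContDiff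

/-- The midpoint form of the Prékopa–Leindler inequality for the volume of `X`. -/
def PrekopaLeindler (X : Type*) [AddCommGroup X] [Module ℝ X] [MeasureSpace X] : Prop :=
  ∀ f g h : X → ENNReal, Measurable f → Measurable g → Measurable h →
    (∀ x y, f x * g y ≤ h ((1 / 2 : ℝ) • (x + y)) ^ 2) →
    (∫⁻ x, f x) * (∫⁻ x, g x) ≤ (∫⁻ x, h x) ^ 2

theorem volume_add_volume_le_of_midpoint_mem {A B C : Set ℝ} (hA : MeasurableSet A)
    (hB : MeasurableSet B) (hA0 : A.Nonempty) (hB0 : B.Nonempty)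
    (h : ∀ x ∈ A, ∀ y ∈ B, (1 / 2 : ℝ) • (x + y) ∈ C) :
    volume A + volume B ≤ 2 * volume C := by
  have key : ∀ A' B' : Set ℝ, IsCompact A' → IsCompact B' → A'.Nonempty → B'.Nonempty →
      A' ⊆ A → B' ⊆ B → volume A' + volume B' ≤ 2 * volume C := by
    intro A' B' hA' hB' hA'0 hB'0 hAs hBs
    obtain ⟨a, haA, ha⟩ := hA'.exists_isGreatest hA'0
    obtain ⟨b, hbB, hb⟩ := hB'.exists_isLeast hB'0
    have hsub : (fun x => x + b) '' A' ∪ (fun x => a + x) '' B' ⊆ (2 : ℝ) • C := by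
      rintro z (⟨x, hx, rfl⟩ | ⟨y, hy, rfl⟩)
      · exact ⟨_, h x (hAs hx) b (hBs hbB), by simp⟩
      · exact ⟨_, h a (hAs haA) y (hBs hy), by simp⟩
    have hInt : ((fun x => x + b) '' A') ∩ ((fun x => a + x) '' B') ⊆ {a + b} := by
      rintro z ⟨⟨x, hx, rfl⟩, ⟨y, hy, hyz⟩⟩
      have h1 := ha hx
      have h2 := hb hy
      simp only at hyz
      simp only [Set.mem_singleton_iff]
      linarith
    have hdis : AEDisjoint volume ((fun x => x + b) '' A') ((fun x => a + x) '' B') :=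
      measure_mono_null hInt (by simp)
    have hm : MeasurableSet ((fun x => a + x) '' B') :=
      (hB'.image (by fun_prop)).measurableSet
    calc volume A' + volume B'
        = volume ((fun x => x + b) '' A') + volume ((fun x => a + x) '' B') := by
          simp
      _ = volume ((fun x => x + b) '' A' ∪ (fun x => a + x) '' B') :=
          (measure_union₀ hm.nullMeasurableSet hdis).symm
      _ ≤ volume ((2 : ℝ) • C) := measure_mono hsub
      _ = 2 * volume C := by simp [Measure.addHaar_smul]
  obtain ⟨a0, ha0⟩ := hA0
  obtain ⟨b0, hb0⟩ := hB0
  rw [hA.measure_eq_iSup_isCompact, hB.measure_eq_iSup_isCompact]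
  simp only [iSup_and']
  refine ENNReal.biSup_add_biSup_le' (f := fun K => volume K) (g := fun K => volume K)
    (p := fun K => K ⊆ A ∧ IsCompact K) (q := fun K => K ⊆ B ∧ IsCompact K)
    ⟨∅, Set.empty_subset _, isCompact_empty⟩
    ⟨∅, Set.empty_subset _, isCompact_empty⟩ fun K hK K' hK' => ?_
  have := key (insert a0 K) (insert b0 K') (hK.2.insert _) (hK'.2.insert _) (by simp) (by simp)
    (Set.insert_subset ha0 hK.1) (Set.insert_subset hb0 hK'.1)
  exact le_trans (add_le_add (measure_mono (Set.subset_insert _ _))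
    (measure_mono (Set.subset_insert _ _))) this

theorem lintegral_eq_lintegral_meas_lt_of_le_one {f : ℝ → ENNReal} (hf : Measurable f)
    (hf1 : ∀ x, f x ≤ 1) :
    ∫⁻ x, f x = ∫⁻ t in Set.Ioo (0 : ℝ) 1, volume {x | ENNReal.ofReal t < f x} := by
  have hfin : ∀ x, f x ≠ ⊤ := fun x => ne_top_of_le_ne_top (by simp) (hf1 x)
  have h1 : ∫⁻ x, f x = ∫⁻ x, ENNReal.ofReal (f x).toReal := by
    simp [ENNReal.ofReal_toReal, hfin]
  rw [h1, lintegral_eq_lintegral_meas_lt volume (by filter_upwards with x; simp)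
    hf.ennreal_toReal.aemeasurable]
  have h2 : ∀ t ∈ Set.Ioi (0 : ℝ), volume {x | t < (f x).toReal} =
      (Set.Ioo (0 : ℝ) 1).indicator (fun t => volume {x | ENNReal.ofReal t < f x}) t := by
    intro t ht
    by_cases h : t < 1
    · rw [Set.indicator_of_mem (s := Set.Ioo (0 : ℝ) 1) ⟨ht, h⟩]
      congr 1; ext x
      simp [ENNReal.ofReal_lt_iff_lt_toReal (le_of_lt ht) (hfin x)]
    · rw [Set.indicator_of_notMem (by simp [h])]
      have : {x | t < (f x).toReal} = ∅ := by
        ext x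
        have : (f x).toReal ≤ 1 := ENNReal.toReal_le_of_le_ofReal (by simp) (by simpa using hf1 x)
        simp; linarith [not_lt.1 h]
      simp [this]
  rw [setLIntegral_congr_fun measurableSet_Ioi h2, setLIntegral_indicator measurableSet_Ioo]
  congr 2
  ext; simp +contextual

theorem ENNReal.mul_le_sq_of_add_le {a b c : ENNReal} (h : a + b ≤ 2 * c) : a * b ≤ c ^ 2 := by
  by_cases hc : c = ⊤
  · simp [hc]
  have hab : a + b ≠ ⊤ := ne_top_of_le_ne_top (by finiteness) h
  lift a to NNReal using (ENNReal.add_ne_top.1 hab).1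
  lift b to NNReal using (ENNReal.add_ne_top.1 hab).2
  lift c to NNReal using hc
  norm_cast at h ⊢
  have h' : (a : ℝ) + b ≤ 2 * c := by exact_mod_cast h
  have : (a : ℝ) * b ≤ c ^ 2 := by nlinarith [sq_nonneg ((a : ℝ) - b), a.2, b.2, c.2]
  exact_mod_cast this

theorem lintegral_mul_le_sq_of_iSup_eq_one {f g h : ℝ → ENNReal} (hf : Measurable f)
    (hg : Measurable g) (hh : Measurable h) (hf1 : ⨆ x, f x = 1) (hg1 : ⨆ x, g x = 1)
    (H : ∀ x y, f x * g y ≤ h ((1 / 2 : ℝ) • (x + y)) ^ 2) :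
    (∫⁻ x, f x) * (∫⁻ x, g x) ≤ (∫⁻ x, h x) ^ 2 := by
  apply ENNReal.mul_le_sq_of_add_le
  have hle : ∫⁻ x, min (h x) 1 ≤ ∫⁻ x, h x := lintegral_mono fun x => min_le_left _ _
  refine le_trans ?_ (mul_le_mul_right hle 2)
  rw [lintegral_eq_lintegral_meas_lt_of_le_one hf fun x => hf1 ▸ le_iSup f x,
    lintegral_eq_lintegral_meas_lt_of_le_one hg fun x => hg1 ▸ le_iSup g x,
    lintegral_eq_lintegral_meas_lt_of_le_one (hh.min measurable_const) fun x => min_le_right _ _]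
  rw [← lintegral_add_left', ← lintegral_const_mul']
  · refine setLIntegral_mono' measurableSet_Ioo fun t ht => ?_
    have ht1 : ENNReal.ofReal t < 1 := by simpa using ht.2
    refine volume_add_volume_le_of_midpoint_mem (measurableSet_lt measurable_const hf)
      (measurableSet_lt measurable_const hg) ?_ ?_ ?_
    · exact lt_iSup_iff.1 (hf1 ▸ ht1)
    · exact lt_iSup_iff.1 (hg1 ▸ ht1)
    · intro x hx y hy
      simp only [Set.mem_ofPred_eq, lt_min_iff] at hx hy ⊢
      refine ⟨?_, ht1⟩
      have h1 : ENNReal.ofReal t ^ 2 < h ((1 / 2 : ℝ) • (x + y)) ^ 2 := by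
        refine lt_of_lt_of_le ?_ (H x y)
        rw [sq]
        exact ENNReal.mul_lt_mul hx hy
      exact (ENNReal.pow_right_strictMono (by simp)).lt_iff_lt.1 h1
  · simp
  · refine (Antitone.measurable ?_).aemeasurable
    intro s t hst
    exact measure_mono fun x hx => lt_of_le_of_lt (ENNReal.ofReal_le_ofReal hst) hx

theorem lintegral_mul_le_sq_of_bounded {f g h : ℝ → ENNReal} (hf : Measurable f)
    (hg : Measurable g) (hh : Measurable h) (hf1 : ⨆ x, f x ≠ ⊤) (hg1 : ⨆ x, g x ≠ ⊤)
    (H : ∀ x y, f x * g y ≤ h ((1 / 2 : ℝ) • (x + y)) ^ 2) :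
    (∫⁻ x, f x) * (∫⁻ x, g x) ≤ (∫⁻ x, h x) ^ 2 := by
  set A := ⨆ x, f x with hA
  set B := ⨆ x, g x with hB
  by_cases hA0 : A = 0
  · have : ∀ x, f x = 0 := fun x => by
      have := le_iSup f x; rw [← hA, hA0] at this; simpa using this
    simp [this]
  by_cases hB0 : B = 0
  · have : ∀ x, g x = 0 := fun x => by
      have := le_iSup g x; rw [← hB, hB0] at this; simpa using this
    simp [this]
  set c : ENNReal := ((A * B) ^ (1 / 2 : ℝ))⁻¹ with hc
  have hAB0 : A * B ≠ 0 := mul_ne_zero hA0 hB0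
  have hABt : A * B ≠ ⊤ := ENNReal.mul_ne_top hf1 hg1
  have hc2 : c ^ 2 = (A * B)⁻¹ := by
    rw [hc, ← ENNReal.inv_pow, ← ENNReal.rpow_natCast, ← ENNReal.rpow_mul]; norm_num
  have key := lintegral_mul_le_sq_of_iSup_eq_one (f := fun x => A⁻¹ * f x)
    (g := fun x => B⁻¹ * g x) (h := fun x => c * h x) (hf.const_mul _) (hg.const_mul _)
    (hh.const_mul _) (by rw [← ENNReal.mul_iSup, ← hA, ENNReal.inv_mul_cancel hA0 hf1])
    (by rw [← ENNReal.mul_iSup, ← hB, ENNReal.inv_mul_cancel hB0 hg1]) (by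
      intro x y
      rw [mul_pow, hc2, ENNReal.mul_inv (Or.inl hA0) (Or.inl hf1), mul_mul_mul_comm]
      gcongr
      exact H x y)
  rw [lintegral_const_mul _ hf, lintegral_const_mul _ hg, lintegral_const_mul _ hh, mul_pow, hc2,
    mul_mul_mul_comm, ← ENNReal.mul_inv (Or.inl hA0) (Or.inl hf1)] at key
  have := mul_le_mul_right key (A * B)
  rwa [← mul_assoc, ENNReal.mul_inv_cancel hAB0 hABt, one_mul,
    ← mul_assoc, ENNReal.mul_inv_cancel hAB0 hABt, one_mul] at this

theorem lintegral_min_natCast_tendsto {f : ℝ → ENNReal} (hf : Measurable f) :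
    Filter.Tendsto (fun n : ℕ => ∫⁻ x, min (f x) n) Filter.atTop (nhds (∫⁻ x, f x)) := by
  refine lintegral_tendsto_of_tendsto_of_monotone
    (fun n => (hf.min measurable_const).aemeasurable) ?_ ?_
  · filter_upwards with x
    intro m n hmn
    exact min_le_min_left _ (by exact_mod_cast hmn)
  · filter_upwards with x
    have := (tendsto_const_nhds (x := f x)).min ENNReal.tendsto_nat_nhds_top
    simpa using this

theorem prekopaLeindler_real : PrekopaLeindler ℝ := by
  intro f g h hf hg hh H
  have h1 : ∀ n m : ℕ, (∫⁻ x, min (f x) n) * (∫⁻ x, min (g x) m) ≤ (∫⁻ x, h x) ^ 2 := by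
    intro n m
    refine lintegral_mul_le_sq_of_bounded (hf.min measurable_const) (hg.min measurable_const) hh
      ?_ ?_ fun x y => le_trans (by gcongr <;> exact min_le_left _ _) (H x y)
    · exact ne_top_of_le_ne_top (by simp : (n : ENNReal) ≠ ⊤) (iSup_le fun x => min_le_right _ _)
    · exact ne_top_of_le_ne_top (by simp : (m : ENNReal) ≠ ⊤) (iSup_le fun x => min_le_right _ _)
  have e1 := (lintegral_min_natCast_tendsto hf)
  have e2 := (lintegral_min_natCast_tendsto hg)
  have m1 : ∫⁻ x, f x = ⨆ n : ℕ, ∫⁻ x, min (f x) n :=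
    tendsto_nhds_unique e1 (tendsto_atTop_iSup fun m n hmn =>
      lintegral_mono fun x => min_le_min_left _ (by exact_mod_cast hmn))
  have m2 : ∫⁻ x, g x = ⨆ n : ℕ, ∫⁻ x, min (g x) n :=
    tendsto_nhds_unique e2 (tendsto_atTop_iSup fun m n hmn =>
      lintegral_mono fun x => min_le_min_left _ (by exact_mod_cast hmn))
  rw [m1, m2, ENNReal.iSup_mul]
  refine iSup_le fun n => ?_
  rw [ENNReal.mul_iSup]
  exact iSup_le fun m => h1 n m

theorem PrekopaLeindler.prod {X Y : Type*} [AddCommGroup X] [Module ℝ X] [MeasureSpace X]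
    [AddCommGroup Y] [Module ℝ Y] [MeasureSpace Y] [SFinite (volume : Measure X)]
    [SFinite (volume : Measure Y)]
    (hX : PrekopaLeindler X) (hY : PrekopaLeindler Y) : PrekopaLeindler (X × Y) := by
  intro f g h hf hg hh H
  rw [Measure.volume_eq_prod, lintegral_prod _ hf.aemeasurable, lintegral_prod _ hg.aemeasurable,
    lintegral_prod _ hh.aemeasurable]
  refine hX _ _ _ hf.lintegral_prod_right' hg.lintegral_prod_right' hh.lintegral_prod_right'
    fun x x' => ?_
  exact hY _ _ _ (hf.comp measurable_prodMk_left) (hg.comp measurable_prodMk_left)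
    (hh.comp measurable_prodMk_left) fun y y' => H (x, y) (x', y')

theorem PrekopaLeindler.of_measurePreserving {X Y : Type*} [AddCommGroup X] [Module ℝ X]
    [MeasureSpace X] [AddCommGroup Y] [Module ℝ Y] [MeasureSpace Y] (hX : PrekopaLeindler X)
    (e : X → Y) (he : MeasurePreserving e) (hmid : ∀ x y, e ((1 / 2 : ℝ) • (x + y)) =
      (1 / 2 : ℝ) • (e x + e y)) : PrekopaLeindler Y := by
  intro f g h hf hg hh H
  rw [← he.lintegral_comp hf, ← he.lintegral_comp hg, ← he.lintegral_comp hh]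
  refine hX _ _ _ (hf.comp he.measurable) (hg.comp he.measurable) (hh.comp he.measurable)
    fun x y => ?_
  simpa only [Function.comp_apply, hmid] using H (e x) (e y)

theorem prekopaLeindler_pi (n : ℕ) : PrekopaLeindler (Fin n → ℝ) := by
  induction n with
  | zero =>
    intro f g h hf hg hh H
    have := H 0 0
    simp only [Measure.volume_pi_eq_dirac (0 : Fin 0 → ℝ)]
    rw [lintegral_dirac, lintegral_dirac, lintegral_dirac]
    simpa using this
  | succ n ih =>
    refine (prekopaLeindler_real.prod ih).of_measurePreserving
      (MeasurableEquiv.piFinSuccAbove (fun _ : Fin (n + 1) => ℝ) 0).symm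
      (volume_preserving_piFinSuccAbove (fun _ : Fin (n + 1) => ℝ) 0).symm ?_
    rintro ⟨x, x'⟩ ⟨y, y'⟩
    ext i
    refine Fin.cases ?_ (fun j => ?_) i <;> simp [MeasurableEquiv.piFinSuccAbove, mul_add]

theorem prekopaLeindler_euclideanSpace (n : ℕ) : PrekopaLeindler (EuclideanSpace ℝ (Fin n)) :=
  (prekopaLeindler_pi n).of_measurePreserving _ (PiLp.volume_preserving_toLp (Fin n))
    fun x y => by simp

/-- Euclidean space of dimension `d`. -/
abbrev Euc (d : ℕ) := EuclideanSpace ℝ (Fin d)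

/-- The `i`-th partial derivative. -/
noncomputable def pd {d : ℕ} (i : Fin d) (f : Euc d → ℝ) : Euc d → ℝ :=
  fun x => fderiv ℝ f x (EuclideanSpace.single i 1)

/-- The squared norm of the gradient. -/
noncomputable def gradSq {d : ℕ} (f : Euc d → ℝ) : Euc d → ℝ := fun x => ∑ i, pd i f x ^ 2

/-- The operator `v ↦ ∂ᵢ v - (∂ᵢ V) v`, minus the adjoint of `∂ᵢ` in `L²(e^{-V})`. -/
noncomputable def dStar {d : ℕ} (V : Euc d → ℝ) (i : Fin d) (v : Euc d → ℝ) : Euc d → ℝ :=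
  fun x => pd i v x - pd i V x * v x

/-- The generator `Δ - ⟨∇V, ∇⟩` of the Langevin dynamics with potential `V`. -/
noncomputable def lap {d : ℕ} (V u : Euc d → ℝ) : Euc d → ℝ :=
  fun x => ∑ i, dStar V i (pd i u) x

/-- Smooth functions with compact support. -/
structure IsTest {d : ℕ} (u : Euc d → ℝ) : Prop where
  smooth : ContDiff ℝ ∞ u
  compact : HasCompactSupport u

section Calculus

variable {d : ℕ} {f g u v V : Euc d → ℝ}

theorem contDiff_pd (i : Fin d) (hf : ContDiff ℝ ∞ f) : ContDiff ℝ ∞ (pd i f) :=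
  (hf.fderiv_right (m := ∞) (by simp)).clm_apply contDiff_const

theorem IsTest.pd (i : Fin d) (hf : IsTest f) : IsTest (pd i f) :=
  ⟨contDiff_pd i hf.smooth, (hf.compact.fderiv ℝ).comp_left
    (g := fun L : Euc d →L[ℝ] ℝ => L (EuclideanSpace.single i 1)) (by simp)⟩

theorem IsTest.mul_left (hf : ContDiff ℝ ∞ f) (hg : IsTest g) : IsTest (fun x => f x * g x) :=
  ⟨hf.mul hg.smooth, hg.compact.mul_left⟩

theorem IsTest.add (hf : IsTest f) (hg : IsTest g) : IsTest (fun x => f x + g x) :=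
  ⟨hf.smooth.add hg.smooth, hf.compact.add hg.compact⟩

theorem IsTest.const_mul (c : ℝ) (hg : IsTest g) : IsTest (fun x => c * g x) :=
  IsTest.mul_left contDiff_const hg

theorem IsTest.sub (hf : IsTest f) (hg : IsTest g) : IsTest (fun x => f x - g x) := by
  simpa [sub_eq_add_neg] using hf.add (hg.const_mul (-1))

theorem isTest_zero : IsTest (fun _ : Euc d => (0 : ℝ)) :=
  ⟨contDiff_const, HasCompactSupport.zero⟩

theorem IsTest.sum {ι : Type*} (s : Finset ι) {f : ι → Euc d → ℝ} (hf : ∀ i ∈ s, IsTest (f i)) :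
    IsTest (fun x => ∑ i ∈ s, f i x) := by
  classical
  induction s using Finset.induction_on with
  | empty => simpa using isTest_zero
  | insert a s ha ih =>
    simp only [Finset.sum_insert ha]
    exact (hf a (by simp)).add (ih fun i hi => hf i (by simp [hi]))

theorem IsTest.dStar (i : Fin d) (hV : ContDiff ℝ ∞ V) (hf : IsTest f) : IsTest (dStar V i f) :=
  (hf.pd i).sub (IsTest.mul_left (contDiff_pd i hV) hf)

theorem IsTest.lap (hV : ContDiff ℝ ∞ V) (hu : IsTest u) : IsTest (lap V u) :=
  IsTest.sum _ fun i _ => (hu.pd i).dStar i hV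

theorem IsTest.integrable (hf : IsTest f) : Integrable f :=
  hf.smooth.continuous.integrable_of_hasCompactSupport hf.compact

theorem pd_add (i : Fin d) (hf : ContDiff ℝ ∞ f) (hg : ContDiff ℝ ∞ g) (x : Euc d) :
    pd i (fun x => f x + g x) x = pd i f x + pd i g x := by
  unfold pd
  rw [fderiv_fun_add (hf.differentiable (by simp) x) (hg.differentiable (by simp) x)]; simp

theorem pd_sub (i : Fin d) (hf : ContDiff ℝ ∞ f) (hg : ContDiff ℝ ∞ g) (x : Euc d) :
    pd i (fun x => f x - g x) x = pd i f x - pd i g x := by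
  unfold pd
  rw [fderiv_fun_sub (hf.differentiable (by simp) x) (hg.differentiable (by simp) x)]; simp

theorem pd_mul (i : Fin d) (hf : ContDiff ℝ ∞ f) (hg : ContDiff ℝ ∞ g) (x : Euc d) :
    pd i (fun x => f x * g x) x = f x * pd i g x + pd i f x * g x := by
  unfold pd
  rw [fderiv_fun_mul (hf.differentiable (by simp) x) (hg.differentiable (by simp) x)]
  simp; ring

theorem pd_const_mul (i : Fin d) (c : ℝ) (hf : ContDiff ℝ ∞ f) (x : Euc d) :
    pd i (fun x => c * f x) x = c * pd i f x := by
  unfold pd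
  rw [fderiv_const_mul (hf.differentiable (by simp) x)]; simp

theorem pd_exp_neg (i : Fin d) (hV : ContDiff ℝ ∞ V) (x : Euc d) :
    pd i (fun x => Real.exp (-V x)) x = -(pd i V x * Real.exp (-V x)) := by
  unfold pd
  have h := ((hV.differentiable (by simp) x).hasFDerivAt.neg).exp
  rw [show (fun x => Real.exp (-V x)) = fun x => Real.exp ((-V) x) from rfl, h.fderiv]
  simp; ring

theorem pd_comm (i j : Fin d) (hf : ContDiff ℝ ∞ f) (x : Euc d) :
    pd i (pd j f) x = pd j (pd i f) x := by
  have hd : DifferentiableAt ℝ (fderiv ℝ f) x :=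
    (hf.fderiv_right (m := ∞) (by simp)).differentiable (by simp) x
  have key : ∀ v w : Euc d, fderiv ℝ (fun y => fderiv ℝ f y v) x w =
      fderiv ℝ (fderiv ℝ f) x w v := by
    intro v w
    rw [fderiv_clm_apply hd (differentiableAt_const _)]
    simp
  unfold pd
  rw [key, key]
  exact (hf.contDiffAt.isSymmSndFDerivAt (by simp; exact ENat.LEInfty.out)).eq _ _

theorem pd_sq (i : Fin d) (hf : ContDiff ℝ ∞ f) (x : Euc d) :
    pd i (fun x => f x ^ 2) x = 2 * f x * pd i f x := by
  simp only [pow_two]; rw [pd_mul i hf hf]; ring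

theorem integral_pd_eq_zero (i : Fin d) (hg : IsTest g) : ∫ x, pd i g x = 0 := by
  obtain ⟨R, hR⟩ := hg.compact.isCompact.isBounded.subset_closedBall 0
  let χ : ContDiffBump (0 : Euc d) := ⟨|R| + 1, |R| + 2, by positivity, by linarith⟩
  have hχ : IsTest χ := ⟨χ.contDiff, χ.hasCompactSupport⟩
  have hχg : ∀ x, x ∈ tsupport g → (χ : Euc d → ℝ) =ᶠ[nhds x] fun _ => 1 := by
    intro x hx
    have : x ∈ Metric.ball (0 : Euc d) (|R| + 1) := by
      have := hR hx
      simp at this ⊢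
      linarith [le_abs_self R]
    filter_upwards [Metric.isOpen_ball.mem_nhds this] with y hy
    exact χ.one_of_mem_closedBall (Metric.ball_subset_closedBall hy)
  have h := integral_mul_fderiv_eq_neg_fderiv_mul_of_integrable (μ := volume)
    (𝕜 := ℝ) (f := fun x => χ x) (g := g) (v := EuclideanSpace.single i 1)
    ((IsTest.mul_left (contDiff_pd i hχ.smooth) hg).integrable)
    ((IsTest.mul_left hχ.smooth (hg.pd i)).integrable)
    ((IsTest.mul_left hχ.smooth hg).integrable)
    (fun x _ => hχ.smooth.differentiable (by simp) x)
    (fun x _ => hg.smooth.differentiable (by simp) x)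
  have h1 : ∀ x, χ x * pd i g x = pd i g x := by
    intro x
    by_cases hx : x ∈ tsupport g
    · rw [(hχg x hx).eq_of_nhds, one_mul]
    · have : fderiv ℝ g x = 0 := by
        by_contra h0
        exact hx (tsupport_fderiv_subset ℝ (subset_tsupport _ h0))
      simp [pd, this]
  have h2 : ∀ x, pd i χ x * g x = 0 := by
    intro x
    by_cases hx : x ∈ tsupport g
    · have : fderiv ℝ χ x = 0 := by rw [(hχg x hx).fderiv_eq]; simp
      simp [pd, this]
    · simp [image_eq_zero_of_notMem_tsupport hx]
  have h3 : ∫ x, χ x * pd i g x = -∫ x, pd i χ x * g x := h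
  simpa [h1, h2] using h3

theorem integral_pd_mul_eq_neg (i : Fin d) (hf : ContDiff ℝ ∞ f) (hg : IsTest g) :
    ∫ x, pd i f x * g x = -∫ x, f x * pd i g x := by
  have h := integral_pd_eq_zero i (IsTest.mul_left hf hg)
  simp only [pd_mul i hf hg.smooth] at h
  rw [integral_add (IsTest.mul_left hf (hg.pd i)).integrable
    (IsTest.mul_left (contDiff_pd i hf) hg).integrable] at h
  linarith

theorem contDiff_exp_neg (hV : ContDiff ℝ ∞ V) : ContDiff ℝ ∞ (fun x => Real.exp (-V x)) :=
  hV.neg.exp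

theorem IsTest.mul_exp_neg (hV : ContDiff ℝ ∞ V) (hf : IsTest f) :
    IsTest (fun x => f x * Real.exp (-V x)) := by
  simpa [mul_comm] using IsTest.mul_left (contDiff_exp_neg hV) hf

theorem pd_mul_exp_neg (i : Fin d) (hV : ContDiff ℝ ∞ V) (hv : ContDiff ℝ ∞ v) (x : Euc d) :
    pd i (fun x => v x * Real.exp (-V x)) x = dStar V i v x * Real.exp (-V x) := by
  rw [pd_mul i hv (contDiff_exp_neg hV), pd_exp_neg i hV, dStar]; ring

theorem integral_pd_mul_weight (i : Fin d) (hV : ContDiff ℝ ∞ V) (hf : ContDiff ℝ ∞ f)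
    (hv : IsTest v) :
    ∫ x, pd i f x * v x * Real.exp (-V x) = -∫ x, f x * dStar V i v x * Real.exp (-V x) := by
  have h := integral_pd_mul_eq_neg i hf (hv.mul_exp_neg hV)
  simpa only [pd_mul_exp_neg i hV hv.smooth, mul_assoc] using h

theorem integral_dStar_mul_weight (i : Fin d) (hV : ContDiff ℝ ∞ V) (hf : ContDiff ℝ ∞ f)
    (hv : IsTest v) :
    ∫ x, f x * dStar V i v x * Real.exp (-V x) = -∫ x, pd i f x * v x * Real.exp (-V x) := by
  rw [integral_pd_mul_weight i hV hf hv, neg_neg]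

theorem integral_mul_lap (hV : ContDiff ℝ ∞ V) (hf : ContDiff ℝ ∞ f) (hu : IsTest u) :
    ∫ x, f x * lap V u x * Real.exp (-V x) =
      -∫ x, (∑ i, pd i f x * pd i u x) * Real.exp (-V x) := by
  simp only [lap, Finset.mul_sum, Finset.sum_mul]
  rw [integral_finsetSum, integral_finsetSum, ← Finset.sum_neg_distrib]
  · exact Finset.sum_congr rfl fun i _ => integral_dStar_mul_weight i hV hf (hu.pd i)
  · exact fun i _ => ((IsTest.mul_left (contDiff_pd i hf) (hu.pd i)).mul_exp_neg hV).integrable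
  · exact fun i _ => ((IsTest.mul_left hf ((hu.pd i).dStar i hV)).mul_exp_neg hV).integrable

theorem pd_dStar (i j : Fin d) (hV : ContDiff ℝ ∞ V) (hv : ContDiff ℝ ∞ v) (x : Euc d) :
    pd j (dStar V i v) x = dStar V i (pd j v) x - pd j (pd i V) x * v x := by
  unfold dStar
  rw [pd_sub j (contDiff_pd i hv) ((contDiff_pd i hV).mul hv), pd_mul j (contDiff_pd i hV) hv,
    pd_comm j i hv]
  ring

/-- The integrated Bochner formula. -/
theorem integral_lap_sq (hV : ContDiff ℝ ∞ V) (hu : IsTest u) :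
    ∫ x, lap V u x ^ 2 * Real.exp (-V x) =
      (∑ j, ∫ x, gradSq (pd j u) x * Real.exp (-V x)) +
      ∫ x, (∑ i, ∑ j, pd j (pd i V) x * (pd i u x * pd j u x)) * Real.exp (-V x) := by
  have hL := hu.lap hV
  have e1 : ∫ x, lap V u x ^ 2 * Real.exp (-V x) =
      ∑ j, ∑ i, -∫ x, pd j (dStar V i (pd i u)) x * pd j u x * Real.exp (-V x) := by
    have : ∀ x, lap V u x ^ 2 * Real.exp (-V x) =
        ∑ j, ∑ i, dStar V i (pd i u) x * dStar V j (pd j u) x * Real.exp (-V x) := by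
      intro x
      simp only [lap, pow_two, Finset.sum_mul, Finset.mul_sum]
    simp only [this]
    rw [integral_finsetSum]
    · refine Finset.sum_congr rfl fun j _ => ?_
      rw [integral_finsetSum]
      · exact Finset.sum_congr rfl fun i _ =>
          integral_dStar_mul_weight j hV ((hu.pd i).dStar i hV).smooth (hu.pd j)
      · exact fun i _ => ((IsTest.mul_left ((hu.pd i).dStar i hV).smooth
          ((hu.pd j).dStar j hV)).mul_exp_neg hV).integrable
    · exact fun j _ => integrable_finsetSum _ fun i _ =>
        ((IsTest.mul_left ((hu.pd i).dStar i hV).smooth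
          ((hu.pd j).dStar j hV)).mul_exp_neg hV).integrable
  have e2 : ∀ i j, -∫ x, pd j (dStar V i (pd i u)) x * pd j u x * Real.exp (-V x) =
      (∫ x, pd i (pd j u) x ^ 2 * Real.exp (-V x)) +
      ∫ x, pd j (pd i V) x * (pd i u x * pd j u x) * Real.exp (-V x) := by
    intro i j
    have h1 : ∀ x, pd j (dStar V i (pd i u)) x * pd j u x * Real.exp (-V x) =
        pd j u x * dStar V i (pd i (pd j u)) x * Real.exp (-V x) -
        pd j (pd i V) x * (pd i u x * pd j u x) * Real.exp (-V x) := by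
      intro x
      rw [pd_dStar i j hV (contDiff_pd i hu.smooth),
        show pd j (pd i u) = pd i (pd j u) from funext fun x => pd_comm j i hu.smooth x]
      ring
    simp only [h1]
    rw [integral_sub, integral_dStar_mul_weight i hV (contDiff_pd j hu.smooth) ((hu.pd j).pd i)]
    · simp only [pow_two]; ring
    · exact ((IsTest.mul_left (hu.pd j).smooth (((hu.pd j).pd i).dStar i hV)).mul_exp_neg
        hV).integrable
    · exact ((IsTest.mul_left (contDiff_pd j (contDiff_pd i hV))
        (IsTest.mul_left (hu.pd i).smooth (hu.pd j))).mul_exp_neg hV).integrable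
  have i1 : ∀ i j, Integrable fun x => pd i (pd j u) x ^ 2 * Real.exp (-V x) := fun i j => by
    simpa only [pow_two] using ((IsTest.mul_left ((hu.pd j).pd i).smooth
      ((hu.pd j).pd i)).mul_exp_neg hV).integrable
  have i2 : ∀ i j, Integrable fun x => pd j (pd i V) x * (pd i u x * pd j u x) * Real.exp (-V x) :=
    fun i j => ((IsTest.mul_left (contDiff_pd j (contDiff_pd i hV))
        (IsTest.mul_left (hu.pd i).smooth (hu.pd j))).mul_exp_neg hV).integrable
  rw [e1]
  simp only [e2, Finset.sum_add_distrib, gradSq, Finset.sum_mul]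
  congr 1
  · refine Finset.sum_congr rfl fun j _ => ?_
    rw [integral_finsetSum _ fun i _ => i1 i j]
  · rw [integral_finsetSum _ fun i _ => integrable_finsetSum _ fun j _ => i2 i j,
      Finset.sum_comm]
    refine Finset.sum_congr rfl fun i _ => ?_
    rw [integral_finsetSum _ fun j _ => i2 i j]

end Calculus

section Hessian

variable {d : ℕ} {f g u v V : Euc d → ℝ}

theorem fderiv_apply_eq_sum (f : Euc d → ℝ) (x v : Euc d) :
    fderiv ℝ f x v = ∑ i, v i * pd i f x := by
  conv_lhs => rw [← (EuclideanSpace.basisFun (Fin d) ℝ).sum_repr v]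
  simp [pd, map_sum]

theorem hasDerivAt_line (hf : ContDiff ℝ ∞ f) (x v : Euc d) (t : ℝ) :
    HasDerivAt (fun t : ℝ => f (x + t • v)) (∑ i, v i * pd i f (x + t • v)) t := by
  rw [← fderiv_apply_eq_sum]
  have h1 : HasDerivAt (fun t : ℝ => x + t • v) v t := by
    simpa using ((hasDerivAt_id t).smul_const v).const_add x
  exact (hf.differentiable (by simp) _).hasFDerivAt.comp_hasDerivAt t h1

theorem sum_hessian_ge (hV : ContDiff ℝ ∞ V)
    (hconv : ∀ x y, V ((1 / 2 : ℝ) • (x + y)) + ‖x - y‖ ^ 2 / 8 ≤ (V x + V y) / 2)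
    (x : Euc d) (a : Fin d → ℝ) :
    ∑ i, a i ^ 2 ≤ ∑ i, ∑ j, pd j (pd i V) x * (a i * a j) := by
  set v : Euc d := WithLp.toLp 2 a with hv
  have hva : ∀ i, v i = a i := fun i => rfl
  have hnorm : ‖v‖ ^ 2 = ∑ i, a i ^ 2 := by
    rw [EuclideanSpace.norm_sq_eq]; simp [hva]
  set c := ∑ i, ∑ j, pd j (pd i V) x * (a i * a j) with hc
  by_contra hlt
  push Not at hlt
  let k : ℝ → ℝ := fun t => V (x + t • v) + V (x + t • (-v)) - 2 * V x - ‖v‖ ^ 2 * t ^ 2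
  let k' : ℝ → ℝ := fun t => (∑ i, v i * pd i V (x + t • v)) + (∑ i, (-v) i * pd i V (x + t • (-v)))
    - ‖v‖ ^ 2 * (2 * t)
  have hk : ∀ t, HasDerivAt k (k' t) t := by
    intro t
    have h := (((hasDerivAt_line hV x v t).add (hasDerivAt_line hV x (-v) t)).sub_const
      (2 * V x)).sub ((hasDerivAt_pow 2 t).const_mul (‖v‖ ^ 2))
    exact h.congr_deriv (by simp [k'])
  have hk' : HasDerivAt k' (2 * (c - ‖v‖ ^ 2)) 0 := by
    have h1 : ∀ w : Euc d, HasDerivAt (fun t : ℝ => ∑ i, w i * pd i V (x + t • w))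
        (∑ i, w i * ∑ j, w j * pd j (pd i V) x) 0 := by
      intro w
      refine HasDerivAt.fun_sum fun i _ => ?_
      have := (hasDerivAt_line (contDiff_pd i hV) x w 0).const_mul (w i)
      simpa using this
    have h2 : HasDerivAt (fun t : ℝ => ‖v‖ ^ 2 * (2 * t)) (‖v‖ ^ 2 * (2 * 1)) 0 :=
      ((hasDerivAt_id (0 : ℝ)).const_mul 2).const_mul _
    have h := ((h1 v).add (h1 (-v))).sub h2
    refine h.congr_deriv ?_
    have e : ∑ i, v i * ∑ j, v j * pd j (pd i V) x = c := by
      simp only [hc, Finset.mul_sum, hva]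
      exact Finset.sum_congr rfl fun i _ => Finset.sum_congr rfl fun j _ => by ring
    have e' : ∑ i, (-v) i * ∑ j, (-v) j * pd j (pd i V) x = c := by
      rw [← e]; simp
    rw [e, e']; ring
  have hderiv : deriv k = k' := funext fun t => (hk t).deriv
  have hmax : IsLocalMax k 0 := by
    refine isLocalMax_of_deriv_deriv_neg ?_ ?_ (hk 0).continuousAt
    · rw [hderiv, hk'.deriv, hnorm]; linarith
    · rw [hderiv]; simp [k']
  have hk0 : k 0 = 0 := by simp [k]; ring
  have hnn : ∀ t, 0 ≤ k t := by
    intro t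
    have h := hconv (x + t • v) (x + t • (-v))
    have e1 : (1 / 2 : ℝ) • (x + t • v + (x + t • (-v))) = x := by
      rw [smul_neg]; module
    have e2 : x + t • v - (x + t • (-v)) = (2 * t) • v := by rw [smul_neg]; module
    rw [e1, e2, norm_smul, mul_pow, Real.norm_eq_abs, sq_abs] at h
    simp only [k]; linarith
  have hz : k =ᶠ[nhds 0] fun _ => 0 := by
    filter_upwards [hmax] with t ht
    exact le_antisymm (ht.trans hk0.le) (hnn t)
  have hd : deriv k =ᶠ[nhds 0] fun _ => 0 := by
    simpa using hz.deriv
  have := hd.deriv_eq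
  rw [hderiv, hk'.deriv] at this
  simp at this
  linarith

theorem integral_lap_sq_ge (hV : ContDiff ℝ ∞ V)
    (hconv : ∀ x y, V ((1 / 2 : ℝ) • (x + y)) + ‖x - y‖ ^ 2 / 8 ≤ (V x + V y) / 2)
    (hu : IsTest u) :
    (∑ j, ∫ x, gradSq (pd j u) x * Real.exp (-V x)) + ∫ x, gradSq u x * Real.exp (-V x) ≤
    ∫ x, lap V u x ^ 2 * Real.exp (-V x) := by
  rw [integral_lap_sq hV hu]
  refine add_le_add le_rfl (integral_mono ?_ ?_ fun x => ?_)
  · simp only [gradSq, Finset.sum_mul, pow_two]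
    exact integrable_finsetSum _ fun i _ =>
      ((IsTest.mul_left (hu.pd i).smooth (hu.pd i)).mul_exp_neg hV).integrable
  · simp only [Finset.sum_mul]
    exact integrable_finsetSum _ fun i _ => integrable_finsetSum _ fun j _ =>
      ((IsTest.mul_left (contDiff_pd j (contDiff_pd i hV))
        (IsTest.mul_left (hu.pd i).smooth (hu.pd j))).mul_exp_neg hV).integrable
  · exact mul_le_mul_of_nonneg_right (sum_hessian_ge hV hconv x fun i => pd i u x)
      (Real.exp_nonneg _)

end Hessian

theorem sq_integral_mul_le {α : Type*} [MeasurableSpace α] {μ : Measure α} {f g : α → ℝ}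
    (hf : Integrable (fun x => f x ^ 2) μ) (hg : Integrable (fun x => g x ^ 2) μ)
    (hfg : Integrable (fun x => f x * g x) μ) :
    (∫ x, f x * g x ∂μ) ^ 2 ≤ (∫ x, f x ^ 2 ∂μ) * ∫ x, g x ^ 2 ∂μ := by
  have h : ∀ s : ℝ, 0 ≤ (∫ x, f x ^ 2 ∂μ) * (s * s) + (2 * ∫ x, f x * g x ∂μ) * s +
      ∫ x, g x ^ 2 ∂μ := by
    intro s
    have h1 : 0 ≤ ∫ x, (s * f x + g x) ^ 2 ∂μ := integral_nonneg fun x => sq_nonneg _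
    have h2 : ∀ x, (s * f x + g x) ^ 2 = s * s * f x ^ 2 + 2 * s * (f x * g x) + g x ^ 2 :=
      fun x => by ring
    simp only [h2] at h1
    have h3 : Integrable (fun x => s * s * f x ^ 2 + 2 * s * (f x * g x)) μ :=
      (hf.const_mul _).add (hfg.const_mul _)
    rw [integral_add h3 hg, integral_add (hf.const_mul _) (hfg.const_mul _), integral_const_mul,
      integral_const_mul] at h1
    linarith
  have := discrim_le_zero h
  rw [discrim] at this
  nlinarith

section Mollify

variable {d : ℕ} {ε : ℝ} {f g h u v w V ρ : Euc d → ℝ}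

/-- The convolution of `f` with `ρ`. -/
noncomputable def mollify (ρ f : Euc d → ℝ) : Euc d → ℝ := fun y => ∫ t, f t * ρ (y - t)

theorem mollify_eq_convolution (ρ f : Euc d → ℝ) :
    mollify ρ f = convolution f ρ (ContinuousLinearMap.mul ℝ ℝ) volume := rfl

theorem contDiff_mollify (hρ : IsTest ρ) (hf : LocallyIntegrable f) :
    ContDiff ℝ ∞ (mollify ρ f) :=
  hρ.compact.contDiff_convolution_right (ContinuousLinearMap.mul ℝ ℝ) hf hρ.smooth

theorem pd_mollify (i : Fin d) (hρ : IsTest ρ) (hf : LocallyIntegrable f) (y : Euc d) :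
    pd i (mollify ρ f) y = mollify (pd i ρ) f y := by
  have h := hρ.compact.hasFDerivAt_convolution_right (ContinuousLinearMap.mul ℝ ℝ) hf
    (hρ.smooth.of_le ENat.LEInfty.out) y
  rw [mollify_eq_convolution, pd, h.fderiv, convolution_precompR_apply]
  · rfl
  · exact hf
  · exact hρ.compact.fderiv ℝ
  · exact hρ.smooth.continuous_fderiv (by simp)

theorem integrable_mul_translate (hρ : IsTest ρ) (hf : LocallyIntegrable f) (y : Euc d) :
    Integrable fun t => f t * ρ (y - t) :=
  hρ.compact.convolutionExists_right (ContinuousLinearMap.mul ℝ ℝ) hf hρ.smooth.continuous y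

/-- A nonnegative smooth bump of integral one supported in the ball of radius `ε`. -/
structure IsMollifier (ε : ℝ) (ρ : Euc d → ℝ) : Prop where
  test : IsTest ρ
  nonneg : ∀ x, 0 ≤ ρ x
  integral_eq_one : ∫ x, ρ x = 1
  eq_zero : ∀ x, ε ≤ ‖x‖ → ρ x = 0

theorem isMollifier_normed (φ : ContDiffBump (0 : Euc d)) :
    IsMollifier φ.rOut (φ.normed volume) where
  test := ⟨φ.contDiff_normed, φ.hasCompactSupport_normed⟩
  nonneg := φ.nonneg_normed
  integral_eq_one := φ.integral_normed
  eq_zero := fun x hx => by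
    by_contra h
    have : x ∈ Function.support (φ.normed volume) := h
    rw [φ.support_normed_eq] at this
    simp at this
    linarith

theorem pd_reflect (i : Fin d) (hρ : ContDiff ℝ ∞ ρ) (y t : Euc d) :
    pd i (fun t => ρ (y - t)) t = -pd i ρ (y - t) := by
  unfold pd
  have h1 : HasFDerivAt (fun t : Euc d => y - t) (-ContinuousLinearMap.id ℝ (Euc d)) t :=
    (hasFDerivAt_id t).const_sub y
  have h2 := (hρ.differentiable (by simp) (y - t)).hasFDerivAt.comp t h1
  rw [show (fun t => ρ (y - t)) = ρ ∘ fun t => y - t from rfl, h2.fderiv]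
  simp

theorem IsTest.reflect (hρ : IsTest ρ) (y : Euc d) : IsTest (fun t => ρ (y - t)) :=
  ⟨hρ.smooth.comp (contDiff_const.sub contDiff_id),
    hρ.compact.comp_homeomorph (Homeomorph.subLeft y)⟩

theorem lap_reflect (hρ : IsTest ρ) (V : Euc d → ℝ) (y t : Euc d) :
    lap V (fun t => ρ (y - t)) t =
      ∑ i, (pd i (pd i ρ) (y - t) + pd i V t * pd i ρ (y - t)) := by
  refine Finset.sum_congr rfl fun i _ => ?_
  have e : pd i (fun t => ρ (y - t)) = fun t => (-1) * pd i ρ (y - t) := by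
    funext t; rw [pd_reflect i hρ.smooth]; ring
  rw [dStar, e, pd_const_mul i (-1) ((hρ.pd i).reflect y).smooth, pd_reflect i (hρ.pd i).smooth]
  ring

theorem locallyIntegrable_mul_continuous (hf : LocallyIntegrable f) (hg : Continuous g) :
    LocallyIntegrable fun x => f x * g x := by
  have := (locallyIntegrableOn_univ.2 hf).mul_continuousOn hg.continuousOn isOpen_univ.isLocallyClosed
  exact locallyIntegrableOn_univ.1 this

/-- A mollified weak solution of the equation `div (∇w + w ∇V) = 0` has a divergence-free flux. -/
theorem sum_pd_mollify_eq_zero (hV : ContDiff ℝ ∞ V) (hw : LocallyIntegrable w)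
    (hρ : IsTest ρ) (horth : ∀ u, IsTest u → ∫ x, w x * lap V u x = 0) (y : Euc d) :
    ∑ i, (pd i (pd i (mollify ρ w)) y + pd i (mollify ρ fun t => w t * pd i V t) y) = 0 := by
  have h := horth _ (hρ.reflect y)
  simp only [lap_reflect hρ, Finset.mul_sum, mul_add] at h
  have hwV : ∀ i, LocallyIntegrable fun t => w t * pd i V t := fun i =>
    locallyIntegrable_mul_continuous hw (contDiff_pd i hV).continuous
  have i1 : ∀ i, Integrable fun t => w t * pd i (pd i ρ) (y - t) := fun i =>
    integrable_mul_translate ((hρ.pd i).pd i) hw y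
  have i2 : ∀ i, Integrable fun t => w t * (pd i V t * pd i ρ (y - t)) := fun i => by
    simpa only [mul_assoc] using integrable_mul_translate (hρ.pd i) (hwV i) y
  have i3 : ∀ i, Integrable fun t => w t * pd i (pd i ρ) (y - t) +
      w t * (pd i V t * pd i ρ (y - t)) := fun i => (i1 i).add (i2 i)
  rw [integral_finsetSum _ fun i _ => i3 i] at h
  rw [← h]
  refine Finset.sum_congr rfl fun i _ => ?_
  rw [integral_add (i1 i) (i2 i), pd_mollify i hρ (hwV i),
    show pd i (mollify ρ w) = mollify (pd i ρ) w from funext fun z => pd_mollify i hρ hw z,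
    pd_mollify i (hρ.pd i) hw]
  simp only [mollify, mul_assoc]

theorem mollify_abs_sq_le (hρ : IsMollifier ε ρ)
    (hh : Integrable fun t => h t ^ 2 * v t) (hv : Integrable v) (hv0 : ∀ t, 0 < v t)
    (hhv : Integrable fun t => h t * v t) (y : Euc d) :
    (mollify ρ (fun t => |h t * v t|) y) ^ 2 ≤
      mollify ρ (fun t => h t ^ 2 * v t) y * mollify ρ v y := by
  have hn := hρ.nonneg
  have e0 : ∀ t, (Real.sqrt (v t * ρ (y - t))) ^ 2 = v t * ρ (y - t) := fun t =>
    Real.sq_sqrt (mul_nonneg (hv0 t).le (hn _))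
  have e1 : ∀ t, (|h t| * Real.sqrt (v t * ρ (y - t))) ^ 2 = h t ^ 2 * v t * ρ (y - t) := by
    intro t
    rw [mul_pow, e0, sq_abs]; ring
  have e2 : ∀ t, (|h t| * Real.sqrt (v t * ρ (y - t))) * Real.sqrt (v t * ρ (y - t)) =
      |h t * v t| * ρ (y - t) := by
    intro t
    rw [mul_assoc, ← pow_two, e0, abs_mul, abs_of_pos (hv0 t)]; ring
  have := sq_integral_mul_le (μ := volume) (f := fun t => |h t| * Real.sqrt (v t * ρ (y - t)))
    (g := fun t => Real.sqrt (v t * ρ (y - t)))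
    (by simpa only [e1] using integrable_mul_translate hρ.test hh.locallyIntegrable y)
    (by simpa only [e0] using integrable_mul_translate hρ.test hv.locallyIntegrable y)
    (by simpa only [e2] using integrable_mul_translate hρ.test hhv.abs.locallyIntegrable y)
  simp only [e0, e1, e2] at this
  exact this

theorem integral_mollify (hρ : IsMollifier ε ρ) (hf : Integrable f) :
    Integrable (mollify ρ f) ∧ ∫ y, mollify ρ f y = ∫ y, f y := by
  refine ⟨hf.integrable_convolution (ContinuousLinearMap.mul ℝ ℝ) hρ.test.integrable, ?_⟩
  have := integral_convolution (L := ContinuousLinearMap.mul ℝ ℝ) (μ := volume) (ν := volume) hf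
    hρ.test.integrable
  rw [mollify_eq_convolution, this]
  simp [hρ.integral_eq_one]

end Mollify

section WeakSolutions

variable {d : ℕ} {ε : ℝ} {f g h u v w V ρ χ G : Euc d → ℝ} {A : Fin d → Euc d → ℝ}

theorem pd_mul_exp (i : Fin d) (hV : ContDiff ℝ ∞ V) (hG : ContDiff ℝ ∞ G) (x : Euc d) :
    pd i (fun x => G x * Real.exp (V x)) x = (pd i G x + pd i V x * G x) * Real.exp (V x) := by
  have e := pd_mul_exp_neg i hV.neg hG x
  have e2 : pd i (fun x => -V x) x = - pd i V x := by
    simpa using pd_const_mul i (-1) hV x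
  simp only [neg_neg, dStar] at e
  rw [e, e2]; ring

theorem gradSq_nonneg (f : Euc d → ℝ) (x : Euc d) : 0 ≤ gradSq f x :=
  Finset.sum_nonneg fun _ _ => sq_nonneg _

theorem contDiff_gradSq (hf : ContDiff ℝ ∞ f) : ContDiff ℝ ∞ (gradSq f) :=
  ContDiff.sum fun i _ => (contDiff_pd i hf).pow 2

/-- Caccioppoli inequality for divergence-free fluxes. -/
theorem energy_le (hV : ContDiff ℝ ∞ V) (hG : ContDiff ℝ ∞ G) (hA : ∀ i, ContDiff ℝ ∞ (A i))
    (hdiv : ∀ y, ∑ i, (pd i (pd i G) y + pd i (A i) y) = 0) (hχ : IsTest χ) :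
    (1 / 2) * ∫ x, χ x ^ 2 * gradSq (fun x => G x * Real.exp (V x)) x * Real.exp (-V x) ≤
      ∫ x, (5 * gradSq χ x * G x ^ 2 * Real.exp (V x) +
        2 * χ x ^ 2 * (∑ i, (A i x - pd i V x * G x) ^ 2) * Real.exp (V x)) := by
  set g : Euc d → ℝ := fun x => G x * Real.exp (V x) with hgdef
  have hg : ContDiff ℝ ∞ g := hG.mul hV.exp
  have hχ2 : IsTest (fun x => χ x ^ 2) := by
    simpa only [pow_two] using IsTest.mul_left hχ.smooth hχ
  have hv : IsTest (fun x => g x * χ x ^ 2) := IsTest.mul_left hg hχ2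
  set r : Fin d → Euc d → ℝ := fun i x => A i x - pd i V x * G x with hr
  have hrs : ∀ i, ContDiff ℝ ∞ (r i) := fun i => (hA i).sub ((contDiff_pd i hV).mul hG)
  have hF : ∀ i x, pd i G x + A i x = Real.exp (-V x) * pd i g x + r i x := by
    intro i x
    rw [pd_mul_exp i hV hG, hr, Real.exp_neg]
    field_simp; ring
  have key : ∫ x, ∑ i, (pd i G x + A i x) * pd i (fun x => g x * χ x ^ 2) x = 0 := by
    rw [integral_finsetSum]
    · have : ∀ i, ∫ x, (pd i G x + A i x) * pd i (fun x => g x * χ x ^ 2) x =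
          -∫ x, (pd i (pd i G) x + pd i (A i) x) * (g x * χ x ^ 2) := by
        intro i
        rw [← neg_eq_iff_eq_neg, ← integral_pd_mul_eq_neg i ((contDiff_pd i hG).add (hA i)) hv]
        refine integral_congr_ae (Filter.Eventually.of_forall fun x => ?_)
        simp only [pd_add i (contDiff_pd i hG) (hA i)]
      simp only [this]
      rw [Finset.sum_neg_distrib, ← integral_finsetSum]
      · simp only [← Finset.sum_mul, hdiv]; simp
      · exact fun i _ => (IsTest.mul_left ((contDiff_pd i (contDiff_pd i hG)).add
          (contDiff_pd i (hA i))) hv).integrable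
    · exact fun i _ => (IsTest.mul_left ((contDiff_pd i hG).add (hA i)) (hv.pd i)).integrable
  have hpv : ∀ i x, pd i (fun x => g x * χ x ^ 2) x =
      χ x ^ 2 * pd i g x + 2 * χ x * pd i χ x * g x := by
    intro i x
    rw [pd_mul i hg hχ2.smooth, pd_sq i hχ.smooth]; ring
  have hptw : ∀ x, (1 / 2) * (χ x ^ 2 * gradSq g x * Real.exp (-V x)) ≤
      (5 * gradSq χ x * G x ^ 2 * Real.exp (V x) +
        2 * χ x ^ 2 * (∑ i, (r i x) ^ 2) * Real.exp (V x)) +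
      ∑ i, (pd i G x + A i x) * pd i (fun x => g x * χ x ^ 2) x := by
    intro x
    simp only [gradSq, Finset.mul_sum, Finset.sum_mul, ← Finset.sum_add_distrib]
    refine Finset.sum_le_sum fun i _ => ?_
    rw [hF, hpv]
    have hGg : G x = g x * Real.exp (-V x) := by
      rw [hgdef, Real.exp_neg]; field_simp
    rw [hGg]
    set s := Real.exp (-(V x) / 2) with hs
    have hs0 : 0 < s := Real.exp_pos _
    have e1 : Real.exp (-V x) = s ^ 2 := by
      rw [hs, ← Real.exp_nat_mul]; congr 1; push_cast; ring
    have e2 : Real.exp (V x) = (s⁻¹) ^ 2 := by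
      rw [inv_pow, ← e1, Real.exp_neg, inv_inv]
    rw [e1, e2]
    set q := r i x * s⁻¹ with hq
    have e3 : r i x = q * s := by rw [hq]; field_simp
    rw [e3]
    have e4 : (g x * s ^ 2) ^ 2 * s⁻¹ ^ 2 = g x ^ 2 * s ^ 2 := by field_simp
    have e5 : (q * s) ^ 2 * s⁻¹ ^ 2 = q ^ 2 := by field_simp
    have e6 : 5 * pd i χ x ^ 2 * (g x * s ^ 2) ^ 2 * s⁻¹ ^ 2 +
        2 * χ x ^ 2 * (q * s) ^ 2 * s⁻¹ ^ 2 =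
        5 * pd i χ x ^ 2 * (g x ^ 2 * s ^ 2) + 2 * χ x ^ 2 * q ^ 2 := by
      rw [← e4, ← e5]; ring
    rw [e6]
    nlinarith [sq_nonneg (1 / 2 * χ x * pd i g x * s + 2 * pd i χ x * g x * s),
      sq_nonneg (1 / 2 * χ x * pd i g x * s + χ x * q),
      sq_nonneg (pd i χ x * g x * s + χ x * q)]
  have I1 : Integrable fun x => 5 * gradSq χ x * G x ^ 2 * Real.exp (V x) +
        2 * χ x ^ 2 * (∑ i, (r i x) ^ 2) * Real.exp (V x) := by
    have h1 : IsTest (gradSq χ) := IsTest.sum _ fun i _ => by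
      simpa only [pow_two] using IsTest.mul_left (hχ.pd i).smooth (hχ.pd i)
    have h2 : IsTest (fun x => (5 * G x ^ 2 * Real.exp (V x)) * gradSq χ x +
        (2 * (∑ i, (r i x) ^ 2) * Real.exp (V x)) * χ x ^ 2) :=
      (IsTest.mul_left ((contDiff_const.mul (hG.pow 2)).mul hV.exp) h1).add
      (IsTest.mul_left ((contDiff_const.mul (ContDiff.sum fun i _ => (hrs i).pow 2)).mul hV.exp)
        hχ2)
    refine h2.integrable.congr (Filter.Eventually.of_forall fun x => ?_)
    simp only; ring
  have I2 : Integrable fun x => ∑ i, (pd i G x + A i x) * pd i (fun x => g x * χ x ^ 2) x :=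
    integrable_finsetSum _ fun i _ =>
      (IsTest.mul_left ((contDiff_pd i hG).add (hA i)) (hv.pd i)).integrable
  have I0 : Integrable fun x => χ x ^ 2 * gradSq g x * Real.exp (-V x) := by
    refine (IsTest.mul_left ((contDiff_gradSq hg).mul (contDiff_exp_neg hV))
      hχ2).integrable.congr (Filter.Eventually.of_forall fun x => ?_)
    simp only; ring
  rw [← integral_const_mul]
  refine (integral_mono (I0.const_mul _) (I1.add I2) hptw).trans ?_
  rw [integral_add' I1 I2, key, add_zero]

theorem exists_uniform_modulus {f : Euc d → ℝ} (hf : Continuous f) (R : ℝ) {δ : ℝ} (hδ : 0 < δ) :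
    ∃ ε > 0, ∀ y, ‖y‖ ≤ R → ∀ t, ‖y - t‖ < ε → |f t - f y| ≤ δ := by
  have hK : IsCompact (Metric.closedBall (0 : Euc d) (R + 1)) := isCompact_closedBall _ _
  have hu := hK.uniformContinuousOn_of_continuous hf.continuousOn
  rw [Metric.uniformContinuousOn_iff] at hu
  obtain ⟨ε, hε, h⟩ := hu δ hδ
  refine ⟨min ε 1, by positivity, fun y hy t hyt => ?_⟩
  have h1 : ‖t‖ ≤ ‖y‖ + ‖y - t‖ := by
    have := norm_sub_le y (y - t); simpa using this
  have := h t (by simp; linarith [hyt.trans_le (min_le_right ε 1)]) y (by simp; linarith)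
    (by rw [dist_comm, dist_eq_norm]; exact hyt.trans_le (min_le_left _ _))
  rw [Real.dist_eq] at this
  exact this.le

theorem IsMollifier.integral_translate (hρ : IsMollifier ε ρ) (y : Euc d) :
    ∫ t, ρ (y - t) = 1 := by
  rw [integral_sub_left_eq_self (fun t => ρ t) volume y]; exact hρ.integral_eq_one

/-- Weighted averages over small balls. -/
theorem IsMollifier.abs_mollify_sub_le (hρ : IsMollifier ε ρ) (hw : LocallyIntegrable w)
    (hf : Continuous f) {δ : ℝ} {y : Euc d} (h : ∀ t, ‖y - t‖ < ε → |f t - f y| ≤ δ) :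
    |mollify ρ (fun t => w t * f t) y - f y * mollify ρ w y| ≤
      δ * mollify ρ (fun t => |w t|) y := by
  have hw' : LocallyIntegrable fun t => |w t| := fun x =>
    let ⟨s, hs, hi⟩ := hw x
    ⟨s, hs, hi.norm⟩
  have i1 := integrable_mul_translate hρ.test (locallyIntegrable_mul_continuous hw hf) y
  have i2 := integrable_mul_translate hρ.test hw y
  have i3 := integrable_mul_translate hρ.test hw' y
  unfold mollify
  rw [← integral_const_mul, ← integral_const_mul, ← integral_sub i1 (i2.const_mul _)]
  refine abs_integral_le_integral_abs.trans ?_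
  refine integral_mono ((i1.sub (i2.const_mul _)).abs) (i3.const_mul _) fun t => ?_
  simp only
  rw [show w t * f t * ρ (y - t) - f y * (w t * ρ (y - t)) =
    (f t - f y) * (w t * ρ (y - t)) by ring, abs_mul, abs_mul (w t), abs_of_nonneg (hρ.nonneg _)]
  by_cases ht : ‖y - t‖ < ε
  · exact mul_le_mul_of_nonneg_right (h t ht) (mul_nonneg (abs_nonneg _) (hρ.nonneg _))
  · rw [hρ.eq_zero _ (not_lt.1 ht)]; simp

theorem IsMollifier.mollify_nonneg (hρ : IsMollifier ε ρ) (hf : ∀ t, 0 ≤ f t) (y : Euc d) :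
    0 ≤ mollify ρ f y :=
  integral_nonneg fun _ => mul_nonneg (hf _) (hρ.nonneg _)

theorem IsMollifier.exp_mul_mollify_le (hρ : IsMollifier ε ρ) (hV : Continuous V) {y : Euc d}
    (h : ∀ t, ‖y - t‖ < ε → |V t - V y| ≤ 1 / 2) :
    mollify ρ (fun t => Real.exp (-V t)) y * Real.exp (V y) ≤ 2 := by
  have hc : Continuous fun t => Real.exp (-V t) := by fun_prop
  have i1 := integrable_mul_translate hρ.test hc.locallyIntegrable y
  unfold mollify
  rw [← integral_mul_const]
  have h2 : Real.exp (1 / 2) ≤ 2 := by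
    have := Real.exp_one_lt_d9
    have e : Real.exp 1 = Real.exp (1 / 2) * Real.exp (1 / 2) := by rw [← Real.exp_add]; norm_num
    nlinarith [Real.exp_pos (1 / 2)]
  have i4 : Integrable fun t => 2 * ρ (y - t) :=
    (hρ.test.reflect y).integrable.const_mul 2
  calc _ ≤ ∫ t, 2 * ρ (y - t) := by
        refine integral_mono (i1.mul_const _) i4 fun t => ?_
        by_cases ht : ‖y - t‖ < ε
        · simp only
          rw [mul_right_comm, ← Real.exp_add]
          refine mul_le_mul_of_nonneg_right (le_trans (Real.exp_le_exp.2 ?_) h2) (hρ.nonneg _)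
          have := abs_le.1 (h t ht); linarith
        · simp [hρ.eq_zero _ (not_lt.1 ht)]
    _ = 2 := by rw [integral_const_mul, hρ.integral_translate]; norm_num

end WeakSolutions

section WeakSolutions

variable {d : ℕ} {ε : ℝ} {f g h u v w V ρ χ G : Euc d → ℝ}

/-- Cutoff functions at scale `S` with gradient of order `1 / S`. -/
theorem exists_cutoff (d : ℕ) : ∃ C : ℝ, 0 ≤ C ∧ ∀ S : ℝ, 1 ≤ S → ∃ χ : Euc d → ℝ, IsTest χ ∧
    (∀ x, 0 ≤ χ x ∧ χ x ≤ 1) ∧ (∀ x, ‖x‖ ≤ S → χ x = 1) ∧ (∀ x, 2 * S ≤ ‖x‖ → χ x = 0) ∧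
    (∀ x, gradSq χ x ≤ C / S ^ 2) ∧ ∀ x, 2 * S ≤ ‖x‖ → gradSq χ x = 0 := by
  let b : ContDiffBump (0 : Euc d) := ⟨1, 2, by norm_num, by norm_num⟩
  have hb : IsTest b := ⟨b.contDiff, b.hasCompactSupport⟩
  have hc : Continuous (gradSq b) := (contDiff_gradSq hb.smooth).continuous
  have hcs : HasCompactSupport (gradSq b) := by
    have h1 : IsTest (gradSq b) := IsTest.sum _ fun i _ => by
      simpa only [pow_two] using IsTest.mul_left (hb.pd i).smooth (hb.pd i)
    exact h1.compact
  obtain ⟨C, hC⟩ := hc.bounded_above_of_compact_support hcs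
  refine ⟨C, (norm_nonneg _).trans (hC 0), fun S hS => ?_⟩
  have hS0 : 0 < S := by linarith
  have hχ : IsTest (fun x : Euc d => b (S⁻¹ • x)) := by
    refine ⟨hb.smooth.comp (contDiff_const_smul _), ?_⟩
    exact hb.compact.comp_homeomorph (Homeomorph.smulOfNeZero S⁻¹ (by positivity))
  have hpd : ∀ i x, pd i (fun x : Euc d => b (S⁻¹ • x)) x = S⁻¹ * pd i b (S⁻¹ • x) := by
    intro i x
    unfold pd
    have h1 : HasFDerivAt (fun x : Euc d => S⁻¹ • x) (S⁻¹ • ContinuousLinearMap.id ℝ (Euc d)) x :=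
      (hasFDerivAt_id x).const_smul S⁻¹
    have h2 := (hb.smooth.differentiable (by simp) (S⁻¹ • x)).hasFDerivAt.comp x h1
    rw [show (fun x : Euc d => b (S⁻¹ • x)) = b ∘ fun x : Euc d => S⁻¹ • x from rfl, h2.fderiv]
    simp
  have hg : ∀ x, gradSq (fun x : Euc d => b (S⁻¹ • x)) x = gradSq b (S⁻¹ • x) / S ^ 2 := by
    intro x
    simp only [gradSq, hpd, mul_pow, ← Finset.mul_sum]
    field_simp
  have hn : ∀ x : Euc d, ‖S⁻¹ • x‖ = ‖x‖ / S := by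
    intro x; rw [norm_smul, Real.norm_of_nonneg (by positivity)]; field_simp
  refine ⟨_, hχ, fun x => ⟨b.nonneg, b.le_one⟩, fun x hx => ?_, fun x hx => ?_, fun x => ?_,
    fun x hx => ?_⟩
  · refine b.one_of_mem_closedBall ?_
    simp only [mem_closedBall_zero_iff, hn]
    rw [div_le_iff₀ hS0]; simpa [b] using hx
  · refine b.zero_of_le_dist ?_
    rw [dist_zero_right, hn, le_div_iff₀ hS0]; exact hx
  · rw [hg]
    gcongr
    exact (le_abs_self _).trans (hC _)
  · have hmin : ∀ i, pd i b (S⁻¹ • x) = 0 := by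
      intro i
      unfold pd
      have : IsLocalMin b (S⁻¹ • x) := by
        have h0 : b (S⁻¹ • x) = 0 := by
          refine b.zero_of_le_dist ?_
          rw [dist_zero_right, hn, le_div_iff₀ hS0]; exact hx
        refine Filter.Eventually.of_forall fun y => ?_
        rw [h0]; exact b.nonneg
      rw [this.fderiv_eq_zero]; simp
    rw [hg]; simp [gradSq, hmin]

/-- A weak solution `h` in `L²(e^{-V})` of `L h = 0` has vanishing distributional gradient. -/
theorem integral_mul_pd_eq_zero_of_weak (hV : ContDiff ℝ ∞ V)
    (hω : Integrable fun x => Real.exp (-V x))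
    (hh : Integrable fun x => h x ^ 2 * Real.exp (-V x))
    (hw : Integrable fun x => h x * Real.exp (-V x))
    (horth : ∀ u, IsTest u → ∫ x, h x * Real.exp (-V x) * lap V u x = 0)
    (hv : IsTest v) (i : Fin d) : ∫ x, h x * pd i v x = 0 := by
  obtain ⟨C, hC0, hC⟩ := exists_cutoff d
  set H := ∫ x, h x ^ 2 * Real.exp (-V x)
  set W := ∫ x, |h x * Real.exp (-V x)|
  have hH0 : 0 ≤ H := integral_nonneg fun x => by positivity
  have hW0 : 0 ≤ W := integral_nonneg fun x => abs_nonneg _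
  set B := ∫ x, v x ^ 2 * Real.exp (V x)
  have hB0 : 0 ≤ B := integral_nonneg fun x => by positivity
  have hψ : IsTest (fun x => Real.exp (V x) * pd i v x) := IsTest.mul_left hV.exp (hv.pd i)
  obtain ⟨R, hR⟩ := hv.compact.isCompact.isBounded.subset_closedBall 0
  have hvR : ∀ x, R < ‖x‖ → v x = 0 := by
    intro x hx
    by_contra hne
    have := hR (subset_tsupport v hne)
    simp at this; linarith
  -- the main estimate
  have main : ∀ S : ℝ, 1 ≤ S → R ≤ S →
      |∫ x, h x * pd i v x| ≤ Real.sqrt ((20 * C + 8 * d) * H / S ^ 2 * B) + W / S := by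
    intro S hS hRS
    have hS0 : 0 < S := by linarith
    obtain ⟨χ, hχ, hχ01, hχ1, hχ2, hχ3, hχ4⟩ := hC S hS
    obtain ⟨ε₁, hε₁, h1⟩ := exists_uniform_modulus hV.continuous (2 * S) (δ := 1 / 2) (by norm_num)
    have h2 : ∃ ε > 0, ∀ j, ∀ y, ‖y‖ ≤ 2 * S → ∀ t, ‖y - t‖ < ε →
        |pd j V t - pd j V y| ≤ 1 / S := by
      choose e he hh using fun j => exists_uniform_modulus (contDiff_pd j hV).continuous (2 * S)
        (δ := 1 / S) (by positivity)
      obtain ⟨ε, hε, hle⟩ : ∃ ε > 0, ∀ j, ε ≤ e j := by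
        rcases isEmpty_or_nonempty (Fin d) with hd | hd
        · exact ⟨1, one_pos, fun j => (hd.false j).elim⟩
        · obtain ⟨j, hj⟩ := Finite.exists_min e
          exact ⟨e j, he j, hj⟩
      exact ⟨ε, hε, fun j y hy t ht => hh j y hy t (ht.trans_le (hle j))⟩
    obtain ⟨ε₂, hε₂, h2⟩ := h2
    have huc : UniformContinuous (fun x => Real.exp (V x) * pd i v x) :=
      hψ.compact.uniformContinuous_of_continuous hψ.smooth.continuous
    rw [Metric.uniformContinuous_iff] at huc
    obtain ⟨ε₃, hε₃, h3⟩ := huc (1 / S) (by positivity)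
    set ε := min ε₁ (min ε₂ ε₃) with hε
    have hε0 : 0 < ε := by positivity
    let φ : ContDiffBump (0 : Euc d) := ⟨ε / 2, ε, by positivity, by linarith⟩
    set ρ := φ.normed volume
    have hρ : IsMollifier ε ρ := isMollifier_normed φ
    set w := fun x => h x * Real.exp (-V x) with hwdef
    set G := mollify ρ w
    set A : Fin d → Euc d → ℝ := fun j => mollify ρ fun t => w t * pd j V t
    have hwl : LocallyIntegrable w := hw.locallyIntegrable
    have hG : ContDiff ℝ ∞ G := contDiff_mollify hρ.test hwl
    have hA : ∀ j, ContDiff ℝ ∞ (A j) := fun j => contDiff_mollify hρ.test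
      (locallyIntegrable_mul_continuous hwl (contDiff_pd j hV).continuous)
    have hen := energy_le hV hG hA (sum_pd_mollify_eq_zero hV hwl hρ.test horth) hχ
    have hg : ContDiff ℝ ∞ fun x => G x * Real.exp (V x) := hG.mul hV.exp
    obtain ⟨hmi, hme⟩ := integral_mollify hρ hh
    set m := mollify ρ fun x => h x ^ 2 * Real.exp (-V x)
    have hm0 : ∀ x, 0 ≤ m x := hρ.mollify_nonneg fun t => by positivity
    have hsq : ∀ y, ‖y‖ ≤ 2 * S →
        mollify ρ (fun t => |w t|) y ^ 2 * Real.exp (V y) ≤ 2 * m y := by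
      intro y hy
      have a1 := mollify_abs_sq_le hρ hh hω (fun t => Real.exp_pos _) hw y
      have a2 := hρ.exp_mul_mollify_le hV.continuous (y := y)
        fun t ht => h1 y hy t (ht.trans_le (min_le_left _ _))
      calc _ ≤ m y * mollify ρ (fun t => Real.exp (-V t)) y * Real.exp (V y) := by
            gcongr
        _ = m y * (mollify ρ (fun t => Real.exp (-V t)) y * Real.exp (V y)) := by ring
        _ ≤ m y * 2 := mul_le_mul_of_nonneg_left a2 (hm0 y)
        _ = _ := by ring
    have hGle : ∀ y, |G y| ≤ mollify ρ (fun t => |w t|) y := by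
      intro y
      refine abs_integral_le_integral_abs.trans (le_of_eq ?_)
      refine integral_congr_ae (Filter.Eventually.of_forall fun t => ?_)
      simp only [abs_mul, abs_of_nonneg (hρ.nonneg _)]
    have hrhs : ∀ y, 5 * gradSq χ y * G y ^ 2 * Real.exp (V y) +
        2 * χ y ^ 2 * (∑ j, (A j y - pd j V y * G y) ^ 2) * Real.exp (V y) ≤
        (10 * C + 4 * d) / S ^ 2 * m y := by
      intro y
      by_cases hy : ‖y‖ ≤ 2 * S
      · have b1 : G y ^ 2 * Real.exp (V y) ≤ 2 * m y := by
          refine le_trans ?_ (hsq y hy)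
          gcongr ?_ * _
          exact sq_le_sq' (by linarith [neg_abs_le (G y), hGle y])
            ((le_abs_self _).trans (hGle y))
        have b2 : ∀ j, (A j y - pd j V y * G y) ^ 2 * Real.exp (V y) ≤ 2 * m y / S ^ 2 := by
          intro j
          have := hρ.abs_mollify_sub_le hwl (contDiff_pd j hV).continuous (δ := 1 / S) (y := y)
            fun t ht => h2 j y hy t (ht.trans_le ((min_le_right _ _).trans (min_le_left _ _)))
          calc _ ≤ (1 / S * mollify ρ (fun t => |w t|) y) ^ 2 * Real.exp (V y) := by
                gcongr ?_ * _
                rw [← sq_abs]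
                exact pow_le_pow_left₀ (abs_nonneg _) this 2
            _ = (mollify ρ (fun t => |w t|) y ^ 2 * Real.exp (V y)) / S ^ 2 := by
                field_simp
            _ ≤ _ := div_le_div_of_nonneg_right (hsq y hy) (by positivity)
        have b3 : (∑ j, (A j y - pd j V y * G y) ^ 2) * Real.exp (V y) ≤
            d * (2 * m y / S ^ 2) := by
          rw [Finset.sum_mul]
          refine (Finset.sum_le_sum fun j _ => b2 j).trans ?_
          simp
        have b4 : χ y ^ 2 ≤ 1 := by
          have := hχ01 y; nlinarith
        have hs0 : 0 ≤ (∑ j, (A j y - pd j V y * G y) ^ 2) * Real.exp (V y) := by positivity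
        calc _ = 5 * gradSq χ y * (G y ^ 2 * Real.exp (V y)) +
              2 * χ y ^ 2 * ((∑ j, (A j y - pd j V y * G y) ^ 2) * Real.exp (V y)) := by ring
          _ ≤ 5 * (C / S ^ 2) * (2 * m y) + 2 * 1 * (d * (2 * m y / S ^ 2)) := by
              have := gradSq_nonneg χ y
              have := hm0 y
              gcongr
              exact hχ3 y
          _ = _ := by ring
      · rw [hχ4 y (by linarith), hχ2 y (by linarith)]
        have := hm0 y
        simp; positivity
    have hE : ∫ x, χ x ^ 2 * gradSq (fun x => G x * Real.exp (V x)) x * Real.exp (-V x) ≤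
        (20 * C + 8 * d) * H / S ^ 2 := by
      have : ∫ x, (5 * gradSq χ x * G x ^ 2 * Real.exp (V x) +
          2 * χ x ^ 2 * (∑ i, (A i x - pd i V x * G x) ^ 2) * Real.exp (V x)) ≤
          (10 * C + 4 * d) / S ^ 2 * H := by
        rw [show H = ∫ y, m y from hme.symm, ← integral_const_mul]
        refine integral_mono_of_nonneg (Filter.Eventually.of_forall fun x => ?_) (hmi.const_mul _)
          (Filter.Eventually.of_forall hrhs)
        have := gradSq_nonneg χ x
        simp only [Pi.zero_apply]
        positivity
      have e : (20 * C + 8 * d) * H / S ^ 2 = 2 * ((10 * C + 4 * d) / S ^ 2 * H) := by ring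
      rw [e]; linarith
    -- pairing of the mollified function with the test function
    have hpair : |∫ x, (G x * Real.exp (V x)) * pd i v x| ≤
        Real.sqrt ((20 * C + 8 * d) * H / S ^ 2 * B) := by
      have hip := integral_pd_mul_eq_neg i hg hv
      rw [← abs_neg, ← hip]
      refine Real.abs_le_sqrt ?_
      set p := pd i fun x => G x * Real.exp (V x) with hp
      have hps : ContDiff ℝ ∞ p := contDiff_pd i hg
      have e1 : ∀ x, p x * v x = (χ x * p x * Real.exp (-V x / 2)) * (v x * Real.exp (V x / 2)) := by
        intro x
        have : Real.exp (-V x / 2) * Real.exp (V x / 2) = 1 := by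
          rw [← Real.exp_add]; simp [neg_div]
        have hx : χ x * v x = v x := by
          by_cases hx : ‖x‖ ≤ S
          · rw [hχ1 x hx, one_mul]
          · rw [hvR x (by linarith)]; simp
        calc p x * v x = p x * (χ x * v x) * (Real.exp (-V x / 2) * Real.exp (V x / 2)) := by
              rw [this, hx]; ring
          _ = _ := by ring
      have e2 : ∀ x, (χ x * p x * Real.exp (-V x / 2)) ^ 2 = χ x ^ 2 * p x ^ 2 * Real.exp (-V x) := by
        intro x
        rw [mul_pow, mul_pow, ← Real.exp_nat_mul]; congr 2; push_cast; ring
      have e3 : ∀ x, (v x * Real.exp (V x / 2)) ^ 2 = v x ^ 2 * Real.exp (V x) := by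
        intro x
        rw [mul_pow, ← Real.exp_nat_mul]; congr 2; push_cast; ring
      have j2 : Integrable fun x => χ x ^ 2 * p x ^ 2 * Real.exp (-V x) := by
        refine (IsTest.mul_left ((hps.pow 2).mul ((contDiff_exp_neg hV).mul hχ.smooth))
          hχ).integrable.congr (Filter.Eventually.of_forall fun x => ?_)
        simp only; ring
      have j3 : Integrable fun x => v x ^ 2 * Real.exp (V x) := by
        refine (IsTest.mul_left (hV.exp.mul hv.smooth) hv).integrable.congr
          (Filter.Eventually.of_forall fun x => ?_)
        simp only; ring
      have cs := sq_integral_mul_le (μ := volume) (f := fun x => χ x * p x * Real.exp (-V x / 2))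
        (g := fun x => v x * Real.exp (V x / 2)) (by simpa only [e2] using j2)
        (by simpa only [e3] using j3) (by
          simpa only [← e1] using (IsTest.mul_left hps hv).integrable)
      simp only [← e1, e2, e3] at cs
      refine cs.trans (mul_le_mul_of_nonneg_right (le_trans ?_ hE) hB0)
      refine integral_mono j2 ?_ fun x => ?_
      · refine (IsTest.mul_left ((contDiff_gradSq hg).mul ((contDiff_exp_neg hV).mul hχ.smooth))
          hχ).integrable.congr (Filter.Eventually.of_forall fun x => ?_)
        simp only; ring
      · simp only
        gcongr
        exact Finset.single_le_sum (f := fun j => pd j (fun x => G x * Real.exp (V x)) x ^ 2)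
          (fun j _ => sq_nonneg _) (Finset.mem_univ i)
    have hdiff : |(∫ x, (G x * Real.exp (V x)) * pd i v x) - ∫ x, h x * pd i v x| ≤ W / S := by
      set ψ := fun x => Real.exp (V x) * pd i v x with hψdef
      have k1 : ∫ x, h x * pd i v x = ∫ t, w t * ψ t := by
        refine integral_congr_ae (Filter.Eventually.of_forall fun t => ?_)
        simp only [hwdef, hψdef, Real.exp_neg]
        field_simp
      have hjoint : Integrable (fun p : Euc d × Euc d => w p.2 * ρ (p.1 - p.2) * ψ p.1)
          (volume.prod volume) := by
        have := hw.convolution_integrand (ContinuousLinearMap.mul ℝ ℝ) (μ := volume) (ν := volume)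
          hρ.test.integrable
        obtain ⟨M, hM⟩ := hψ.smooth.continuous.bounded_above_of_compact_support hψ.compact
        exact this.mul_bdd (c := M) (hψ.smooth.continuous.comp continuous_fst).aestronglyMeasurable
          (Filter.Eventually.of_forall fun p => hM p.1)
      have k2 : ∫ x, (G x * Real.exp (V x)) * pd i v x =
          ∫ t, ∫ y, w t * ρ (y - t) * ψ y := by
        rw [← integral_integral_swap hjoint]
        refine integral_congr_ae (Filter.Eventually.of_forall fun y => ?_)
        simp only
        rw [integral_mul_const, mul_assoc]
        rfl
      have hinner : Integrable fun t => ∫ y, w t * ρ (y - t) * ψ y := hjoint.integral_prod_right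
      have hwψ : Integrable fun t => w t * ψ t := by
        obtain ⟨M, hM⟩ := hψ.smooth.continuous.bounded_above_of_compact_support hψ.compact
        exact hw.mul_bdd (c := M) hψ.smooth.continuous.aestronglyMeasurable
          (Filter.Eventually.of_forall hM)
      rw [k1, k2, ← integral_sub hinner hwψ]
      refine abs_integral_le_integral_abs.trans ?_
      rw [div_eq_mul_inv, ← integral_mul_const]
      refine integral_mono (hinner.sub hwψ).abs (hw.abs.mul_const _) fun t => ?_
      simp only
      have hρt : ∫ y, ρ (y - t) = 1 := by
        rw [integral_sub_right_eq_self (fun t => ρ t) t]; exact hρ.integral_eq_one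
      have hρti : Integrable fun y => ρ (y - t) := hρ.test.integrable.comp_sub_right t
      have hρψ : Integrable fun y => ρ (y - t) * ψ y := by
        obtain ⟨M, hM⟩ := hψ.smooth.continuous.bounded_above_of_compact_support hψ.compact
        exact hρti.mul_bdd (c := M) hψ.smooth.continuous.aestronglyMeasurable
          (Filter.Eventually.of_forall hM)
      have e : (∫ y, w t * ρ (y - t) * ψ y) - w t * ψ t =
          w t * ∫ y, ρ (y - t) * (ψ y - ψ t) := by
        have : ∀ y, ρ (y - t) * (ψ y - ψ t) = ρ (y - t) * ψ y - ρ (y - t) * ψ t :=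
          fun y => by ring
        simp only [this]
        rw [integral_sub hρψ (hρti.mul_const _), integral_mul_const, hρt]
        simp only [mul_assoc]
        rw [integral_const_mul]; ring
      rw [e, abs_mul]
      refine mul_le_mul_of_nonneg_left ?_ (abs_nonneg _)
      refine abs_integral_le_integral_abs.trans ?_
      rw [← one_mul S⁻¹, ← hρt, ← integral_mul_const]
      refine integral_mono_of_nonneg (Filter.Eventually.of_forall fun y => abs_nonneg _)
        (hρti.mul_const _) (Filter.Eventually.of_forall fun y => ?_)
      simp only
      rw [abs_mul, abs_of_nonneg (hρ.nonneg _)]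
      by_cases hy : ‖y - t‖ < ε
      · refine mul_le_mul_of_nonneg_left ?_ (hρ.nonneg _)
        have := h3 (a := y) (b := t) (by
          rw [dist_eq_norm]
          exact hy.trans_le ((min_le_right _ _).trans (min_le_right _ _)))
        rw [Real.dist_eq, one_div] at this
        exact this.le
      · rw [hρ.eq_zero _ (not_lt.1 hy)]; simp
    have := abs_sub_abs_le_abs_sub (∫ x, h x * pd i v x) (∫ x, (G x * Real.exp (V x)) * pd i v x)
    rw [abs_sub_comm] at this
    linarith
  have hlim : Filter.Tendsto (fun S : ℝ =>
      Real.sqrt ((20 * C + 8 * d) * H / S ^ 2 * B) + W / S) Filter.atTop (nhds 0) := by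
    have t1 : Filter.Tendsto (fun S : ℝ => (20 * C + 8 * d) * H / S ^ 2 * B) Filter.atTop
        (nhds (0 * B)) :=
      (Filter.Tendsto.const_div_atTop (Filter.tendsto_pow_atTop two_ne_zero) _).mul_const B
    have t2 := (Real.continuous_sqrt.tendsto _).comp t1
    have t3 : Filter.Tendsto (fun S : ℝ => W / S) Filter.atTop (nhds 0) :=
      Filter.Tendsto.const_div_atTop Filter.tendsto_id _
    have := t2.add t3
    simpa using this
  have : |∫ x, h x * pd i v x| ≤ 0 := ge_of_tendsto hlim (by
    filter_upwards [Filter.eventually_ge_atTop 1, Filter.eventually_ge_atTop R] with S h1 h2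
    exact main S h1 h2)
  exact abs_eq_zero.1 (le_antisymm this (abs_nonneg _))

end WeakSolutions

section Density

variable {d : ℕ} {f g h u v w V ρ : Euc d → ℝ}

theorem ae_eq_const_of_integral_mul_pd (hh : LocallyIntegrable h)
    (h0 : ∀ v, IsTest v → ∀ i, ∫ x, h x * pd i v x = 0) :
    ∃ c : ℝ, ∀ᵐ x, h x = c := by
  let φ : ℕ → ContDiffBump (0 : Euc d) := fun n =>
    ⟨1 / (2 * (n + 1)), 1 / (n + 1), by positivity, by
      apply one_div_lt_one_div_of_lt <;> [positivity; linarith [Nat.cast_nonneg (α := ℝ) n]]⟩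
  have hφ : Filter.Tendsto (fun n => (φ n).rOut) Filter.atTop (nhds 0) :=
    tendsto_one_div_add_atTop_nhds_zero_nat
  have hφ2 : ∀ᶠ n in Filter.atTop, (φ n).rOut ≤ 2 * (φ n).rIn := by
    refine Filter.Eventually.of_forall fun n => le_of_eq ?_
    simp only [φ]; field_simp
  have hlim := ContDiffBump.ae_convolution_tendsto_right_of_locallyIntegrable (μ := volume)
    hφ hφ2 hh
  have hconst : ∀ n x, convolution ((φ n).normed volume) h (ContinuousLinearMap.lsmul ℝ ℝ)
      volume x = mollify ((φ n).normed volume) h 0 := by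
    intro n x
    set ρ := (φ n).normed volume
    have hρ : IsMollifier _ ρ := isMollifier_normed (φ n)
    have e : convolution ρ h (ContinuousLinearMap.lsmul ℝ ℝ) volume x = mollify ρ h x := by
      rw [mollify, convolution_def, ← integral_sub_left_eq_self _ volume x]
      refine integral_congr_ae (Filter.Eventually.of_forall fun t => ?_)
      simp [mul_comm]
    rw [e]
    have hs := contDiff_mollify hρ.test hh
    refine is_const_of_fderiv_eq_zero (𝕜 := ℝ) (hs.differentiable (by simp)) (fun y => ?_) x 0
    ext v
    rw [fderiv_apply_eq_sum]
    refine Finset.sum_eq_zero fun i _ => ?_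
    rw [pd_mollify i hρ.test hh]
    have := h0 _ (hρ.test.reflect y) i
    simp only [pd_reflect i hρ.test.smooth, mul_neg, integral_neg, neg_eq_zero] at this
    rw [mollify, this, mul_zero]
  simp only [hconst] at hlim
  obtain ⟨x₀, hx₀⟩ := hlim.exists
  exact ⟨h x₀, hlim.mono fun x hx => tendsto_nhds_unique hx hx₀⟩

theorem lap_add (hu : ContDiff ℝ ∞ u) (hv : ContDiff ℝ ∞ v) (x : Euc d) :
    lap V (fun x => u x + v x) x = lap V u x + lap V v x := by
  simp only [lap, dStar, ← Finset.sum_add_distrib]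
  refine Finset.sum_congr rfl fun i _ => ?_
  rw [show pd i (fun x => u x + v x) = fun x => pd i u x + pd i v x from
    funext fun x => pd_add i hu hv x, pd_add i (contDiff_pd i hu) (contDiff_pd i hv)]
  ring

theorem lap_const_mul (c : ℝ) (hu : ContDiff ℝ ∞ u) (x : Euc d) :
    lap V (fun x => c * u x) x = c * lap V u x := by
  simp only [lap, dStar, Finset.mul_sum]
  refine Finset.sum_congr rfl fun i _ => ?_
  rw [show pd i (fun x => c * u x) = fun x => c * pd i u x from
    funext fun x => pd_const_mul i c hu x, pd_const_mul i c (contDiff_pd i hu)]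
  ring

/-- The range of the generator on test functions is dense among centred functions. -/
theorem exists_lap_approx (hV : ContDiff ℝ ∞ V) (hω : Integrable fun x => Real.exp (-V x))
    (hfm : AEStronglyMeasurable f) (hf : Integrable fun x => f x ^ 2 * Real.exp (-V x))
    (hf0 : ∫ x, f x * Real.exp (-V x) = 0) {ε : ℝ} (hε : 0 < ε) :
    ∃ u, IsTest u ∧ ∫ x, (f x - lap V u x) ^ 2 * Real.exp (-V x) < ε := by
  set s : Euc d → ℝ := fun x => Real.exp (-V x / 2) with hs
  have hs2 : ∀ x, s x ^ 2 = Real.exp (-V x) := fun x => by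
    rw [hs, ← Real.exp_nat_mul]; congr 1; push_cast; ring
  have hs0 : ∀ x, 0 < s x := fun x => Real.exp_pos _
  have hsc : ContDiff ℝ ∞ s := (hV.neg.div_const 2).exp
  have mem : ∀ k : Euc d → ℝ, AEStronglyMeasurable k →
      Integrable (fun x => k x ^ 2 * Real.exp (-V x)) → MemLp (fun x => k x * s x) 2 volume := by
    intro k hk hki
    refine (memLp_two_iff_integrable_sq (hk.mul hsc.continuous.aestronglyMeasurable)).2 ?_
    simpa only [Pi.mul_apply, mul_pow, hs2] using hki
  have hlap : ∀ u, IsTest u → MemLp (fun x => lap V u x * s x) 2 volume := fun u hu =>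
    mem _ (hu.lap hV).smooth.continuous.aestronglyMeasurable (by
      have h1 := (IsTest.mul_left (hu.lap hV).smooth (hu.lap hV)).mul_exp_neg hV
      simpa only [pow_two] using h1.integrable)
  let S : Submodule ℝ (Lp ℝ 2 (volume : Measure (Euc d))) :=
    { carrier := {φ | ∃ u, IsTest u ∧ φ =ᵐ[volume] fun x => lap V u x * s x}
      zero_mem' := ⟨fun _ => 0, isTest_zero, by
        filter_upwards [Lp.coeFn_zero ℝ 2 (volume : Measure (Euc d))] with x hx
        have h0 : lap V (fun _ : Euc d => (0 : ℝ)) x = 0 := by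
          simpa using lap_const_mul (V := V) 0 (u := fun _ : Euc d => (0 : ℝ)) contDiff_const x
        rw [hx, h0]; simp⟩
      add_mem' := by
        rintro a b ⟨u, hu, hau⟩ ⟨v, hv, hbv⟩
        refine ⟨_, hu.add hv, ?_⟩
        filter_upwards [hau, hbv, Lp.coeFn_add a b] with x h1 h2 h3
        rw [h3, Pi.add_apply, h1, h2, lap_add hu.smooth hv.smooth]; ring
      smul_mem' := by
        rintro c a ⟨u, hu, hau⟩
        refine ⟨_, hu.const_mul c, ?_⟩
        filter_upwards [hau, Lp.coeFn_smul c a] with x h1 h2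
        rw [h2, Pi.smul_apply, h1, lap_const_mul c hu.smooth, smul_eq_mul]; ring }
  set F := (mem f hfm hf).toLp
  have hFc := (mem f hfm hf).coeFn_toLp
  have hF : F ∈ Sᗮᗮ := by
    rw [Submodule.mem_orthogonal]
    intro k hk
    rw [Submodule.mem_orthogonal] at hk
    have hk2 : Integrable fun x => k x ^ 2 :=
      (memLp_two_iff_integrable_sq (Lp.aestronglyMeasurable k)).1 (Lp.memLp k)
    set h : Euc d → ℝ := fun x => k x * (s x)⁻¹ with hh
    have hks : ∀ x, k x = h x * s x := fun x => by
      rw [hh]; field_simp [(hs0 x).ne']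
    have hcont : Continuous fun x => (s x)⁻¹ := hsc.continuous.inv₀ fun x => (hs0 x).ne'
    have hhm : AEStronglyMeasurable h volume :=
      (Lp.aestronglyMeasurable k).mul hcont.aestronglyMeasurable
    have hhi : Integrable fun x => h x ^ 2 * Real.exp (-V x) := by
      simpa only [hks, mul_pow, hs2] using hk2
    have hw : Integrable fun x => h x * Real.exp (-V x) := by
      refine (hhi.add hω).mono'
        (hhm.mul (contDiff_exp_neg hV).continuous.aestronglyMeasurable)
        (Filter.Eventually.of_forall fun x => ?_)
      rw [Real.norm_eq_abs, abs_mul, abs_of_pos (Real.exp_pos _)]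
      simp only [Pi.add_apply]
      have : |h x| ≤ h x ^ 2 + 1 := by
        rw [← sq_abs]; nlinarith [sq_nonneg (|h x| - 1), abs_nonneg (h x)]
      nlinarith [Real.exp_pos (-V x)]
    have horth : ∀ u, IsTest u → ∫ x, h x * Real.exp (-V x) * lap V u x = 0 := by
      intro u hu
      have := hk (hlap u hu).toLp ⟨u, hu, (hlap u hu).coeFn_toLp⟩
      rw [L2.inner_def] at this
      rw [← this]
      refine integral_congr_ae ?_
      filter_upwards [(hlap u hu).coeFn_toLp] with x hx
      rw [hx, hks, ← hs2]
      simp; ring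
    have hloc : LocallyIntegrable h := by
      have := locallyIntegrable_mul_continuous hw.locallyIntegrable hV.exp.continuous
      refine this.congr (Filter.Eventually.of_forall fun x => ?_)
      simp only [Real.exp_neg]; field_simp
    obtain ⟨c, hc⟩ := ae_eq_const_of_integral_mul_pd hloc fun v hv i =>
      integral_mul_pd_eq_zero_of_weak hV hω hhi hw horth hv i
    rw [L2.inner_def]
    have : ∫ x, inner ℝ (k x) (F x) = ∫ x, c * (f x * Real.exp (-V x)) := by
      refine integral_congr_ae ?_
      filter_upwards [hFc, hc] with x hx hcx
      rw [hx, hks, hcx, ← hs2]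
      simp; ring
    rw [this, integral_const_mul, hf0, mul_zero]
  rw [Submodule.orthogonal_orthogonal_eq_closure, ← SetLike.mem_coe,
    Submodule.topologicalClosure_coe, Metric.mem_closure_iff] at hF
  obtain ⟨b, ⟨u, hu, hbu⟩, hb⟩ := hF (Real.sqrt ε) (by positivity)
  refine ⟨u, hu, ?_⟩
  rw [dist_eq_norm] at hb
  have hb2 : ‖F - b‖ ^ 2 < ε := by
    have := Real.sq_sqrt hε.le
    nlinarith [norm_nonneg (F - b), Real.sqrt_nonneg ε]
  rw [← real_inner_self_eq_norm_sq, L2.inner_def] at hb2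
  refine lt_of_eq_of_lt (integral_congr_ae ?_) hb2
  filter_upwards [hFc, hbu, Lp.coeFn_sub F b] with x h1 h2 h3
  rw [h3, Pi.sub_apply, h1, h2, ← hs2]
  simp; ring

end Density

/-- `V` is a smooth even potential with Hessian at least the identity, normalised so that
`e^{-V}` is a probability density. -/
structure IsPotential {d : ℕ} (V : Euc d → ℝ) : Prop where
  smooth : ContDiff ℝ ∞ V
  even : ∀ x, V (-x) = V x
  convex : ∀ x y, V ((1 / 2 : ℝ) • (x + y)) + ‖x - y‖ ^ 2 / 8 ≤ (V x + V y) / 2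
  integral_eq_one : ∫ x, Real.exp (-V x) = 1

section Poincare

variable {d : ℕ} {f g h u v w V ρ : Euc d → ℝ} {k a σ : ℝ}

theorem integrable_norm_pow_mul_gaussian (n : ℕ) {b : ℝ} (hb : 0 < b) :
    Integrable fun x : Euc d => ‖x‖ ^ n * Real.exp (-b * ‖x‖ ^ 2) := by
  have h1 : Integrable fun x : Euc d => Real.exp (-(b / 2) * ‖x‖ ^ 2) := by
    have := GaussianFourier.integrable_cexp_neg_mul_sq_norm_add (V := Euc d) (b := ((b / 2 : ℝ) : ℂ))
      (by simpa using hb) 0 0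
    have h2 := this.norm
    refine h2.congr (Filter.Eventually.of_forall fun x => ?_)
    simp only [Complex.norm_exp]
    congr 1
    simp [← Complex.ofReal_pow]
  have hbd : ∃ M : ℝ, ∀ r : ℝ, 0 ≤ r → r ^ n * Real.exp (-(b / 2) * r ^ 2) ≤ M := by
    have hc : Continuous fun r : ℝ => r ^ n * Real.exp (-(b / 2) * r ^ 2) := by fun_prop
    have hl : Filter.Tendsto (fun r : ℝ => r ^ n * Real.exp (-(b / 2) * r ^ 2)) Filter.atTop
        (nhds 0) := by
      have := (tendsto_rpow_abs_mul_exp_neg_mul_sq_cocompact (a := b / 2) (by positivity) (n : ℝ))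
      have h2 := this.mono_left atTop_le_cocompact
      refine h2.congr' ?_
      filter_upwards [Filter.eventually_ge_atTop 0] with r hr
      rw [abs_of_nonneg hr, Real.rpow_natCast]
    obtain ⟨R, hR⟩ := (Filter.eventually_atTop.1 (hl.eventually (gt_mem_nhds (zero_lt_one' ℝ))))
    obtain ⟨M, hM⟩ := (isCompact_Icc (a := (0 : ℝ)) (b := R)).bddAbove_image hc.continuousOn
    refine ⟨max M 1, fun r hr => ?_⟩
    rcases le_total r R with h | h
    · exact (hM ⟨r, ⟨hr, h⟩, rfl⟩).trans (le_max_left _ _)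
    · exact (hR r h).le.trans (le_max_right _ _)
  obtain ⟨M, hM⟩ := hbd
  refine (h1.const_mul M).mono' (by fun_prop) (Filter.Eventually.of_forall fun x => ?_)
  rw [Real.norm_of_nonneg (by positivity)]
  have : Real.exp (-b * ‖x‖ ^ 2) = Real.exp (-(b / 2) * ‖x‖ ^ 2) * Real.exp (-(b / 2) * ‖x‖ ^ 2) := by
    rw [← Real.exp_add]; congr 1; ring
  rw [this, ← mul_assoc]
  exact mul_le_mul_of_nonneg_right (hM _ (norm_nonneg _)) (Real.exp_pos _).le

namespace IsPotential

theorem exp_neg_le (hV : IsPotential V) (x : Euc d) :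
    Real.exp (-V x) ≤ Real.exp (-V 0) * Real.exp (-(1 / 2) * ‖x‖ ^ 2) := by
  rw [← Real.exp_add]
  refine Real.exp_le_exp.2 ?_
  have h := hV.convex x (-x)
  rw [hV.even, add_neg_cancel, smul_zero, sub_neg_eq_add, ← two_smul ℝ x, norm_smul] at h
  norm_num at h
  nlinarith

/-- Functions of polynomial growth are integrable against `e^{-V}`. -/
theorem integrable_mul (hV : IsPotential V) (hf : Continuous f) {C : ℝ} {n : ℕ}
    (h : ∀ x, |f x| ≤ C * ‖x‖ ^ n) : Integrable fun x => f x * Real.exp (-V x) := by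
  refine ((integrable_norm_pow_mul_gaussian (d := d) n (b := 1 / 2) (by norm_num)).const_mul
    (|C| * Real.exp (-V 0))).mono'
    (hf.mul (contDiff_exp_neg hV.smooth).continuous).aestronglyMeasurable
    (Filter.Eventually.of_forall fun x => ?_)
  rw [Real.norm_eq_abs, abs_mul, abs_of_pos (Real.exp_pos _)]
  have h1 : |f x| ≤ |C| * ‖x‖ ^ n :=
    (h x).trans (mul_le_mul_of_nonneg_right (le_abs_self C) (by positivity))
  calc _ ≤ (|C| * ‖x‖ ^ n) * (Real.exp (-V 0) * Real.exp (-(1 / 2) * ‖x‖ ^ 2)) :=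
        mul_le_mul h1 (hV.exp_neg_le x) (Real.exp_pos _).le (by positivity)
    _ = _ := by ring

theorem integrable_exp (hV : IsPotential V) : Integrable fun x => Real.exp (-V x) := by
  simpa using hV.integrable_mul (f := fun _ => 1) continuous_const (C := 1) (n := 0) (by simp)

end IsPotential

theorem pd_comp_neg (hf : ContDiff ℝ ∞ f) (i : Fin d) (x : Euc d) :
    pd i (fun x => f (-x)) x = -pd i f (-x) := by
  simpa using pd_reflect i hf 0 x

theorem pd_neg_of_parity (hf : ContDiff ℝ ∞ f) (h : ∀ x, f (-x) = σ * f x) (i : Fin d)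
    (x : Euc d) : pd i f (-x) = -σ * pd i f x := by
  have e := pd_comp_neg hf i x
  rw [show (fun x => f (-x)) = fun x => σ * f x from funext h, pd_const_mul i σ hf] at e
  linarith

theorem lap_comp_neg (hV : IsPotential V) (hu : ContDiff ℝ ∞ u) (x : Euc d) :
    lap V (fun x => u (-x)) x = lap V u (-x) := by
  refine Finset.sum_congr rfl fun i _ => ?_
  have e : pd i (fun x => u (-x)) = fun x => (-1) * pd i u (-x) := by
    funext y; rw [pd_comp_neg hu]; ring
  have e2 : ContDiff ℝ ∞ fun x => pd i u (-x) := (contDiff_pd i hu).comp contDiff_neg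
  have e3 := pd_neg_of_parity (σ := 1) hV.smooth (by simpa using hV.even) i x
  rw [dStar, dStar, e, pd_const_mul i _ e2, pd_comp_neg (contDiff_pd i hu), e3]
  ring

/-- A spectral gap inequality for the generator in a parity sector. -/
def LapGap (V : Euc d → ℝ) (σ k : ℝ) : Prop :=
  ∀ u, IsTest u → (∀ x, u (-x) = σ * u x) →
    k * ∫ x, gradSq u x * Real.exp (-V x) ≤ ∫ x, lap V u x ^ 2 * Real.exp (-V x)

/-- A spectral gap for the generator implies a Poincaré inequality. -/
theorem LapGap.poincare (hV : IsPotential V) (hσ : σ ^ 2 = 1) (hk : 0 < k) (hgap : LapGap V σ k)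
    (hf : ContDiff ℝ ∞ f) (hpar : ∀ x, f (-x) = σ * f x)
    (hf0 : ∫ x, f x * Real.exp (-V x) = 0)
    (hf2 : Integrable fun x => f x ^ 2 * Real.exp (-V x))
    (hg : Integrable fun x => gradSq f x * Real.exp (-V x)) :
    k * ∫ x, f x ^ 2 * Real.exp (-V x) ≤ ∫ x, gradSq f x * Real.exp (-V x) := by
  rw [← le_div_iff₀' hk]
  refine le_of_forall_pos_le_add fun ε hε => ?_
  obtain ⟨u, hu, hfu⟩ := exists_lap_approx hV.smooth hV.integrable_exp
    hf.continuous.aestronglyMeasurable hf2 hf0 hε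
  have hun : IsTest fun x => u (-x) := by simpa using hu.reflect 0
  set u' : Euc d → ℝ := fun x => (1 / 2) * u x + σ / 2 * u (-x) with hu'
  have htest : IsTest u' := (hu.const_mul _).add (hun.const_mul _)
  have hpar' : ∀ x, u' (-x) = σ * u' x := by
    intro x
    simp only [hu', neg_neg]
    linear_combination (-(1 / 2) * u (-x)) * hσ
  have hlap : ∀ x, lap V u' x = 1 / 2 * lap V u x + σ / 2 * lap V u (-x) := by
    intro x
    rw [hu', lap_add (hu.const_mul _).smooth (hun.const_mul _).smooth,
      lap_const_mul _ hu.smooth, lap_const_mul _ hun.smooth, lap_comp_neg hV hu.smooth]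
  set L := lap V u' with hL
  have hLt : IsTest L := htest.lap hV.smooth
  have iL2 : Integrable fun x => L x ^ 2 * Real.exp (-V x) := by
    have := ((IsTest.mul_left hLt.smooth hLt).mul_exp_neg hV.smooth).integrable
    simpa only [pow_two] using this
  have ifL : Integrable fun x => f x * L x * Real.exp (-V x) :=
    ((IsTest.mul_left hf hLt).mul_exp_neg hV.smooth).integrable
  have hexp : ∀ g : Euc d → ℝ, IsTest g → ((Integrable fun x => (f x - g x) ^ 2 * Real.exp (-V x)) ∧
      ∫ x, (f x - g x) ^ 2 * Real.exp (-V x) = (∫ x, f x ^ 2 * Real.exp (-V x)) -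
        2 * (∫ x, f x * g x * Real.exp (-V x)) + ∫ x, g x ^ 2 * Real.exp (-V x)) := by
    intro g hg
    have j1 : Integrable fun x => f x * g x * Real.exp (-V x) :=
      ((IsTest.mul_left hf hg).mul_exp_neg hV.smooth).integrable
    have j2 : Integrable fun x => g x ^ 2 * Real.exp (-V x) := by
      have := ((IsTest.mul_left hg.smooth hg).mul_exp_neg hV.smooth).integrable
      simpa only [pow_two] using this
    have e : ∀ x, (f x - g x) ^ 2 * Real.exp (-V x) = f x ^ 2 * Real.exp (-V x) -
        2 * (f x * g x * Real.exp (-V x)) + g x ^ 2 * Real.exp (-V x) := fun x => by ring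
    have j3 : Integrable fun x => f x ^ 2 * Real.exp (-V x) -
        2 * (f x * g x * Real.exp (-V x)) := hf2.sub (j1.const_mul 2)
    simp only [e]
    refine ⟨j3.add j2, ?_⟩
    rw [integral_add j3 j2, integral_sub hf2 (j1.const_mul 2), integral_const_mul]
  have hsym : ∫ x, (f x - L x) ^ 2 * Real.exp (-V x) ≤ ε := by
    have i0 := (hexp _ (hu.lap hV.smooth)).1
    set Q : Euc d → ℝ := fun x => (f x - lap V u x) ^ 2 * Real.exp (-V x) with hQ
    have i1 : Integrable fun x => Q (-x) := i0.comp_neg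
    have e1 : ∫ x, Q (-x) = ∫ x, Q x := integral_neg_eq_self Q volume
    calc _ ≤ ∫ x, (1 / 2 * Q x + 1 / 2 * Q (-x)) := by
          refine integral_mono (hexp L hLt).1 ((i0.const_mul _).add (i1.const_mul _)) fun x => ?_
          simp only [hQ, hV.even, hpar]
          rw [hlap, ← mul_assoc, ← mul_assoc, ← add_mul]
          refine mul_le_mul_of_nonneg_right ?_ (Real.exp_pos _).le
          set A := lap V u x
          set B := lap V u (-x)
          have : (σ * f x - B) ^ 2 = (f x - σ * B) ^ 2 := by
            linear_combination (f x ^ 2 - B ^ 2) * hσ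
          rw [this]
          nlinarith [sq_nonneg (f x - A - (f x - σ * B))]
      _ = ∫ x, Q x := by
          rw [integral_add (i0.const_mul _) (i1.const_mul _), integral_const_mul,
            integral_const_mul, e1]
          ring
      _ ≤ ε := hfu.le
  rw [(hexp L hLt).2] at hsym
  have hU := hgap u' htest hpar'
  have hpair := integral_mul_lap hV.smooth hf htest
  have hgu : Integrable fun x => gradSq u' x * Real.exp (-V x) := by
    have h1 : IsTest (gradSq u') := IsTest.sum _ fun i _ => by
      simpa only [pow_two] using IsTest.mul_left (htest.pd i).smooth (htest.pd i)
    exact (h1.mul_exp_neg hV.smooth).integrable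
  set A := ∫ x, f x ^ 2 * Real.exp (-V x)
  set U := ∫ x, L x ^ 2 * Real.exp (-V x)
  set P := ∫ x, f x * L x * Real.exp (-V x)
  set Γ := ∫ x, gradSq f x * Real.exp (-V x)
  set G := ∫ x, gradSq u' x * Real.exp (-V x)
  have hG0 : 0 ≤ G := integral_nonneg fun x => mul_nonneg (gradSq_nonneg _ _) (Real.exp_pos _).le
  have hΓ0 : 0 ≤ Γ := integral_nonneg fun x => mul_nonneg (gradSq_nonneg _ _) (Real.exp_pos _).le
  have hU0 : 0 ≤ U := integral_nonneg fun x => by positivity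
  have hcs : P ^ 2 ≤ Γ * G := by
    rw [hpair, neg_sq]
    -- Cauchy–Schwarz through the quadratic form
    have hq : ∀ s : ℝ, 0 ≤ Γ * (s * s) + (2 * ∫ x, (∑ i, pd i f x * pd i u' x) *
        Real.exp (-V x)) * s + G := by
      intro s
      have ip : Integrable fun x => (∑ i, pd i f x * pd i u' x) * Real.exp (-V x) :=
        ((IsTest.sum _ fun i _ => IsTest.mul_left (contDiff_pd i hf)
          (htest.pd i)).mul_exp_neg hV.smooth).integrable
      have h1 : 0 ≤ ∫ x, (s * s * (gradSq f x * Real.exp (-V x)) +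
          2 * s * ((∑ i, pd i f x * pd i u' x) * Real.exp (-V x)) +
          gradSq u' x * Real.exp (-V x)) := by
        refine integral_nonneg fun x => ?_
        have : s * s * (gradSq f x * Real.exp (-V x)) +
          2 * s * ((∑ i, pd i f x * pd i u' x) * Real.exp (-V x)) +
          gradSq u' x * Real.exp (-V x) =
          (∑ i, (s * pd i f x + pd i u' x) ^ 2) * Real.exp (-V x) := by
          simp only [gradSq, Finset.sum_mul, Finset.mul_sum, ← Finset.sum_add_distrib]
          refine Finset.sum_congr rfl fun i _ => by ring
        rw [this]
        simp only [Pi.zero_apply]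
        positivity
      have i2 : Integrable fun x => s * s * (gradSq f x * Real.exp (-V x)) +
          2 * s * ((∑ i, pd i f x * pd i u' x) * Real.exp (-V x)) :=
        (hg.const_mul _).add (ip.const_mul _)
      rw [integral_add i2 hgu, integral_add (hg.const_mul _) (ip.const_mul _),
        integral_const_mul, integral_const_mul] at h1
      linarith
    have := discrim_le_zero hq
    rw [discrim] at this
    nlinarith
  have h4 : P ^ 2 ≤ Γ / k * U := by
    calc P ^ 2 ≤ Γ * G := hcs
      _ ≤ Γ * (U / k) := by
          refine mul_le_mul_of_nonneg_left ?_ hΓ0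
          rw [le_div_iff₀' hk]; exact hU
      _ = _ := by ring
  by_contra! hcon
  set D := Γ / k
  have hD0 : 0 ≤ D := by positivity
  have hA : 0 < A - ε := by linarith
  have h5 : (A - ε + U) ^ 2 ≤ 4 * P ^ 2 := by nlinarith
  rcases hU0.eq_or_lt with h0 | h0
  · rw [← h0] at h5 h4
    nlinarith
  · nlinarith [sq_nonneg (A - ε - U)]

end Poincare

section Gap

variable {d : ℕ} {f g h u v w V ρ : Euc d → ℝ} {k a σ : ℝ}

theorem IsTest.gradSq (hu : IsTest u) : IsTest (gradSq u) :=
  IsTest.sum _ fun i _ => by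
    simpa only [pow_two] using IsTest.mul_left (hu.pd i).smooth (hu.pd i)

theorem IsTest.integrable_sq (hV : ContDiff ℝ ∞ V) (hu : IsTest u) :
    Integrable fun x => u x ^ 2 * Real.exp (-V x) := by
  have := ((IsTest.mul_left hu.smooth hu).mul_exp_neg hV).integrable
  simpa only [pow_two] using this

theorem integral_eq_zero_of_odd (hV : IsPotential V) (h : ∀ x, f (-x) = (-1) * f x) :
    ∫ x, f x * Real.exp (-V x) = 0 := by
  have := integral_neg_eq_self (fun x => f x * Real.exp (-V x)) volume
  simp only [h, hV.even, neg_mul, one_mul, integral_neg] at this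
  linarith

theorem lapGap_one (hV : IsPotential V) (σ : ℝ) : LapGap V σ 1 := by
  intro u hu _
  have := integral_lap_sq_ge hV.smooth hV.convex hu
  have h2 : 0 ≤ ∑ j, ∫ x, gradSq (pd j u) x * Real.exp (-V x) :=
    Finset.sum_nonneg fun j _ => integral_nonneg fun x =>
      mul_nonneg (gradSq_nonneg _ _) (Real.exp_pos _).le
  linarith

theorem LapGap.mono {k' : ℝ} (h : LapGap V σ k) (hk : k' ≤ k) : LapGap V σ k' := fun u hu hp =>
  (mul_le_mul_of_nonneg_right hk (integral_nonneg fun _ =>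
      mul_nonneg (gradSq_nonneg _ _) (Real.exp_pos _).le)).trans (h u hu hp)

theorem integral_gradSq (hV : ContDiff ℝ ∞ V) (hu : IsTest u) :
    ∫ x, gradSq u x * Real.exp (-V x) = ∑ j, ∫ x, pd j u x ^ 2 * Real.exp (-V x) := by
  simp only [gradSq, Finset.sum_mul]
  rw [integral_finsetSum _ fun j _ => (hu.pd j).integrable_sq hV]

/-- A gap among odd functions improves to a larger gap among even functions. -/
theorem LapGap.even_of_odd (hV : IsPotential V) (hk : 0 < k) (h : LapGap V (-1) k) :
    LapGap V 1 (k + 1) := by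
  intro u hu hp
  have hb := integral_lap_sq_ge hV.smooth hV.convex hu
  have hj : ∀ j, k * ∫ x, pd j u x ^ 2 * Real.exp (-V x) ≤
      ∫ x, gradSq (pd j u) x * Real.exp (-V x) := by
    intro j
    have hodd : ∀ x, pd j u (-x) = (-1) * pd j u x := fun x => by
      simpa using pd_neg_of_parity hu.smooth hp j x
    exact h.poincare hV (by norm_num) hk (hu.pd j).smooth hodd (integral_eq_zero_of_odd hV hodd)
      ((hu.pd j).integrable_sq hV.smooth) ((hu.pd j).gradSq.mul_exp_neg hV.smooth).integrable
  have := Finset.sum_le_sum fun j (_ : j ∈ Finset.univ) => hj j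
  rw [← Finset.mul_sum, ← integral_gradSq hV.smooth hu] at this
  linarith

/-- The variance form of the Poincaré inequality among even functions. -/
theorem LapGap.variance_le (hV : IsPotential V) (hk : 0 < k) (h : LapGap V 1 k)
    (hf : ContDiff ℝ ∞ f) (hpar : ∀ x, f (-x) = f x)
    (hf1 : Integrable fun x => f x * Real.exp (-V x))
    (hf2 : Integrable fun x => f x ^ 2 * Real.exp (-V x))
    (hg : Integrable fun x => gradSq f x * Real.exp (-V x)) :
    k * ((∫ x, f x ^ 2 * Real.exp (-V x)) - (∫ x, f x * Real.exp (-V x)) ^ 2) ≤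
      ∫ x, gradSq f x * Real.exp (-V x) := by
  set m := ∫ x, f x * Real.exp (-V x)
  have hω := hV.integrable_exp
  have e : ∀ x, (f x - m) ^ 2 * Real.exp (-V x) = f x ^ 2 * Real.exp (-V x) -
      2 * m * (f x * Real.exp (-V x)) + m ^ 2 * Real.exp (-V x) := fun x => by ring
  have i1 : Integrable fun x => f x ^ 2 * Real.exp (-V x) -
      2 * m * (f x * Real.exp (-V x)) := hf2.sub (hf1.const_mul _)
  have hs : ContDiff ℝ ∞ fun x => f x - m := hf.sub contDiff_const
  have hgr : gradSq (fun x => f x - m) = gradSq f := by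
    funext x
    refine Finset.sum_congr rfl fun i _ => ?_
    unfold pd; rw [fderiv_sub_const]
  have hp := h.poincare hV (by norm_num) hk hs (fun x => by rw [hpar, one_mul])
    (by
      simp only [sub_mul]
      rw [integral_sub hf1 (hω.const_mul _), integral_const_mul, hV.integral_eq_one, mul_one,
        sub_self])
    (by simp only [e]; exact i1.add (hω.const_mul _)) (by rw [hgr]; exact hg)
  rw [hgr] at hp
  refine le_trans (le_of_eq ?_) hp
  simp only [e]
  rw [integral_add i1 (hω.const_mul _), integral_sub hf2 (hf1.const_mul _), integral_const_mul,
    integral_const_mul, hV.integral_eq_one]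
  congr 1
  change _ - m ^ 2 = _ - 2 * m * m + m ^ 2 * 1
  ring

theorem contDiff_inner_left (e : Euc d) : ContDiff ℝ ∞ fun x : Euc d => inner ℝ e x :=
  contDiff_const.inner ℝ contDiff_id

theorem pd_inner (i : Fin d) (e x : Euc d) : pd i (fun x : Euc d => inner ℝ e x) x = e i := by
  unfold pd
  rw [show (fun x : Euc d => inner ℝ e x) = innerSL ℝ e from rfl, ContinuousLinearMap.fderiv]
  simp [EuclideanSpace.inner_single_right]

theorem IsPotential.integrable_inner_sq (hV : IsPotential V) (e : Euc d) :
    Integrable fun x => (inner ℝ e x) ^ 2 * Real.exp (-V x) :=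
  hV.integrable_mul (C := ‖e‖ ^ 2) (n := 2) ((contDiff_inner_left e).continuous.pow 2) fun x => by
    rw [abs_pow, ← mul_pow]
    exact pow_le_pow_left₀ (abs_nonneg _) (abs_real_inner_le_norm e x) 2

/-- A gap among even functions and a covariance bound give a gap among odd functions. -/
theorem LapGap.odd_of_even (hV : IsPotential V) (hk : 0 < k) (ha : 0 < a) (h : LapGap V 1 k)
    (hcov : ∀ e : Euc d, ∫ x, (inner ℝ e x) ^ 2 * Real.exp (-V x) ≤ a * ‖e‖ ^ 2) :
    LapGap V (-1) ((1 + k) / (1 + k * a)) := by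
  intro u hu hp
  have hb := integral_lap_sq_ge hV.smooth hV.convex hu
  set e : Euc d := WithLp.toLp 2 fun j => ∫ x, pd j u x * Real.exp (-V x) with he
  have hej : ∀ j, e j = ∫ x, pd j u x * Real.exp (-V x) := fun j => rfl
  have hj : ∀ j, k * ((∫ x, pd j u x ^ 2 * Real.exp (-V x)) - e j ^ 2) ≤
      ∫ x, gradSq (pd j u) x * Real.exp (-V x) := by
    intro j
    exact h.variance_le hV hk (hu.pd j).smooth
      (fun x => by simpa using pd_neg_of_parity hu.smooth hp j x)
      ((hu.pd j).mul_exp_neg hV.smooth).integrable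
      ((hu.pd j).integrable_sq hV.smooth) ((hu.pd j).gradSq.mul_exp_neg hV.smooth).integrable
  have hsum := Finset.sum_le_sum fun j (_ : j ∈ Finset.univ) => hj j
  rw [← Finset.mul_sum, Finset.sum_sub_distrib, ← integral_gradSq hV.smooth hu,
    show ∑ j, e j ^ 2 = ‖e‖ ^ 2 by rw [EuclideanSpace.norm_sq_eq]; simp] at hsum
  have hL := hu.lap hV.smooth
  have hpair := integral_mul_lap hV.smooth (contDiff_inner_left e) hu
  simp only [pd_inner, Finset.sum_mul] at hpair
  rw [integral_finsetSum _ fun j _ => by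
    simpa only [mul_assoc] using (((hu.pd j).mul_exp_neg hV.smooth).integrable.const_mul (e j))]
    at hpair
  simp only [mul_assoc, integral_const_mul, ← hej, ← pow_two] at hpair
  rw [show ∑ j, e j ^ 2 = ‖e‖ ^ 2 by rw [EuclideanSpace.norm_sq_eq]; simp] at hpair
  set U := ∫ x, lap V u x ^ 2 * Real.exp (-V x)
  have hcs : (‖e‖ ^ 2) ^ 2 ≤ (a * ‖e‖ ^ 2) * U := by
    have e1 : ∀ x, (inner ℝ e x * Real.exp (-V x / 2)) * (lap V u x * Real.exp (-V x / 2)) =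
        inner ℝ e x * (lap V u x * Real.exp (-V x)) := by
      intro x
      have : Real.exp (-V x) = Real.exp (-V x / 2) * Real.exp (-V x / 2) := by
        rw [← Real.exp_add]; congr 1; ring
      rw [this]; ring
    have e2 : ∀ y x : ℝ, (y * Real.exp (-x / 2)) ^ 2 = y ^ 2 * Real.exp (-x) := by
      intro y x
      rw [mul_pow, ← Real.exp_nat_mul]; congr 2; push_cast; ring
    have := sq_integral_mul_le (μ := volume) (f := fun x => inner ℝ e x * Real.exp (-V x / 2))
      (g := fun x => lap V u x * Real.exp (-V x / 2))
      (by simpa only [e2] using hV.integrable_inner_sq e)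
      (by simpa only [e2] using hL.integrable_sq hV.smooth)
      (by simpa only [e1, mul_assoc] using
        ((IsTest.mul_left (contDiff_inner_left e) hL).mul_exp_neg hV.smooth).integrable)
    simp only [e1, e2, hpair, neg_sq] at this
    refine this.trans (mul_le_mul_of_nonneg_right (hcov e) (integral_nonneg fun x => by positivity))
  have hle : ‖e‖ ^ 2 ≤ a * U := by
    rcases (sq_nonneg ‖e‖).eq_or_lt with h0 | h0
    · rw [← h0]
      exact mul_nonneg ha.le (integral_nonneg fun x => by positivity)
    · nlinarith
  rw [div_mul_eq_mul_div, div_le_iff₀ (by positivity)]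
  nlinarith [mul_le_mul_of_nonneg_left hle hk.le]

/-- The bootstrapped gap among odd functions. -/
theorem lapGap_odd (hV : IsPotential V) (ha : 0 < a) (ha1 : a ≤ 1)
    (hcov : ∀ e : Euc d, ∫ x, (inner ℝ e x) ^ 2 * Real.exp (-V x) ≤ a * ‖e‖ ^ 2) :
    LapGap V (-1) (Real.sqrt a)⁻¹ := by
  set r := Real.sqrt a with hr
  have hr0 : 0 < r := Real.sqrt_pos.2 ha
  have hr1 : r ≤ 1 := Real.sqrt_le_one.2 ha1
  have hra : r ^ 2 = a := Real.sq_sqrt ha.le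
  set T : Set ℝ := Set.Icc 1 r⁻¹ ∩ {k | LapGap V (-1) k} with hT
  have hs1 : 1 ≤ r⁻¹ := (one_le_inv₀ hr0).2 hr1
  have hne : T.Nonempty := ⟨1, ⟨le_rfl, hs1⟩, lapGap_one hV _⟩
  have hcl : IsClosed {k | LapGap V (-1) k} := by
    simp only [LapGap, Set.ofPred_forall]
    refine isClosed_iInter fun u => isClosed_iInter fun hu => isClosed_iInter fun hp => ?_
    exact isClosed_le (by fun_prop) continuous_const
  obtain ⟨k, ⟨⟨hk1, hks⟩, hk⟩, hmax⟩ := (isCompact_Icc.inter_right hcl).exists_isGreatest hne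
  rcases hks.eq_or_lt with h0 | h0
  · rwa [← h0]
  exfalso
  have hk0 : 0 < k := by linarith
  have hnew := LapGap.odd_of_even hV (by linarith) ha (LapGap.even_of_odd hV hk0 hk) hcov
  set k' := (1 + (k + 1)) / (1 + (k + 1) * a)
  have hkr : k * r < 1 := by
    calc k * r < r⁻¹ * r := mul_lt_mul_of_pos_right h0 hr0
      _ = 1 := inv_mul_cancel₀ hr0.ne'
  have hkk : k < k' := by
    rw [lt_div_iff₀ (by positivity), ← hra]
    nlinarith [mul_pos hk0 hr0]
  have : min k' r⁻¹ ≤ k := hmax ⟨⟨le_min (hk1.trans hkk.le) hs1, min_le_right _ _⟩,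
    hnew.mono (min_le_left _ _)⟩
  rcases min_le_iff.1 this with h | h <;> linarith

theorem IsPotential.cov_le_one (hV : IsPotential V) (e : Euc d) :
    ∫ x, (inner ℝ e x) ^ 2 * Real.exp (-V x) ≤ 1 * ‖e‖ ^ 2 := by
  have hg : gradSq (fun x : Euc d => inner ℝ e x) = fun _ => ‖e‖ ^ 2 := by
    funext x
    simp only [gradSq, pd_inner, EuclideanSpace.norm_sq_eq]; simp
  have hodd : ∀ x : Euc d, inner ℝ e (-x) = (-1) * inner ℝ e x := fun x => by
    rw [inner_neg_right]; ring
  have := (lapGap_one hV (-1)).poincare hV (by norm_num) one_pos (contDiff_inner_left e) hodd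
    (integral_eq_zero_of_odd hV hodd) (hV.integrable_inner_sq e)
    (by rw [hg]; exact hV.integrable_exp.const_mul _)
  rw [hg, integral_const_mul, hV.integral_eq_one] at this
  linarith

/-- The variance of a quadratic form under an even, strongly log-concave measure. -/
theorem IsPotential.variance_quadratic_le (hV : IsPotential V) (ha : 0 < a) (ha1 : a ≤ 1)
    (hcov : ∀ e : Euc d, ∫ x, (inner ℝ e x) ^ 2 * Real.exp (-V x) ≤ a * ‖e‖ ^ 2)
    (b : OrthonormalBasis (Fin d) ℝ (Euc d)) (α : Fin d → ℝ) :
    ((∫ x, (∑ i, α i * (inner ℝ (b i) x) ^ 2) ^ 2 * Real.exp (-V x)) -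
      (∫ x, (∑ i, α i * (inner ℝ (b i) x) ^ 2) * Real.exp (-V x)) ^ 2) ≤
      4 / (1 + (Real.sqrt a)⁻¹) *
        ∑ i, α i ^ 2 * ∫ x, (inner ℝ (b i) x) ^ 2 * Real.exp (-V x) := by
  have hs : 0 < (Real.sqrt a)⁻¹ := inv_pos.2 (Real.sqrt_pos.2 ha)
  have hgap := LapGap.even_of_odd hV hs (lapGap_odd hV ha ha1 hcov)
  set q : Euc d → ℝ := fun x => ∑ i, α i * (inner ℝ (b i) x) ^ 2 with hq
  have hqs : ContDiff ℝ ∞ q :=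
    ContDiff.sum fun i _ => contDiff_const.mul ((contDiff_inner_left (b i)).pow 2)
  have hqb : ∀ x, |q x| ≤ (∑ i, |α i|) * ‖x‖ ^ 2 := by
    intro x
    rw [Finset.sum_mul]
    refine (Finset.abs_sum_le_sum_abs _ _).trans (Finset.sum_le_sum fun i _ => ?_)
    rw [abs_mul, abs_pow]
    refine mul_le_mul_of_nonneg_left (pow_le_pow_left₀ (abs_nonneg _) ?_ 2) (abs_nonneg _)
    simpa using abs_real_inner_le_norm (b i) x
  have hgr : gradSq q = fun x => 4 * ∑ i, α i ^ 2 * (inner ℝ (b i) x) ^ 2 := by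
    funext x
    set z : Euc d := ∑ i, (2 * α i * inner ℝ (b i) x) • b i with hz
    have hpd : ∀ j, pd j q x = z j := by
      intro j
      have : fderiv ℝ q x = ∑ i, (2 * α i * inner ℝ (b i) x) • innerSL ℝ (b i) := by
        refine HasFDerivAt.fderiv (HasFDerivAt.fun_sum fun i _ => ?_)
        have h1 : HasFDerivAt (fun x : Euc d => inner ℝ (b i) x) (innerSL ℝ (b i)) x :=
          (innerSL ℝ (b i)).hasFDerivAt
        refine ((h1.pow 2).const_mul (α i)).congr_fderiv ?_
        ext y; simp; ring
      rw [pd, this, hz]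
      simp [EuclideanSpace.inner_single_right]
    rw [gradSq, Finset.sum_congr rfl fun j _ => by rw [hpd j],
      show ∑ j, z j ^ 2 = ‖z‖ ^ 2 by rw [EuclideanSpace.norm_sq_eq]; simp,
      ← real_inner_self_eq_norm_sq, hz, b.orthonormal.inner_sum, Finset.mul_sum]
    refine Finset.sum_congr rfl fun i _ => ?_
    simp; ring
  have hi := fun i => (hV.integrable_inner_sq (b i)).const_mul (α i ^ 2)
  have hgi : ∀ x, gradSq q x * Real.exp (-V x) =
      4 * ∑ i, α i ^ 2 * ((inner ℝ (b i) x) ^ 2 * Real.exp (-V x)) := by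
    intro x
    rw [hgr, mul_assoc, Finset.sum_mul]
    simp only [mul_assoc]
  have := hgap.variance_le hV (by linarith) hqs (fun x => by simp [hq, inner_neg_right])
    (hV.integrable_mul hqs.continuous hqb)
    (hV.integrable_mul (C := (∑ i, |α i|) ^ 2) (n := 4) (hqs.continuous.pow 2) fun x => by
      rw [abs_pow]
      calc |q x| ^ 2 ≤ ((∑ i, |α i|) * ‖x‖ ^ 2) ^ 2 := pow_le_pow_left₀ (abs_nonneg _) (hqb x) 2
        _ = _ := by ring)
    (by simp only [hgi]; exact (integrable_finsetSum _ fun i _ => hi i).const_mul 4)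
  simp only [hgi] at this
  rw [integral_const_mul, integral_finsetSum _ fun i _ => hi i] at this
  simp only [integral_const_mul] at this
  rw [div_mul_eq_mul_div, le_div_iff₀ (by linarith)]
  linarith

end Gap

/-- Smooth positive even log-concave functions. -/
structure IsGood {d : ℕ} (F : Euc d → ℝ) : Prop where
  smooth : ContDiff ℝ ∞ F
  pos : ∀ x, 0 < F x
  even : ∀ x, F (-x) = F x
  logConcave : ∀ x y, F x * F y ≤ F ((1 / 2 : ℝ) • (x + y)) ^ 2

section Tilt

variable {d : ℕ} {F G : Euc d → ℝ}

theorem IsGood.le_zero (hF : IsGood F) (x : Euc d) : F x ≤ F 0 := by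
  have := hF.logConcave x (-x)
  rw [hF.even, add_neg_cancel, smul_zero, ← pow_two] at this
  exact (pow_le_pow_iff_left₀ (hF.pos x).le (hF.pos 0).le two_ne_zero).1 this

theorem IsGood.comp (hF : IsGood F) (g : Euc d →L[ℝ] Euc d) : IsGood fun x => F (g x) where
  smooth := hF.smooth.comp g.contDiff
  pos := fun x => hF.pos _
  even := fun x => by rw [map_neg, hF.even]
  logConcave := fun x y => by simpa using hF.logConcave (g x) (g y)

/-- Change of variables by a linear isomorphism. -/
theorem integral_comp_symm (e : Euc d ≃L[ℝ] Euc d) (G : Euc d → ℝ) :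
    ∫ z, G (e.symm z) = |(e : Euc d →L[ℝ] Euc d).det| * ∫ y, G y := by
  have := integral_image_eq_integral_abs_det_fderiv_smul volume MeasurableSet.univ
    (fun x _ => (e : Euc d →L[ℝ] Euc d).hasFDerivAt.hasFDerivWithinAt)
    (e.injective.injOn) (fun z => G (e.symm z))
  simp only [ContinuousLinearEquiv.coe_coe, Set.image_univ, EquivLike.range_eq_univ,
    Measure.restrict_univ, ContinuousLinearEquiv.symm_apply_apply, smul_eq_mul,
    integral_const_mul] at this
  exact this

theorem abs_det_pos (e : Euc d ≃L[ℝ] Euc d) : 0 < |(e : Euc d →L[ℝ] Euc d).det| := by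
  have := (LinearEquiv.isUnit_det' e.toLinearEquiv).ne_zero
  exact abs_pos.2 this

/-- The mass of `F` tilted by the Gaussian `exp (-‖h y‖² / 2)`. -/
noncomputable def tilt (F : Euc d → ℝ) (h : Euc d →L[ℝ] Euc d) : ℝ :=
  ∫ y, F y * Real.exp (-(1 / 2) * ‖h y‖ ^ 2)

/-- Functions of polynomial growth are integrable against a Gaussian tilt of `F`. -/
theorem IsGood.integrable_tilt (hF : IsGood F) (e : Euc d ≃L[ℝ] Euc d) (hG : Continuous G)
    {C : ℝ} {n : ℕ} (h : ∀ x, |G x| ≤ C * ‖x‖ ^ n) :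
    Integrable fun y => G y * (F y * Real.exp (-(1 / 2) * ‖e y‖ ^ 2)) := by
  obtain ⟨c, hc, hce⟩ : ∃ c > 0, ∀ y, c * ‖y‖ ≤ ‖e y‖ := by
    refine ⟨(‖(e.symm : Euc d →L[ℝ] Euc d)‖ + 1)⁻¹, by positivity, fun y => ?_⟩
    rw [inv_mul_le_iff₀ (by positivity)]
    have := (e.symm : Euc d →L[ℝ] Euc d).le_opNorm (e y)
    simp only [ContinuousLinearEquiv.coe_coe, ContinuousLinearEquiv.symm_apply_apply] at this
    nlinarith [norm_nonneg (e y)]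
  refine ((integrable_norm_pow_mul_gaussian (d := d) n (b := c ^ 2 / 2) (by positivity)).const_mul
    (|C| * F 0)).mono' (hG.mul (hF.smooth.continuous.mul (by fun_prop))).aestronglyMeasurable
    (Filter.Eventually.of_forall fun x => ?_)
  have h0 := hF.pos x
  rw [Real.norm_eq_abs, abs_mul, abs_of_nonneg (a := F x * _) (by positivity)]
  have h1 : |G x| ≤ |C| * ‖x‖ ^ n :=
    (h x).trans (mul_le_mul_of_nonneg_right (le_abs_self C) (by positivity))
  have h2 : Real.exp (-(1 / 2) * ‖e x‖ ^ 2) ≤ Real.exp (-(c ^ 2 / 2) * ‖x‖ ^ 2) := by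
    refine Real.exp_le_exp.2 ?_
    have := pow_le_pow_left₀ (by positivity) (hce x) 2
    nlinarith
  have h3 := (hF.pos 0).le
  calc _ ≤ (|C| * ‖x‖ ^ n) * (F 0 * Real.exp (-(c ^ 2 / 2) * ‖x‖ ^ 2)) := by
        gcongr
        exact hF.le_zero x
    _ = _ := by ring

theorem IsGood.integrable_tilt_one (hF : IsGood F) (e : Euc d ≃L[ℝ] Euc d) :
    Integrable fun y => F y * Real.exp (-(1 / 2) * ‖e y‖ ^ 2) := by
  simpa using hF.integrable_tilt e (G := fun _ => 1) continuous_const (C := 1) (n := 0) (by simp)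

theorem IsGood.tilt_pos (hF : IsGood F) (e : Euc d ≃L[ℝ] Euc d) :
    0 < tilt F (e : Euc d →L[ℝ] Euc d) := by
  refine integral_pos_of_integrable_nonneg_nonzero (x := 0)
    (hF.smooth.continuous.mul (by fun_prop)) (hF.integrable_tilt_one e)
    (fun x => mul_nonneg (hF.pos x).le (Real.exp_pos _).le) ?_
  have := (hF.pos 0).ne'
  simp [this]

/-- The potential of the image of the tilted measure under `e`. -/
noncomputable def tiltPotential (F : Euc d → ℝ) (e : Euc d ≃L[ℝ] Euc d) (z : Euc d) : ℝ :=
  -Real.log (F (e.symm z)) + ‖z‖ ^ 2 / 2 +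
    Real.log (|(e : Euc d →L[ℝ] Euc d).det| * tilt F (e : Euc d →L[ℝ] Euc d))

theorem IsGood.integral_tiltPotential (hF : IsGood F) (e : Euc d ≃L[ℝ] Euc d) (G : Euc d → ℝ) :
    ∫ z, G z * Real.exp (-tiltPotential F e z) =
      (∫ y, G (e y) * (F y * Real.exp (-(1 / 2) * ‖e y‖ ^ 2))) /
        tilt F (e : Euc d →L[ℝ] Euc d) := by
  have hd := abs_det_pos e
  have hT := hF.tilt_pos e
  have h1 : ∀ z, G z * Real.exp (-tiltPotential F e z) =
      (|(e : Euc d →L[ℝ] Euc d).det| * tilt F (e : Euc d →L[ℝ] Euc d))⁻¹ *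
      (fun y => G (e y) * (F y * Real.exp (-(1 / 2) * ‖e y‖ ^ 2))) (e.symm z) := by
    intro z
    have : -tiltPotential F e z = Real.log (F (e.symm z)) + -(1 / 2) * ‖z‖ ^ 2 +
        -Real.log (|(e : Euc d →L[ℝ] Euc d).det| * tilt F (e : Euc d →L[ℝ] Euc d)) := by
      rw [tiltPotential]; ring
    rw [this, Real.exp_add, Real.exp_add, Real.exp_log (hF.pos _), Real.exp_neg,
      Real.exp_log (mul_pos hd hT)]
    simp only [ContinuousLinearEquiv.apply_symm_apply]
    ring
  simp only [h1]
  rw [integral_const_mul, integral_comp_symm e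
    (fun y => G (e y) * (F y * Real.exp (-(1 / 2) * ‖e y‖ ^ 2)))]
  field_simp

theorem IsGood.isPotential (hF : IsGood F) (e : Euc d ≃L[ℝ] Euc d) :
    IsPotential (tiltPotential F e) where
  smooth := (((hF.smooth.comp e.symm.contDiff).log fun x => (hF.pos _).ne').neg.add
    ((contDiff_norm_sq ℝ).div_const 2)).add contDiff_const
  even := fun x => by simp [tiltPotential, hF.even]
  convex := fun x y => by
    have h := Real.log_le_log (mul_pos (hF.pos _) (hF.pos _))
      (hF.logConcave (e.symm x) (e.symm y))
    rw [Real.log_mul (hF.pos _).ne' (hF.pos _).ne', Real.log_pow] at h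
    have hp : ‖(1 / 2 : ℝ) • (x + y)‖ ^ 2 = ‖x + y‖ ^ 2 / 4 := by
      rw [norm_smul, mul_pow]; norm_num; ring
    have hpar := parallelogram_law_with_norm ℝ x y
    simp only [tiltPotential, map_smul, map_add, hp]
    push_cast at h
    nlinarith
  integral_eq_one := by
    have := hF.integral_tiltPotential e (fun _ => 1)
    simp only [one_mul] at this
    rw [this]
    exact div_self (hF.tilt_pos e).ne'

end Tilt

section Dilation

variable {d : ℕ}

/-- Multiplication by `exp (α i)` in the direction `b i`. -/
noncomputable def dilMap (b : OrthonormalBasis (Fin d) ℝ (Euc d)) (α : Fin d → ℝ) :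
    Euc d →L[ℝ] Euc d :=
  ∑ i, Real.exp (α i) • (innerSL ℝ (b i)).smulRight (b i)

theorem inner_dilMap (b : OrthonormalBasis (Fin d) ℝ (Euc d)) (α : Fin d → ℝ) (x : Euc d)
    (i : Fin d) : inner ℝ (b i) (dilMap b α x) = Real.exp (α i) * inner ℝ (b i) x := by
  simp [dilMap, inner_sum, inner_smul_right,
    OrthonormalBasis.inner_eq_ite]

theorem ext_inner_basis (b : OrthonormalBasis (Fin d) ℝ (Euc d)) {x y : Euc d}
    (h : ∀ i, inner ℝ (b i) x = inner ℝ (b i) y) : x = y := by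
  rw [← b.sum_repr' x, ← b.sum_repr' y]
  simp [h]

/-- `dilMap` as a linear isomorphism. -/
noncomputable def dil (b : OrthonormalBasis (Fin d) ℝ (Euc d)) (α : Fin d → ℝ) :
    Euc d ≃L[ℝ] Euc d :=
  ContinuousLinearEquiv.equivOfInverse (dilMap b α) (dilMap b (-α))
    (fun x => ext_inner_basis b fun i => by
      simp [inner_dilMap, ← mul_assoc, ← Real.exp_add])
    (fun x => ext_inner_basis b fun i => by
      simp [inner_dilMap, ← mul_assoc, ← Real.exp_add])

theorem inner_dil (b : OrthonormalBasis (Fin d) ℝ (Euc d)) (α : Fin d → ℝ) (x : Euc d)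
    (i : Fin d) : inner ℝ (b i) (dil b α x) = Real.exp (α i) * inner ℝ (b i) x :=
  inner_dilMap b α x i

theorem norm_sq_eq_sum_inner (b : OrthonormalBasis (Fin d) ℝ (Euc d)) (x : Euc d) :
    ‖x‖ ^ 2 = ∑ i, (inner ℝ (b i) x) ^ 2 := by
  rw [← b.sum_sq_norm_inner_right x]
  simp

theorem norm_dil_sq (b : OrthonormalBasis (Fin d) ℝ (Euc d)) (α : Fin d → ℝ) (x : Euc d) :
    ‖dil b α x‖ ^ 2 = ∑ i, Real.exp (2 * α i) * (inner ℝ (b i) x) ^ 2 := by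
  rw [norm_sq_eq_sum_inner b]
  refine Finset.sum_congr rfl fun i _ => ?_
  rw [inner_dil, mul_pow, ← Real.exp_nat_mul]
  norm_num

theorem dil_zero (b : OrthonormalBasis (Fin d) ℝ (Euc d)) :
    (dil b 0 : Euc d →L[ℝ] Euc d) = 1 := by
  ext1 x
  exact ext_inner_basis b fun i => by simp [inner_dil]

theorem det_dil (b : OrthonormalBasis (Fin d) ℝ (Euc d)) (α : Fin d → ℝ) :
    (dil b α : Euc d →L[ℝ] Euc d).det = Real.exp (∑ i, α i) := by
  change LinearMap.det ((dil b α : Euc d →L[ℝ] Euc d) : Euc d →ₗ[ℝ] Euc d) = _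
  rw [← LinearMap.det_toMatrix b.toBasis, Real.exp_sum, ← Matrix.det_diagonal]
  congr 1
  ext i j
  rw [LinearMap.toMatrix_apply]
  simp [OrthonormalBasis.repr_apply_apply, inner_dil, OrthonormalBasis.inner_eq_ite,
    Matrix.diagonal_apply]

/-- Polar decomposition in coordinates. -/
theorem exists_dil_of_det_ne_zero (h : Euc d →L[ℝ] Euc d) (hh : h.det ≠ 0) :
    ∃ (b : OrthonormalBasis (Fin d) ℝ (Euc d)) (α : Fin d → ℝ),
      (∀ x, ‖h x‖ ^ 2 = ∑ i, Real.exp (2 * α i) * (inner ℝ (b i) x) ^ 2) ∧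
        |h.det| = Real.exp (∑ i, α i) := by
  set hl : Euc d →ₗ[ℝ] Euc d := (h : Euc d →ₗ[ℝ] Euc d) with hhl
  have hdet : LinearMap.det hl ≠ 0 := hh
  set T : Euc d →ₗ[ℝ] Euc d := (LinearMap.adjoint hl) ∘ₗ hl
  have hT : T.IsSymmetric := LinearMap.isSymmetric_adjoint_mul_self hl
  have hn : Module.finrank ℝ (Euc d) = d := by simp
  set b := hT.eigenvectorBasis hn
  set μ := hT.eigenvalues hn
  have hb : ∀ i, T (b i) = μ i • b i := fun i => hT.apply_eigenvectorBasis hn i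
  have hin : ∀ x, ‖h x‖ ^ 2 = ∑ i, μ i * (inner ℝ (b i) x) ^ 2 := by
    intro x
    have h1 : ‖h x‖ ^ 2 = inner ℝ x (T x) := by
      rw [← real_inner_self_eq_norm_sq]
      simp only [T, LinearMap.comp_apply, LinearMap.adjoint_inner_right]
      rfl
    rw [h1, ← b.sum_inner_mul_inner]
    refine Finset.sum_congr rfl fun i _ => ?_
    rw [← hT, hb, inner_smul_left, real_inner_comm x]
    simp; ring
  have hμ : ∀ i, 0 < μ i := by
    intro i
    have h1 := hin (b i)
    simp only [OrthonormalBasis.inner_eq_ite] at h1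
    simp at h1
    rw [← h1]
    have : hl (b i) ≠ 0 := by
      intro h0
      have hi : Function.Injective hl := (LinearMap.equivOfDetNeZero hl hdet).injective
      have := hi (h0.trans (map_zero hl).symm)
      exact b.toBasis.ne_zero i (by simpa using this)
    have := norm_pos_iff.2 this
    exact pow_pos this 2
  refine ⟨b, fun i => Real.log (μ i) / 2, fun x => ?_, ?_⟩
  · rw [hin]
    refine Finset.sum_congr rfl fun i _ => ?_
    rw [mul_div_cancel₀ _ two_ne_zero, Real.exp_log (hμ i)]
  · have h1 : (h.det) ^ 2 = ∏ i, μ i := by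
      have : LinearMap.det T = ∏ i, μ i := by
        simpa using hT.det_eq_prod_eigenvalues hn
      rw [← this]
      have : LinearMap.det T = LinearMap.det (LinearMap.adjoint hl) * LinearMap.det hl :=
        LinearMap.det_comp _ _
      have hadj : LinearMap.det (LinearMap.adjoint hl) = LinearMap.det hl := by
        rw [← LinearMap.det_toMatrix b.toBasis, LinearMap.toMatrix_adjoint,
          Matrix.det_conjTranspose, LinearMap.det_toMatrix b.toBasis]
        rfl
      rw [this, hadj, pow_two]
    rw [← Real.sqrt_sq_eq_abs, h1, ← Finset.sum_div, ← Real.log_prod (fun i _ => (hμ i).ne'),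
      ← Real.log_sqrt (Finset.prod_nonneg fun i _ => (hμ i).le), Real.exp_log]
    exact Real.sqrt_pos.2 (Finset.prod_pos fun i _ => hμ i)

end Dilation

section Second

variable {d : ℕ} {F : Euc d → ℝ}

theorem hasDerivAt_integral_of_gaussian_bound {K K' : ℝ → Euc d → ℝ} {t₀ C c : ℝ} {n : ℕ}
    (hc : 0 < c) (hK : ∀ t, Continuous (K t)) (hK' : ∀ t, Continuous (K' t))
    (hInt : Integrable (K t₀))
    (hb : ∀ t ∈ Metric.ball t₀ 1, ∀ y, |K' t y| ≤ C * (‖y‖ ^ n * Real.exp (-c * ‖y‖ ^ 2)))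
    (hd : ∀ t y, HasDerivAt (fun s => K s y) (K' t y) t) :
    HasDerivAt (fun t => ∫ y, K t y) (∫ y, K' t₀ y) t₀ :=
  (hasDerivAt_integral_of_dominated_loc_of_deriv_le (Metric.ball_mem_nhds t₀ one_pos)
    (Filter.Eventually.of_forall fun t => (hK t).aestronglyMeasurable) hInt
    (hK' t₀).aestronglyMeasurable
    (Filter.Eventually.of_forall fun y t ht => hb t ht y)
    ((integrable_norm_pow_mul_gaussian n hc).const_mul C)
    (Filter.Eventually.of_forall fun y t _ => hd t y)).2

variable (b : OrthonormalBasis (Fin d) ℝ (Euc d)) (α : Fin d → ℝ)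

/-- The quadratic form `∑ i, β i * exp (2 t α i) ⟪b i, y⟫ ^ 2`. -/
noncomputable def wForm (β : Fin d → ℝ) (t : ℝ) (y : Euc d) : ℝ :=
  ∑ i, β i * (Real.exp (2 * (t * α i)) * (inner ℝ (b i) y) ^ 2)

theorem continuous_wForm (β : Fin d → ℝ) (t : ℝ) : Continuous (wForm b α β t) := by
  unfold wForm
  fun_prop

theorem norm_dil_smul_sq (t : ℝ) (y : Euc d) : ‖dil b (t • α) y‖ ^ 2 = wForm b α 1 t y := by
  rw [norm_dil_sq]
  simp [wForm]

theorem hasDerivAt_wForm (β : Fin d → ℝ) (t : ℝ) (y : Euc d) :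
    HasDerivAt (fun s => wForm b α β s y) (wForm b α (2 * α * β) t y) t := by
  unfold wForm
  have : ∀ i ∈ Finset.univ, HasDerivAt
      (fun s : ℝ => β i * (Real.exp (2 * (s * α i)) * (inner ℝ (b i) y) ^ 2))
      ((2 * α * β) i * (Real.exp (2 * (t * α i)) * (inner ℝ (b i) y) ^ 2)) t := by
    intro i _
    refine ((((((hasDerivAt_id t).mul_const (α i)).const_mul 2).exp).mul_const
      ((inner ℝ (b i) y) ^ 2)).const_mul (β i)).congr_deriv ?_
    simp
    ring
  exact HasDerivAt.fun_sum this

theorem abs_wForm_le (β : Fin d → ℝ) (t₀ : ℝ) :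
    ∃ C, 0 ≤ C ∧ ∀ t ∈ Metric.ball t₀ 1, ∀ y, |wForm b α β t y| ≤ C * ‖y‖ ^ 2 := by
  refine ⟨∑ i, |β i| * Real.exp (2 * ((|t₀| + 1) * |α i|)), by positivity, fun t ht y => ?_⟩
  rw [Finset.sum_mul]
  refine (Finset.abs_sum_le_sum_abs _ _).trans (Finset.sum_le_sum fun i _ => ?_)
  rw [abs_mul, mul_assoc, abs_of_nonneg (a := Real.exp _ * _) (by positivity)]
  have ht' : |t| ≤ |t₀| + 1 := by
    rw [Metric.mem_ball, Real.dist_eq] at ht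
    have := abs_sub_abs_le_abs_sub t t₀
    linarith
  have h1 : t * α i ≤ (|t₀| + 1) * |α i| := (le_abs_self _).trans <| by
    rw [abs_mul]; gcongr
  have h2 : (inner ℝ (b i) y) ^ 2 ≤ ‖y‖ ^ 2 := by
    rw [norm_sq_eq_sum_inner b y]
    exact Finset.single_le_sum (f := fun i => (inner ℝ (b i) y) ^ 2)
      (fun i _ => sq_nonneg _) (Finset.mem_univ i)
  gcongr

theorem wForm_one_ge (t₀ : ℝ) :
    ∃ c, 0 < c ∧ ∀ t ∈ Metric.ball t₀ 1, ∀ y, c * ‖y‖ ^ 2 ≤ wForm b α 1 t y := by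
  refine ⟨Real.exp (-(2 * ((|t₀| + 1) * ∑ i, |α i|))), by positivity, fun t ht y => ?_⟩
  rw [norm_sq_eq_sum_inner b, Finset.mul_sum]
  refine Finset.sum_le_sum fun i _ => ?_
  have ht' : |t| ≤ |t₀| + 1 := by
    rw [Metric.mem_ball, Real.dist_eq] at ht
    have := abs_sub_abs_le_abs_sub t t₀
    linarith
  have h3 : |α i| ≤ ∑ i, |α i| := Finset.single_le_sum (f := fun i => |α i|)
    (fun i _ => abs_nonneg _) (Finset.mem_univ i)
  have h1 : -((|t₀| + 1) * ∑ i, |α i|) ≤ t * α i := neg_le_of_abs_le <| by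
    rw [abs_mul]; gcongr
  simp only [Pi.one_apply, one_mul]
  gcongr
  linarith

/-- The weight of the tilt along the ray `t • α`. -/
noncomputable def wWeight (F : Euc d → ℝ) (t : ℝ) (y : Euc d) : ℝ :=
  F y * Real.exp (-(1 / 2) * wForm b α 1 t y)

theorem tilt_dil (F : Euc d → ℝ) (t : ℝ) :
    tilt F (dil b (t • α) : Euc d →L[ℝ] Euc d) = ∫ y, wWeight b α F t y := by
  simp only [tilt, wWeight, ContinuousLinearEquiv.coe_coe, norm_dil_smul_sq]

variable {b α}

theorem IsGood.wWeight_le (hF : IsGood F) (t₀ : ℝ) :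
    ∃ c, 0 < c ∧ ∀ t ∈ Metric.ball t₀ 1, ∀ y,
      wWeight b α F t y ≤ F 0 * Real.exp (-c * ‖y‖ ^ 2) := by
  obtain ⟨c, hc, h⟩ := wForm_one_ge b α t₀
  refine ⟨c / 2, by positivity, fun t ht y => ?_⟩
  unfold wWeight
  have := h t ht y
  have h0 := hF.pos 0
  refine mul_le_mul (hF.le_zero y) (Real.exp_le_exp.2 ?_) (Real.exp_pos _).le h0.le
  linarith

theorem IsGood.wWeight_pos (hF : IsGood F) (t : ℝ) (y : Euc d) : 0 < wWeight b α F t y :=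
  mul_pos (hF.pos y) (Real.exp_pos _)

theorem IsGood.continuous_wWeight (hF : IsGood F) (t : ℝ) : Continuous (wWeight b α F t) := by
  have := hF.smooth.continuous
  have := continuous_wForm b α 1 t
  unfold wWeight
  fun_prop

theorem hasDerivAt_wWeight (t : ℝ) (y : Euc d) :
    HasDerivAt (fun s => wWeight b α F s y) (-(wForm b α α t y) * wWeight b α F t y) t := by
  unfold wWeight
  refine ((((hasDerivAt_wForm b α 1 t y).const_mul (-(1 / 2))).exp).const_mul (F y)).congr_deriv ?_
  have : wForm b α (2 * α * 1) t y = 2 * wForm b α α t y := by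
    simp only [wForm, Finset.mul_sum]
    exact Finset.sum_congr rfl fun i _ => by simp; ring
  rw [this]
  ring

theorem IsGood.integrable_mul_wWeight (hF : IsGood F) (t : ℝ) {G : Euc d → ℝ} (hG : Continuous G)
    {C : ℝ} {n : ℕ} (h : ∀ x, |G x| ≤ C * ‖x‖ ^ n) :
    Integrable fun y => G y * wWeight b α F t y := by
  have := hF.integrable_tilt (dil b (t • α)) hG h
  simpa only [norm_dil_smul_sq, wWeight] using this

theorem IsGood.hasDerivAt_tilt (hF : IsGood F) (t : ℝ) :
    HasDerivAt (fun s => ∫ y, wWeight b α F s y)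
      (∫ y, -(wForm b α α t y) * wWeight b α F t y) t := by
  obtain ⟨c, hc, h⟩ := hF.wWeight_le (b := b) (α := α) t
  obtain ⟨C, hC, h'⟩ := abs_wForm_le b α α t
  refine hasDerivAt_integral_of_gaussian_bound
    (K' := fun s y => -(wForm b α α s y) * wWeight b α F s y) (C := C * F 0) (n := 2) hc hF.continuous_wWeight
    (fun t => (continuous_wForm b α α t).neg.mul (hF.continuous_wWeight t)) ?_ ?_
    (fun t y => hasDerivAt_wWeight t y)
  · simpa using hF.integrable_mul_wWeight (b := b) (α := α) t (G := fun _ => 1) continuous_const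
      (C := 1) (n := 0) (by simp)
  · intro s hs y
    rw [abs_mul, abs_neg, abs_of_pos (hF.wWeight_pos s y)]
    calc _ ≤ (C * ‖y‖ ^ 2) * (F 0 * Real.exp (-c * ‖y‖ ^ 2)) := by
          have := (hF.wWeight_pos (b := b) (α := α) s y).le
          gcongr
          · exact h' s hs y
          · exact h s hs y
      _ = _ := by ring

theorem IsGood.hasDerivAt_tilt_deriv (hF : IsGood F) (t : ℝ) :
    HasDerivAt (fun s => ∫ y, -(wForm b α α s y) * wWeight b α F s y)
      (∫ y, ((wForm b α α t y) ^ 2 - wForm b α (2 * α * α) t y) * wWeight b α F t y) t := by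
  obtain ⟨c, hc, h⟩ := hF.wWeight_le (b := b) (α := α) t
  obtain ⟨C, hC, h'⟩ := abs_wForm_le b α α t
  obtain ⟨C2, hC2, h2⟩ := abs_wForm_le b α (2 * α * α) t
  refine hasDerivAt_integral_of_gaussian_bound
    (K := fun s y => -(wForm b α α s y) * wWeight b α F s y)
    (K' := fun s y => ((wForm b α α s y) ^ 2 - wForm b α (2 * α * α) s y) * wWeight b α F s y)
    (C := (C ^ 2 * (2 / c) + C2) * F 0) (n := 2)
    (c := c / 2) (by positivity)
    (fun t => (continuous_wForm b α α t).neg.mul (hF.continuous_wWeight t))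
    (fun t => (((continuous_wForm b α α t).pow 2).sub (continuous_wForm b α _ t)).mul
      (hF.continuous_wWeight t)) ?_ ?_ ?_
  · refine hF.integrable_mul_wWeight (C := C) (n := 2) t (continuous_wForm b α α t).neg fun y => ?_
    rw [abs_neg]
    exact h' t (Metric.mem_ball_self one_pos) y
  · intro s hs y
    rw [abs_mul, abs_of_pos (hF.wWeight_pos s y)]
    have hsq : (wForm b α α s y) ^ 2 ≤ (C * ‖y‖ ^ 2) ^ 2 := by
      rw [← sq_abs]
      have := h' s hs y
      gcongr
    have hE : c / 2 * ‖y‖ ^ 2 * Real.exp (-c * ‖y‖ ^ 2) ≤ Real.exp (-(c / 2) * ‖y‖ ^ 2) := by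
      have h1 := Real.add_one_le_exp (c / 2 * ‖y‖ ^ 2)
      have h2 : Real.exp (-(c / 2) * ‖y‖ ^ 2) =
          Real.exp (c / 2 * ‖y‖ ^ 2) * Real.exp (-c * ‖y‖ ^ 2) := by
        rw [← Real.exp_add]; ring_nf
      rw [h2]
      gcongr
      linarith
    have hE2 : Real.exp (-c * ‖y‖ ^ 2) ≤ Real.exp (-(c / 2) * ‖y‖ ^ 2) := by
      refine Real.exp_le_exp.2 ?_
      nlinarith [sq_nonneg ‖y‖]
    have h0 := (hF.pos 0).le
    calc _ ≤ ((C * ‖y‖ ^ 2) ^ 2 + C2 * ‖y‖ ^ 2) * (F 0 * Real.exp (-c * ‖y‖ ^ 2)) := by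
          have := (hF.wWeight_pos (b := b) (α := α) s y).le
          gcongr
          · refine (abs_sub _ _).trans ?_
            rw [abs_of_nonneg (sq_nonneg _)]
            exact add_le_add hsq (h2 s hs y)
          · exact h s hs y
      _ = C ^ 2 * (2 / c) * ‖y‖ ^ 2 * F 0 * (c / 2 * ‖y‖ ^ 2 * Real.exp (-c * ‖y‖ ^ 2)) +
            C2 * ‖y‖ ^ 2 * F 0 * Real.exp (-c * ‖y‖ ^ 2) := by
          field_simp
      _ ≤ C ^ 2 * (2 / c) * ‖y‖ ^ 2 * F 0 * Real.exp (-(c / 2) * ‖y‖ ^ 2) +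
            C2 * ‖y‖ ^ 2 * F 0 * Real.exp (-(c / 2) * ‖y‖ ^ 2) := by gcongr
      _ = _ := by ring
  · intro s y
    refine ((hasDerivAt_wForm b α α s y).fun_neg.fun_mul (hasDerivAt_wWeight s y)).congr_deriv ?_
    ring

end Second

section LogTilt

variable {d : ℕ} {F : Euc d → ℝ} (b : OrthonormalBasis (Fin d) ℝ (Euc d)) (α : Fin d → ℝ)

/-- Logarithm of the tilted mass along the ray `t • α`. -/
noncomputable def logTilt (F : Euc d → ℝ) (t : ℝ) : ℝ :=
  Real.log (tilt F (dil b (t • α) : Euc d →L[ℝ] Euc d))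

/-- Second moment in the direction `e` of the measure tilted by `g`. -/
noncomputable def tiltCov (F : Euc d → ℝ) (g : Euc d ≃L[ℝ] Euc d) (e : Euc d) : ℝ :=
  ∫ z, (inner ℝ e z) ^ 2 * Real.exp (-tiltPotential F g z)

variable {b α}

theorem wForm_eq (β : Fin d → ℝ) (t : ℝ) (y : Euc d) :
    wForm b α β t y = ∑ i, β i * (inner ℝ (b i) (dil b (t • α) y)) ^ 2 := by
  refine Finset.sum_congr rfl fun i _ => ?_
  rw [inner_dil, mul_pow, ← Real.exp_nat_mul]
  simp

theorem IsGood.integral_tiltPotential_dil (hF : IsGood F) (t : ℝ) (G : Euc d → ℝ) :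
    ∫ z, G z * Real.exp (-tiltPotential F (dil b (t • α)) z) =
      (∫ y, G (dil b (t • α) y) * wWeight b α F t y) / ∫ y, wWeight b α F t y := by
  rw [hF.integral_tiltPotential, tilt_dil]
  simp only [norm_dil_smul_sq, wWeight]

theorem IsGood.integral_sum_tiltCov (hF : IsGood F) (g : Euc d ≃L[ℝ] Euc d) (β : Fin d → ℝ) :
    ∫ z, (∑ i, β i * (inner ℝ (b i) z) ^ 2) * Real.exp (-tiltPotential F g z) =
      ∑ i, β i * tiltCov F g (b i) := by
  simp only [Finset.sum_mul, tiltCov, ← integral_const_mul]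
  rw [integral_finsetSum]
  · simp only [mul_assoc]
  · intro i _
    simp only [mul_assoc]
    exact ((hF.isPotential g).integrable_inner_sq (b i)).const_mul _

theorem IsGood.integral_wForm (hF : IsGood F) (t : ℝ) (β : Fin d → ℝ) :
    (∫ y, wForm b α β t y * wWeight b α F t y) / (∫ y, wWeight b α F t y) =
      ∑ i, β i * tiltCov F (dil b (t • α)) (b i) := by
  rw [← hF.integral_sum_tiltCov, hF.integral_tiltPotential_dil t]
  simp only [wForm_eq]

theorem IsGood.integral_wWeight_pos (hF : IsGood F) (t : ℝ) : 0 < ∫ y, wWeight b α F t y := by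
  rw [← tilt_dil]
  exact hF.tilt_pos _

theorem IsGood.hasDerivAt_logTilt (hF : IsGood F) (t : ℝ) :
    HasDerivAt (logTilt b α F) (-∑ i, α i * tiltCov F (dil b (t • α)) (b i)) t := by
  have h := (hF.hasDerivAt_tilt (b := b) (α := α) t).log (hF.integral_wWeight_pos t).ne'
  simp only [← tilt_dil] at h
  refine h.congr_deriv ?_
  rw [← hF.integral_wForm, tilt_dil, ← neg_div, ← integral_neg]
  simp only [neg_mul]

theorem IsGood.exists_hasDerivAt_deriv_logTilt (hF : IsGood F)
    (b : OrthonormalBasis (Fin d) ℝ (Euc d)) (α : Fin d → ℝ) (t : ℝ) :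
    ∃ D, HasDerivAt (fun t => -∑ i, α i * tiltCov F (dil b (t • α)) (b i)) D t ∧
      ∀ a, 0 < a → a ≤ 1 → (∀ e, tiltCov F (dil b (t • α)) e ≤ a * ‖e‖ ^ 2) →
        D ≤ -2 * ((1 - √a) / (1 + √a)) * ∑ i, α i ^ 2 * tiltCov F (dil b (t • α)) (b i) := by
  have h := (hF.hasDerivAt_tilt_deriv (b := b) (α := α) t).fun_div
    (hF.hasDerivAt_tilt (b := b) (α := α) t) (hF.integral_wWeight_pos t).ne'
  have hE : ∀ t, (∫ y, -(wForm b α α t y) * wWeight b α F t y) / (∫ y, wWeight b α F t y) =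
      -∑ i, α i * tiltCov F (dil b (t • α)) (b i) := by
    intro t
    rw [← hF.integral_wForm, ← neg_div, ← integral_neg]
    simp only [neg_mul]
  simp only [hE] at h
  refine ⟨_, h, fun a ha ha1 hcov => ?_⟩
  have hV := hF.isPotential (dil b (t • α))
  have hQ := hV.variance_quadratic_le ha ha1 hcov b α
  rw [hF.integral_sum_tiltCov, hF.integral_tiltPotential_dil t] at hQ
  simp only [← wForm_eq] at hQ
  have hP := hF.integral_wWeight_pos (b := b) (α := α) t
  obtain ⟨C, hC, hC'⟩ := abs_wForm_le b α α t
  obtain ⟨C2, hC2, hC2'⟩ := abs_wForm_le b α (2 * α * α) t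
  have hi1 : Integrable fun y => (wForm b α α t y) ^ 2 * wWeight b α F t y := by
    refine hF.integrable_mul_wWeight (C := C ^ 2) (n := 4) t ((continuous_wForm b α α t).pow 2)
      fun y => ?_
    rw [abs_pow]
    calc _ ≤ (C * ‖y‖ ^ 2) ^ 2 := by gcongr; exact hC' t (Metric.mem_ball_self one_pos) y
      _ = _ := by ring
  have hi2 : Integrable fun y => wForm b α (2 * α * α) t y * wWeight b α F t y :=
    hF.integrable_mul_wWeight (C := C2) (n := 2) t (continuous_wForm b α _ t)
      fun y => hC2' t (Metric.mem_ball_self one_pos) y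
  have hsub : (∫ y, ((wForm b α α t y) ^ 2 - wForm b α (2 * α * α) t y) * wWeight b α F t y) =
      (∫ y, (wForm b α α t y) ^ 2 * wWeight b α F t y) -
        ∫ y, wForm b α (2 * α * α) t y * wWeight b α F t y := by
    rw [← integral_sub hi1 hi2]
    simp only [sub_mul]
  have h2 := hF.integral_wForm (b := b) (α := α) t (2 * α * α)
  have h1 := hE t
  set P := ∫ y, wWeight b α F t y
  set P1 := ∫ y, -(wForm b α α t y) * wWeight b α F t y
  set A := ∫ y, (wForm b α α t y) ^ 2 * wWeight b α F t y
  set B := ∫ y, wForm b α (2 * α * α) t y * wWeight b α F t y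
  rw [hsub]
  have hs : ∑ i, (2 * α * α) i * tiltCov F (dil b (t • α)) (b i) =
      2 * ∑ i, α i ^ 2 * tiltCov F (dil b (t • α)) (b i) := by
    rw [Finset.mul_sum]
    exact Finset.sum_congr rfl fun i _ => by simp; ring
  rw [hs] at h2
  have hQ' : A / P - (∑ i, α i * tiltCov F (dil b (t • α)) (b i)) ^ 2 ≤
    4 / (1 + (√a)⁻¹) * ∑ i, α i ^ 2 * tiltCov F (dil b (t • α)) (b i) := hQ
  set S := ∑ i, α i ^ 2 * tiltCov F (dil b (t • α)) (b i)
  set M := ∑ i, α i * tiltCov F (dil b (t • α)) (b i)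
  have hsa : 0 < √a := Real.sqrt_pos.2 ha
  have e1 : ((A - B) * P - P1 * P1) / P ^ 2 = A / P - B / P - (P1 / P) ^ 2 := by
    field_simp
  have e2 : -2 * ((1 - √a) / (1 + √a)) * S = 4 / (1 + (√a)⁻¹) * S - 2 * S := by
    field_simp
    ring
  rw [e1, e2, h2, h1]
  linarith [neg_sq M]

end LogTilt

section Stability

variable {d : ℕ} {F : Euc d → ℝ} {lam : ℝ}

/-- Second moment of the tilted measure, for a possibly degenerate tilt. -/
noncomputable def tiltMoment (F : Euc d → ℝ) (h : Euc d →L[ℝ] Euc d) (e : Euc d) : ℝ :=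
  ∫ y, (inner ℝ e (h y)) ^ 2 * (F y * Real.exp (-(1 / 2) * ‖h y‖ ^ 2))

theorem IsGood.tiltCov_eq (hF : IsGood F) (g : Euc d ≃L[ℝ] Euc d) (e : Euc d) :
    tiltCov F g e = tiltMoment F (g : Euc d →L[ℝ] Euc d) e / tilt F (g : Euc d →L[ℝ] Euc d) :=
  hF.integral_tiltPotential g _

theorem norm_half_le_of_near_one {h : Euc d →L[ℝ] Euc d} (hh : ‖h - 1‖ < 1 / 2) (y : Euc d) :
    1 / 2 * ‖y‖ ≤ ‖h y‖ ∧ ‖h y‖ ≤ 2 * ‖y‖ := by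
  have h1 := (h - 1).le_opNorm y
  have h2 : (h - 1) y = h y - y := by simp
  rw [h2] at h1
  have h3 : ‖h y - y‖ ≤ 1 / 2 * ‖y‖ := h1.trans (by gcongr)
  have h4 := norm_sub_norm_le (h y) y
  have h5 := norm_sub_norm_le y (h y)
  rw [norm_sub_rev] at h5
  constructor <;> nlinarith [norm_nonneg y]

theorem near_one_mem_nhds (h : Euc d →L[ℝ] Euc d) (hh : h = 1) :
    ∀ᶠ g in nhds h, ‖g - 1‖ < 1 / 2 := by
  subst hh
  have : Continuous fun g : Euc d →L[ℝ] Euc d => ‖g - 1‖ := by fun_prop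
  exact this.continuousAt.eventually (gt_mem_nhds (by simp))

theorem IsGood.exp_le_of_near_one (hF : IsGood F) {h : Euc d →L[ℝ] Euc d} (hh : ‖h - 1‖ < 1 / 2)
    (y : Euc d) :
    F y * Real.exp (-(1 / 2) * ‖h y‖ ^ 2) ≤ F 0 * Real.exp (-(1 / 8) * ‖y‖ ^ 2) := by
  refine mul_le_mul (hF.le_zero y) (Real.exp_le_exp.2 ?_) (Real.exp_pos _).le (hF.pos 0).le
  have := pow_le_pow_left₀ (by positivity) (norm_half_le_of_near_one hh y).1 2
  nlinarith

theorem IsGood.continuousAt_tilt (hF : IsGood F) : ContinuousAt (tilt F) 1 := by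
  have hc := hF.smooth.continuous
  refine continuousAt_of_dominated (bound := fun y =>
      F 0 * (‖y‖ ^ 0 * Real.exp (-(1 / 8) * ‖y‖ ^ 2)))
    (Filter.Eventually.of_forall fun h => (hc.mul (by fun_prop)).aestronglyMeasurable) ?_
    ((integrable_norm_pow_mul_gaussian 0 (by norm_num)).const_mul _)
    (Filter.Eventually.of_forall fun y => by fun_prop)
  filter_upwards [near_one_mem_nhds 1 rfl] with h hh
  refine Filter.Eventually.of_forall fun y => ?_
  have := hF.pos y
  rw [Real.norm_eq_abs, abs_of_pos (by positivity), pow_zero, one_mul]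
  exact hF.exp_le_of_near_one hh y

theorem IsGood.continuousAt_tiltMoment (hF : IsGood F) (e : Euc d) :
    ContinuousAt (fun p : (Euc d →L[ℝ] Euc d) × Euc d => tiltMoment F p.1 p.2) (1, e) := by
  have hc := hF.smooth.continuous
  refine continuousAt_of_dominated (bound := fun y =>
      (4 * (‖e‖ + 1) ^ 2 * F 0) * (‖y‖ ^ 2 * Real.exp (-(1 / 8) * ‖y‖ ^ 2)))
    (Filter.Eventually.of_forall fun h =>
      ((by fun_prop : Continuous fun y => (inner ℝ h.2 (h.1 y)) ^ 2).mul
        (hc.mul (by fun_prop))).aestronglyMeasurable) ?_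
    ((integrable_norm_pow_mul_gaussian 2 (by norm_num)).const_mul _)
    (Filter.Eventually.of_forall fun y => by fun_prop)
  have h1 : ∀ᶠ p : (Euc d →L[ℝ] Euc d) × Euc d in nhds (1, e), ‖p.1 - 1‖ < 1 / 2 :=
    (continuous_fst.tendsto (1, e)).eventually (near_one_mem_nhds 1 rfl)
  have h2 : ∀ᶠ p : (Euc d →L[ℝ] Euc d) × Euc d in nhds (1, e), ‖p.2‖ < ‖e‖ + 1 :=
    (continuous_snd.norm.tendsto (1, e)).eventually (gt_mem_nhds (by simp))
  filter_upwards [h1, h2] with p hp hp2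
  refine Filter.Eventually.of_forall fun y => ?_
  have hpos := hF.pos y
  have h0 := (hF.pos 0).le
  rw [Real.norm_eq_abs, abs_of_nonneg (by positivity)]
  have h3 : (inner ℝ p.2 (p.1 y)) ^ 2 ≤ ((‖e‖ + 1) * (2 * ‖y‖)) ^ 2 := by
    rw [← sq_abs]
    gcongr
    refine (abs_real_inner_le_norm _ _).trans ?_
    gcongr
    exact (norm_half_le_of_near_one hp y).2
  calc _ ≤ ((‖e‖ + 1) * (2 * ‖y‖)) ^ 2 * (F 0 * Real.exp (-(1 / 8) * ‖y‖ ^ 2)) := by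
        exact mul_le_mul h3 (hF.exp_le_of_near_one hp y) (by positivity) (by positivity)
    _ = _ := by ring

theorem exists_orthonormalBasis_apply_eq (e : Euc d) (he : ‖e‖ = 1) :
    ∃ (b : OrthonormalBasis (Fin d) ℝ (Euc d)) (i : Fin d), b i = e := by
  have hd : 0 < d := by
    rcases Nat.eq_zero_or_pos d with rfl | h
    · rw [Subsingleton.elim e 0, norm_zero] at he
      exact absurd he (by norm_num)
    · exact h
  let i : Fin d := ⟨0, hd⟩
  have ho : Orthonormal ℝ (({i} : Set (Fin d)).domRestrict fun _ => e) := by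
    constructor
    · intro j; exact he
    · intro j k hjk
      exact absurd (Subsingleton.elim j k) hjk
  obtain ⟨b, hb⟩ := ho.exists_orthonormalBasis_extension_of_card_eq (by simp)
  exact ⟨b, i, hb i rfl⟩

theorem dil_zero_eq_refl (b : OrthonormalBasis (Fin d) ℝ (Euc d)) :
    dil b 0 = ContinuousLinearEquiv.refl ℝ (Euc d) :=
  ContinuousLinearEquiv.coe_injective (dil_zero b)

theorem IsGood.tiltCov_eq_of_isMax (hF : IsGood F)
    (hmax : ∀ h : Euc d →L[ℝ] Euc d, |h.det| ^ lam * tilt F h ≤ tilt F 1)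
    (b : OrthonormalBasis (Fin d) ℝ (Euc d)) (i : Fin d) :
    tiltCov F (ContinuousLinearEquiv.refl ℝ (Euc d)) (b i) = lam := by
  set α : Fin d → ℝ := Pi.single i 1
  have hs : ∑ i, α i = 1 := by simp [α]
  have h1 : ∀ t, lam * t + logTilt b α F t ≤ lam * 0 + logTilt b α F 0 := by
    intro t
    have := Real.log_le_log (by
      have := abs_det_pos (dil b (t • α))
      have := hF.tilt_pos (dil b (t • α))
      positivity) (hmax (dil b (t • α)))
    rw [Real.log_mul (Real.rpow_pos_of_pos (abs_det_pos _) _).ne' (hF.tilt_pos _).ne',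
      Real.log_rpow (abs_det_pos _), det_dil, abs_of_pos (Real.exp_pos _), Real.log_exp] at this
    simp only [Pi.smul_apply, smul_eq_mul, ← Finset.mul_sum, hs, mul_one] at this
    simpa only [logTilt, zero_smul, dil_zero, mul_zero, zero_add] using this
  have h2 := ((hasDerivAt_id (0 : ℝ)).const_mul lam).fun_add
    (hF.hasDerivAt_logTilt (b := b) (α := α) 0)
  have h3 := IsLocalMax.hasDerivAt_eq_zero (Filter.Eventually.of_forall h1) h2
  rw [zero_smul, dil_zero_eq_refl] at h3
  simp [α, Pi.single_apply] at h3
  linarith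

/-- Near the maximiser all the second moments are close to `lam`. -/
theorem IsGood.exists_tiltCov_near (hF : IsGood F)
    (hmax : ∀ h : Euc d →L[ℝ] Euc d, |h.det| ^ lam * tilt F h ≤ tilt F 1)
    {η : ℝ} (hη : 0 < η) :
    ∃ r > 0, ∀ (b : OrthonormalBasis (Fin d) ℝ (Euc d)) (α : Fin d → ℝ), ‖α‖ ≤ r →
      ∀ e, ‖e‖ = 1 → |tiltCov F (dil b α) e - lam| < η := by
  have hT : 0 < tilt F (1 : Euc d →L[ℝ] Euc d) :=
    hF.tilt_pos (ContinuousLinearEquiv.refl ℝ (Euc d))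
  have key : ∀ᶠ h in nhds (1 : Euc d →L[ℝ] Euc d), ∀ e ∈ Metric.sphere (0 : Euc d) 1,
      |tiltMoment F h e / tilt F h - lam| < η := by
    refine (isCompact_sphere (0 : Euc d) 1).eventually_forall_of_forall_eventually fun e he => ?_
    have he1 : ‖e‖ = 1 := by simpa using he
    obtain ⟨b, i, rfl⟩ := exists_orthonormalBasis_apply_eq e he1
    have h1 := hF.tiltCov_eq_of_isMax hmax b i
    rw [hF.tiltCov_eq] at h1
    have hcont : ContinuousAt (fun p : (Euc d →L[ℝ] Euc d) × Euc d =>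
        |tiltMoment F p.1 p.2 / tilt F p.1 - lam|) (1, b i) :=
      (((hF.continuousAt_tiltMoment (b i)).div (ContinuousAt.comp (x := ((1, b i) :
        (Euc d →L[ℝ] Euc d) × Euc d)) (g := tilt F) (f := Prod.fst) hF.continuousAt_tilt
          continuousAt_fst) hT.ne').sub continuousAt_const).abs
    refine hcont.eventually (gt_mem_nhds ?_)
    have h1' : tiltMoment F 1 (b i) / tilt F 1 = lam := h1
    simp [h1', hη]
  obtain ⟨δ, hδ, hδ'⟩ := Metric.eventually_nhds_iff.1 key
  obtain ⟨r, hr, hr'⟩ : ∃ r > 0, Real.exp r - 1 < δ := by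
    refine ⟨Real.log (1 + δ / 2), Real.log_pos (by linarith), ?_⟩
    rw [Real.exp_log (by positivity)]
    linarith
  refine ⟨r, hr, fun b α hα e he => ?_⟩
  rw [hF.tiltCov_eq]
  refine hδ' ?_ e (by simpa using he)
  rw [dist_eq_norm]
  refine lt_of_le_of_lt (ContinuousLinearMap.opNorm_le_bound _ ?_ fun y => ?_) hr'
  · linarith [Real.add_one_le_exp r]
  have hr0 : 0 ≤ Real.exp r - 1 := by linarith [Real.add_one_le_exp r]
  refine (pow_le_pow_iff_left₀ (norm_nonneg _) (by positivity) two_ne_zero).1 ?_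
  rw [mul_pow, norm_sq_eq_sum_inner b, norm_sq_eq_sum_inner b y, Finset.mul_sum]
  refine Finset.sum_le_sum fun i _ => ?_
  have : inner ℝ (b i) (((dil b α : Euc d →L[ℝ] Euc d) - 1) y) =
      (Real.exp (α i) - 1) * inner ℝ (b i) y := by
    simp [inner_sub_right, inner_dil]; ring
  rw [this, mul_pow]
  gcongr ?_ * _
  have hi : |α i| ≤ r := (norm_le_pi_norm α i).trans hα
  rw [← sq_abs]
  gcongr
  rw [abs_le]
  have h1 := Real.exp_le_exp.2 (abs_le.1 hi).2
  have h2 := Real.exp_le_exp.2 (abs_le.1 hi).1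
  have h3 : 2 ≤ Real.exp r + Real.exp (-r) := by
    have := Real.add_one_le_exp r
    have := Real.add_one_le_exp (-r)
    linarith
  constructor <;> linarith

end Stability

section Maximum

variable {d : ℕ} {F : Euc d → ℝ} {lam : ℝ}

theorem le_of_second_deriv_le {f f' f'' : ℝ → ℝ} {M : ℝ} (h : ∀ t, HasDerivAt f (f' t) t)
    (h' : ∀ t, HasDerivAt f' (f'' t) t) (h0 : f 0 = 0) (h0' : f' 0 = 0)
    (hM : ∀ t ∈ Set.Icc (0 : ℝ) 1, f'' t ≤ 2 * M) : f 1 ≤ M := by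
  have a1 : ∀ t ∈ Set.Icc (0 : ℝ) 1, f' t - 2 * M * t ≤ 0 := by
    have hd : ∀ t, HasDerivAt (fun t => f' t - 2 * M * t) (f'' t - 2 * M) t := fun t =>
      ((h' t).fun_sub ((hasDerivAt_id t).const_mul (2 * M))).congr_deriv (by simp)
    have hanti : AntitoneOn (fun t => f' t - 2 * M * t) (Set.Icc 0 1) := by
      refine antitoneOn_of_deriv_nonpos (convex_Icc 0 1)
        (fun t _ => (hd t).continuousAt.continuousWithinAt)
        (fun t _ => (hd t).differentiableAt.differentiableWithinAt) fun t ht => ?_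
      rw [(hd t).deriv]
      linarith [hM t (interior_subset ht)]
    intro t ht
    have := hanti (Set.left_mem_Icc.2 zero_le_one) ht ht.1
    simpa [h0'] using this
  have hd : ∀ t, HasDerivAt (fun t => f t - M * t ^ 2) (f' t - 2 * M * t) t := fun t =>
    ((h t).fun_sub ((hasDerivAt_pow 2 t).const_mul M)).congr_deriv (by simp; ring)
  have hanti : AntitoneOn (fun t => f t - M * t ^ 2) (Set.Icc 0 1) := by
    refine antitoneOn_of_deriv_nonpos (convex_Icc 0 1)
      (fun t _ => (hd t).continuousAt.continuousWithinAt)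
      (fun t _ => (hd t).differentiableAt.differentiableWithinAt) fun t ht => ?_
    rw [(hd t).deriv]
    exact a1 t (interior_subset ht)
  have := hanti (Set.left_mem_Icc.2 zero_le_one) (Set.right_mem_Icc.2 zero_le_one) zero_le_one
  simp [h0] at this
  exact this

/-- The contraction factor of the improved spectral gap. -/
noncomputable def gapFactor (a : ℝ) : ℝ := (1 - √a) / (1 + √a)

theorem IsGood.concave_excess (hF : IsGood F) (b : OrthonormalBasis (Fin d) ℝ (Euc d))
    (α : Fin d → ℝ) {t : ℝ} (ht : t ∈ Set.Icc (0 : ℝ) 1) :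
    t * (logTilt b α F 1 - logTilt b α F 0) ≤ logTilt b α F t - logTilt b α F 0 := by
  choose D hD hD' using hF.exists_hasDerivAt_deriv_logTilt b α
  have hneg : ∀ t, D t ≤ 0 := by
    intro t
    have := hD' t 1 one_pos le_rfl fun e => (hF.isPotential _).cov_le_one e
    simpa using this
  have hconc : ConcaveOn ℝ (Set.Icc 0 1) (logTilt b α F) := by
    refine AntitoneOn.concaveOn_of_deriv (convex_Icc 0 1)
      (fun t _ => (hF.hasDerivAt_logTilt t).continuousAt.continuousWithinAt)
      (fun t _ => (hF.hasDerivAt_logTilt t).differentiableAt.differentiableWithinAt) ?_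
    have : deriv (logTilt b α F) = fun t => -∑ i, α i * tiltCov F (dil b (t • α)) (b i) :=
      funext fun t => (hF.hasDerivAt_logTilt t).deriv
    rw [this]
    refine antitoneOn_of_deriv_nonpos (convex_Icc 0 1).interior
      (fun t _ => (hD t).continuousAt.continuousWithinAt)
      (fun t _ => (hD t).differentiableAt.differentiableWithinAt) fun t _ => ?_
    rw [(hD t).deriv]
    exact hneg t
  have := hconc.2 (Set.left_mem_Icc.2 zero_le_one) (Set.right_mem_Icc.2 zero_le_one)
    (sub_nonneg.2 ht.2) ht.1 (by ring)
  simp only [smul_eq_mul, mul_zero, mul_one, zero_add] at this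
  linarith

theorem logTilt_smul (b : OrthonormalBasis (Fin d) ℝ (Euc d)) (α : Fin d → ℝ) (s t : ℝ) :
    logTilt b (s • α) F t = logTilt b α F (t * s) := by
  simp [logTilt, smul_smul]

theorem logTilt_zero (b : OrthonormalBasis (Fin d) ℝ (Euc d)) (α : Fin d → ℝ) :
    logTilt b α F 0 = Real.log (tilt F 1) := by
  simp [logTilt, dil_zero]

/-- Quadratic decay near the maximiser. -/
theorem IsGood.exists_quadratic_decay (hF : IsGood F) (hl : 0 < lam) (hl1 : lam < 1)
    (hmax : ∀ h : Euc d →L[ℝ] Euc d, |h.det| ^ lam * tilt F h ≤ tilt F 1)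
    {k : ℝ} (hk : k < gapFactor lam * lam) :
    ∃ r > 0, ∀ (b : OrthonormalBasis (Fin d) ℝ (Euc d)) (α : Fin d → ℝ), ‖α‖ ≤ r →
      lam * (∑ i, α i) + (logTilt b α F 1 - Real.log (tilt F 1)) ≤ -k * ∑ i, α i ^ 2 := by
  have hcont : ContinuousAt (fun η : ℝ => gapFactor (lam + η) * (lam - η)) 0 := by
    unfold gapFactor
    refine ContinuousAt.mul (ContinuousAt.div (by fun_prop) (by fun_prop) ?_) (by fun_prop)
    positivity
  have hev : ∀ᶠ η in nhds (0 : ℝ), k < gapFactor (lam + η) * (lam - η) :=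
    hcont.eventually (lt_mem_nhds (by simpa using hk))
  obtain ⟨δ, hδ, hδ'⟩ := Metric.eventually_nhds_iff.1 hev
  set η := min (δ / 2) (min ((1 - lam) / 2) (lam / 2))
  have hη : 0 < η := by
    have : 0 < 1 - lam := by linarith
    positivity
  have hη1 : η ≤ (1 - lam) / 2 := (min_le_right _ _).trans (min_le_left _ _)
  have hη2 : η ≤ lam / 2 := (min_le_right _ _).trans (min_le_right _ _)
  have hkη : k < gapFactor (lam + η) * (lam - η) := hδ' (by
    rw [Real.dist_eq, sub_zero, abs_of_pos hη]
    exact (min_le_left _ _).trans_lt (by linarith))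
  obtain ⟨r, hr, hr'⟩ := hF.exists_tiltCov_near hmax hη
  refine ⟨r, hr, fun b α hα => ?_⟩
  choose D hD hD' using hF.exists_hasDerivAt_deriv_logTilt b α
  rw [← logTilt_zero b α]
  have hlin : ∀ t : ℝ, HasDerivAt (fun t : ℝ => lam * t * ∑ i, α i) (lam * ∑ i, α i) t := fun t =>
    (((hasDerivAt_id t).const_mul lam).mul_const _).congr_deriv (by simp)
  have := le_of_second_deriv_le
    (f := fun t => lam * t * (∑ i, α i) + (logTilt b α F t - logTilt b α F 0))
    (f' := fun t => lam * (∑ i, α i) + -∑ i, α i * tiltCov F (dil b (t • α)) (b i))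
    (f'' := D) (M := -k * ∑ i, α i ^ 2)
    (fun t => (hlin t).fun_add ((hF.hasDerivAt_logTilt t).sub_const _))
    (fun t => (hD t).const_add _) (by simp) ?_ ?_
  · simpa using this
  · simp only [zero_smul, dil_zero_eq_refl, hF.tiltCov_eq_of_isMax hmax, ← Finset.sum_mul]
    ring
  · intro t ht
    have htα : ‖t • α‖ ≤ r := by
      rw [norm_smul, Real.norm_eq_abs, abs_of_nonneg ht.1]
      nlinarith [norm_nonneg α, ht.2]
    have hnear := hr' b (t • α) htα
    have hb1 : ∀ e, tiltCov F (dil b (t • α)) e ≤ (lam + η) * ‖e‖ ^ 2 := by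
      intro e
      rcases eq_or_ne e 0 with rfl | he
      · simp [tiltCov]
      have hne : ‖e‖ ≠ 0 := norm_ne_zero_iff.2 he
      have h1 := hnear (‖e‖⁻¹ • e) (by rw [norm_smul, norm_inv, norm_norm, inv_mul_cancel₀ hne])
      have h2 : tiltCov F (dil b (t • α)) (‖e‖⁻¹ • e) =
          (‖e‖ ^ 2)⁻¹ * tiltCov F (dil b (t • α)) e := by
        simp only [tiltCov, inner_smul_left, mul_pow, mul_assoc, integral_const_mul]
        simp
      rw [h2] at h1
      have h3 := (abs_lt.1 h1).2
      have h4 : (‖e‖ ^ 2)⁻¹ * tiltCov F (dil b (t • α)) e ≤ lam + η := by linarith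
      rwa [inv_mul_le_iff₀ (by positivity), mul_comm] at h4
    have hb2 : ∀ i, lam - η ≤ tiltCov F (dil b (t • α)) (b i) := fun i => by
      linarith [(abs_lt.1 (hnear (b i) (b.norm_eq_one i))).1]
    have h1 := hD' t (lam + η) (by linarith) (by linarith) hb1
    have hg : 0 ≤ gapFactor (lam + η) := by
      refine div_nonneg (sub_nonneg.2 ?_) (by positivity)
      exact Real.sqrt_le_one.2 (by linarith)
    have h2 : (lam - η) * ∑ i, α i ^ 2 ≤ ∑ i, α i ^ 2 * tiltCov F (dil b (t • α)) (b i) := by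
      rw [Finset.mul_sum]
      refine Finset.sum_le_sum fun i _ => ?_
      rw [mul_comm]
      gcongr
      exact hb2 i
    have h3 : 0 ≤ ∑ i, α i ^ 2 := Finset.sum_nonneg fun i _ => sq_nonneg _
    have h4 := mul_le_mul_of_nonneg_left h2 hg
    have h5 := mul_le_mul_of_nonneg_right hkη.le h3
    change D t ≤ -2 * gapFactor (lam + η) * _ at h1
    linarith

/-- Quantitative stability of the maximum under a change of the exponent. -/
theorem IsGood.stability (hF : IsGood F) (hl : 0 < lam) (hl1 : lam < 1)
    (hmax : ∀ h : Euc d →L[ℝ] Euc d, |h.det| ^ lam * tilt F h ≤ tilt F 1)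
    {k : ℝ} (hk0 : 0 < k) (hk : k < gapFactor lam * lam) :
    ∃ ε₀ > 0, ∀ ε, |ε| < ε₀ → ∀ h : Euc d →L[ℝ] Euc d,
      |h.det| ^ (lam + ε) * tilt F h ≤ tilt F 1 * Real.exp (d * ε ^ 2 / (4 * k)) := by
  obtain ⟨r, hr, hdec⟩ := hF.exists_quadratic_decay hl hl1 hmax hk
  have hT : 0 < tilt F (1 : Euc d →L[ℝ] Euc d) :=
    hF.tilt_pos (ContinuousLinearEquiv.refl ℝ (Euc d))
  refine ⟨min lam (k * r / (d + 1)), by positivity, fun ε hε h => ?_⟩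
  have hε1 : |ε| < lam := hε.trans_le (min_le_left _ _)
  have hε2 : |ε| * (d + 1) ≤ k * r := by
    have := hε.le.trans (min_le_right _ _)
    rwa [le_div_iff₀ (by positivity)] at this
  by_cases hdet : h.det = 0
  · rw [hdet, abs_zero, Real.zero_rpow (by linarith [(abs_lt.1 hε1).1]), zero_mul]
    positivity
  obtain ⟨b, α, hb, hdα⟩ := exists_dil_of_det_ne_zero h hdet
  have htilt : tilt F h = Real.exp (logTilt b α F 1) := by
    rw [logTilt, one_smul, Real.exp_log (hF.tilt_pos _)]
    simp only [tilt, ContinuousLinearEquiv.coe_coe, norm_dil_sq, hb]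
  have hgoal : (lam + ε) * (∑ i, α i) + (logTilt b α F 1 - Real.log (tilt F 1)) ≤
      d * ε ^ 2 / (4 * k) := by
    have hs : |∑ i, α i| ≤ d * ‖α‖ := by
      refine (Finset.abs_sum_le_sum_abs _ _).trans ?_
      refine (Finset.sum_le_sum fun i _ => norm_le_pi_norm α i).trans ?_
      simp
    by_cases hα : ‖α‖ ≤ r
    · have h1 := hdec b α hα
      have h2 : ε * (∑ i, α i) - k * ∑ i, α i ^ 2 ≤ d * ε ^ 2 / (4 * k) := by
        rw [Finset.mul_sum, Finset.mul_sum, ← Finset.sum_sub_distrib]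
        calc _ ≤ ∑ _i : Fin d, ε ^ 2 / (4 * k) := by
              refine Finset.sum_le_sum fun i _ => ?_
              rw [le_div_iff₀ (by positivity)]
              nlinarith [sq_nonneg (2 * k * α i - ε)]
          _ = _ := by simp; ring
      linarith
    · push Not at hα
      have hαp : 0 < ‖α‖ := hr.trans hα
      set t := r / ‖α‖
      have ht : 0 < t := by positivity
      have ht1 : t ≤ 1 := (div_le_one hαp).2 hα.le
      have htα : ‖t • α‖ = r := by
        rw [norm_smul, Real.norm_eq_abs, abs_of_pos ht, div_mul_cancel₀ _ hαp.ne']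
      have h1 := hdec b (t • α) htα.le
      have h2 := hF.concave_excess b α ⟨ht.le, ht1⟩
      rw [logTilt_zero] at h2
      rw [logTilt_smul, one_mul] at h1
      have h3 : r ^ 2 ≤ ∑ i, (t • α) i ^ 2 := by
        obtain ⟨i, hi⟩ : ∃ i, r ≤ |(t • α) i| := by
          by_contra! hc
          have := (pi_norm_lt_iff (x := t • α) hr).2 hc
          linarith
        calc r ^ 2 ≤ |(t • α) i| ^ 2 := by gcongr
          _ = (t • α) i ^ 2 := sq_abs _
          _ ≤ _ := Finset.single_le_sum (f := fun i => (t • α) i ^ 2) (fun i _ => sq_nonneg _)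
            (Finset.mem_univ i)
      have h4 : ∑ i, (t • α) i = t * ∑ i, α i := by simp [Finset.mul_sum]
      rw [h4] at h1
      have h5 : t * (ε * ∑ i, α i) ≤ |ε| * (d * r) := by
        calc t * (ε * ∑ i, α i) ≤ t * (|ε| * (d * ‖α‖)) := by
              refine mul_le_mul_of_nonneg_left ((le_abs_self _).trans ?_) ht.le
              rw [abs_mul]
              gcongr
          _ = |ε| * (d * r) := by simp only [t]; field_simp
      have h6 : t * ((lam + ε) * (∑ i, α i) + (logTilt b α F 1 - Real.log (tilt F 1))) ≤ 0 := by
        have h7 := mul_le_mul_of_nonneg_left h3 hk0.le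
        have h8 := mul_le_mul_of_nonneg_right hε2 hr.le
        have h9 : 0 ≤ |ε| * r := by positivity
        nlinarith
      have h7 : (lam + ε) * (∑ i, α i) + (logTilt b α F 1 - Real.log (tilt F 1)) ≤ 0 := by
        by_contra! hc
        linarith [mul_pos ht hc]
      exact h7.trans (by positivity)
  rw [hdα, htilt, ← Real.exp_mul]
  nth_rewrite 1 [← Real.exp_log hT]
  rw [← Real.exp_add, ← Real.exp_add, Real.exp_le_exp]
  linarith

end Maximum

section Existence

variable {d : ℕ} {f : Euc d → ℝ} {lam : ℝ}

theorem tilt_integrand_le (hf : IsGood f) (h : Euc d →L[ℝ] Euc d) (y : Euc d) :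
    ‖f y * Real.exp (-(1 / 2) * ‖h y‖ ^ 2)‖ ≤ f y := by
  have := hf.pos y
  rw [Real.norm_eq_abs, abs_of_pos (by positivity)]
  refine mul_le_of_le_one_right this.le (Real.exp_le_one_iff.2 ?_)
  nlinarith [sq_nonneg ‖h y‖]

theorem IsGood.continuous_tilt (hf : IsGood f) (hi : Integrable f) : Continuous (tilt f) := by
  have hc := hf.smooth.continuous
  refine continuous_of_dominated (fun h => (hc.mul (by fun_prop)).aestronglyMeasurable)
    (fun h => Filter.Eventually.of_forall (tilt_integrand_le hf h)) hi
    (Filter.Eventually.of_forall fun y => by fun_prop)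

theorem IsGood.integrable_tilt_of_integrable (hf : IsGood f) (hi : Integrable f)
    (h : Euc d →L[ℝ] Euc d) : Integrable fun y => f y * Real.exp (-(1 / 2) * ‖h y‖ ^ 2) :=
  hi.mono' (hf.smooth.continuous.mul (by fun_prop)).aestronglyMeasurable
    (Filter.Eventually.of_forall (tilt_integrand_le hf h))

theorem IsGood.tilt_nonneg (hf : IsGood f) (h : Euc d →L[ℝ] Euc d) : 0 ≤ tilt f h :=
  integral_nonneg fun y => mul_nonneg (hf.pos y).le (Real.exp_pos _).le

theorem IsGood.tilt_le_of_norm_le (hf : IsGood f) (hi : Integrable f) {g h : Euc d →L[ℝ] Euc d}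
    (hgh : ∀ y, ‖g y‖ ≤ ‖h y‖) : tilt f h ≤ tilt f g := by
  refine integral_mono (hf.integrable_tilt_of_integrable hi h)
    (hf.integrable_tilt_of_integrable hi g) fun y => ?_
  have h1 := pow_le_pow_left₀ (norm_nonneg _) (hgh y) 2
  refine mul_le_mul_of_nonneg_left (Real.exp_le_exp.2 ?_) (hf.pos y).le
  linarith

/-- The isomorphism attached to a map with nonzero determinant. -/
theorem exists_equiv_of_det_ne_zero (h : Euc d →L[ℝ] Euc d) (hh : h.det ≠ 0) :
    ∃ e : Euc d ≃L[ℝ] Euc d, (e : Euc d →L[ℝ] Euc d) = h :=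
  ⟨h.toContinuousLinearEquivOfDetNeZero hh, h.coe_toContinuousLinearEquivOfDetNeZero hh⟩

theorem IsGood.det_mul_tilt_le (hf : IsGood f) (h : Euc d →L[ℝ] Euc d) :
    |h.det| * tilt f h ≤ f 0 * ∫ z : Euc d, Real.exp (-(1 / 2) * ‖z‖ ^ 2) := by
  have h0 := hf.pos 0
  by_cases hh : h.det = 0
  · rw [hh, abs_zero, zero_mul]
    have : 0 ≤ ∫ z : Euc d, Real.exp (-(1 / 2) * ‖z‖ ^ 2) := integral_nonneg fun z => by positivity
    positivity
  obtain ⟨e, rfl⟩ := exists_equiv_of_det_ne_zero h hh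
  have h1 := integral_comp_symm e (fun y => Real.exp (-(1 / 2) * ‖e y‖ ^ 2))
  simp only [ContinuousLinearEquiv.apply_symm_apply] at h1
  rw [h1, mul_left_comm]
  refine mul_le_mul_of_nonneg_left ?_ (abs_nonneg _)
  rw [← integral_const_mul]
  have hgood : IsGood fun _ : Euc d => (1 : ℝ) :=
    ⟨contDiff_const, fun _ => one_pos, fun _ => rfl, fun _ _ => by simp⟩
  have hInt := hgood.integrable_tilt_one e
  simp only [one_mul] at hInt
  refine integral_mono (hf.integrable_tilt_one e) (hInt.const_mul _) fun y => ?_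
  exact mul_le_mul_of_nonneg_right (hf.le_zero y) (Real.exp_pos _).le

theorem IsGood.tendsto_tilt_smul (hf : IsGood f) (hi : Integrable f) {h : Euc d →L[ℝ] Euc d}
    (hh : h ≠ 0) :
    Filter.Tendsto (fun n : ℕ => tilt f ((n : ℝ) • h)) Filter.atTop (nhds 0) := by
  have hc := hf.smooth.continuous
  have := tendsto_integral_of_dominated_convergence (F := fun (n : ℕ) y =>
      f y * Real.exp (-(1 / 2) * ‖((n : ℝ) • h) y‖ ^ 2)) (f := fun _ => (0 : ℝ)) f
    (fun n => (hc.mul (by fun_prop)).aestronglyMeasurable) hi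
    (fun n => Filter.Eventually.of_forall (tilt_integrand_le hf _)) ?_
  · simpa [tilt] using this
  have hker : volume ((LinearMap.ker (h : Euc d →ₗ[ℝ] Euc d) : Submodule ℝ (Euc d)) :
      Set (Euc d)) = 0 := by
    refine Measure.addHaar_submodule volume _ fun htop => hh ?_
    ext1 y
    have : y ∈ LinearMap.ker (h : Euc d →ₗ[ℝ] Euc d) := by rw [htop]; trivial
    simpa using this
  have hae : ∀ᵐ y : Euc d, h y ≠ 0 := by
    refine measure_mono_null (fun y hy => ?_) hker
    simpa using hy
  filter_upwards [hae] with y hy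
  have hpos : 0 < ‖h y‖ := norm_pos_iff.2 hy
  rw [← mul_zero (f y)]
  refine Filter.Tendsto.const_mul _ (Real.tendsto_exp_atBot.comp ?_)
  have h1 : ∀ n : ℕ, -(1 / 2) * ‖((n : ℝ) • h) y‖ ^ 2 = -(‖h y‖ ^ 2 / 2 * (n : ℝ) ^ 2) := by
    intro n
    rw [smul_apply, norm_smul, mul_pow]
    simp
    ring
  simp only [h1]
  refine Filter.tendsto_neg_atTop_atBot.comp (Filter.Tendsto.const_mul_atTop (by positivity) ?_)
  exact (Filter.tendsto_pow_atTop two_ne_zero).comp tendsto_natCast_atTop_atTop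

theorem IsGood.tendsto_tilt_cocompact (hf : IsGood f) (hi : Integrable f) :
    Filter.Tendsto (tilt f) (Filter.cocompact (Euc d →L[ℝ] Euc d)) (nhds 0) := by
  rw [Metric.tendsto_nhds]
  intro ε hε
  have hcov : ∃ n : ℕ, Metric.sphere (0 : Euc d →L[ℝ] Euc d) 1 ⊆
      {h | tilt f ((n : ℝ) • h) < ε} := by
    refine (isCompact_sphere _ _).elim_directed_cover
      (fun n : ℕ => {h : Euc d →L[ℝ] Euc d | tilt f ((n : ℝ) • h) < ε}) (fun n => ?_) ?_ ?_
    · exact isOpen_lt ((hf.continuous_tilt hi).comp (continuous_const_smul _)) continuous_const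
    · intro h hh
      have hne : h ≠ 0 := by
        rintro rfl
        simp at hh
      obtain ⟨n, hn⟩ := ((hf.tendsto_tilt_smul hi hne).eventually (gt_mem_nhds hε)).exists
      exact Set.mem_iUnion.2 ⟨n, hn⟩
    · refine directed_of_isDirected_le fun m n hmn h hh => ?_
      refine lt_of_le_of_lt (hf.tilt_le_of_norm_le hi fun y => ?_) hh
      simp only [smul_apply, norm_smul, Real.norm_natCast]
      gcongr
  obtain ⟨n, hn⟩ := hcov
  filter_upwards [(tendsto_norm_cocompact_atTop (E := Euc d →L[ℝ] Euc d)).eventually_ge_atTop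
    ((n : ℝ) + 1)] with g hg
  have hgp : 0 < ‖g‖ := by linarith [n.cast_nonneg (α := ℝ)]
  rw [Real.dist_eq, sub_zero, abs_of_nonneg (hf.tilt_nonneg g)]
  refine lt_of_le_of_lt (hf.tilt_le_of_norm_le hi fun y => ?_) (hn (a := ‖g‖⁻¹ • g) ?_)
  · simp only [smul_apply, norm_smul, Real.norm_natCast, norm_inv, norm_norm]
    rw [← mul_assoc]
    refine mul_le_of_le_one_left (norm_nonneg _) ?_
    rw [← div_eq_mul_inv, div_le_one hgp]
    linarith
  · simp [norm_smul, hgp.ne']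

/-- The functional whose maximiser puts the tilted measure in isotropic position. -/
noncomputable def detTilt (f : Euc d → ℝ) (lam : ℝ) (h : Euc d →L[ℝ] Euc d) : ℝ :=
  |h.det| ^ lam * tilt f h

theorem IsGood.exists_maximiser (hf : IsGood f) (hi : Integrable f) (hl : 0 < lam)
    (hl1 : lam < 1) :
    ∃ g : Euc d ≃L[ℝ] Euc d, ∀ h : Euc d →L[ℝ] Euc d,
      detTilt f lam h ≤ detTilt f lam (g : Euc d →L[ℝ] Euc d) := by
  set C := f 0 * ∫ z : Euc d, Real.exp (-(1 / 2) * ‖z‖ ^ 2)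
  have hT : 0 < tilt f (1 : Euc d →L[ℝ] Euc d) :=
    hf.tilt_pos (ContinuousLinearEquiv.refl ℝ (Euc d))
  have h1 : 0 < detTilt f lam (1 : Euc d →L[ℝ] Euc d) := by
    have : (1 : Euc d →L[ℝ] Euc d).det = 1 := LinearMap.det_id
    rw [detTilt, this]
    simpa using hT
  have hcont : Continuous (detTilt f lam) :=
    ((ContinuousLinearMap.continuous_det.abs).rpow_const fun _ => Or.inr hl.le).mul
      (hf.continuous_tilt hi)
  have hle : ∀ h, detTilt f lam h ≤ C ^ lam * tilt f h ^ (1 - lam) := by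
    intro h
    have ht := hf.tilt_nonneg h
    rcases ht.eq_or_lt with h0 | h0
    · rw [detTilt, ← h0, mul_zero, Real.zero_rpow (by linarith), mul_zero]
    have : detTilt f lam h = (|h.det| * tilt f h) ^ lam * tilt f h ^ (1 - lam) := by
      rw [Real.mul_rpow (abs_nonneg _) ht, mul_assoc, ← Real.rpow_add h0, detTilt]
      simp
    rw [this]
    gcongr
    exact hf.det_mul_tilt_le h
  have hlim : Filter.Tendsto (fun h => C ^ lam * tilt f h ^ (1 - lam))
      (Filter.cocompact (Euc d →L[ℝ] Euc d)) (nhds 0) := by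
    have := ((hf.tendsto_tilt_cocompact hi).rpow_const (p := 1 - lam)
      (Or.inr (by linarith))).const_mul (C ^ lam)
    rwa [Real.zero_rpow (by linarith), mul_zero] at this
  obtain ⟨g, hg⟩ := hcont.exists_forall_ge' (x₀ := 1) <| by
    filter_upwards [hlim.eventually (gt_mem_nhds h1)] with h hh
    exact (hle h).trans hh.le
  have hdet : g.det ≠ 0 := by
    intro h0
    have := hg 1
    rw [detTilt, detTilt, h0, abs_zero, Real.zero_rpow hl.ne', zero_mul] at this
    rw [detTilt] at h1
    linarith
  obtain ⟨e, rfl⟩ := exists_equiv_of_det_ne_zero g hdet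
  exact ⟨e, hg⟩

/-- Logarithm of the maximum of `detTilt`. -/
noncomputable def logMax (f : Euc d → ℝ) (lam : ℝ) : ℝ := Real.log (⨆ h, detTilt f lam h)

theorem logMax_eq {g : Euc d ≃L[ℝ] Euc d} (hg : ∀ h : Euc d →L[ℝ] Euc d,
      detTilt f lam h ≤ detTilt f lam (g : Euc d →L[ℝ] Euc d)) :
    logMax f lam = Real.log (detTilt f lam (g : Euc d →L[ℝ] Euc d)) := by
  rw [logMax]
  congr 1
  exact le_antisymm (ciSup_le hg) (le_ciSup ⟨_, Set.forall_mem_range.2 hg⟩ _)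

theorem IsGood.log_detTilt (hf : IsGood f) (lam : ℝ) (g : Euc d ≃L[ℝ] Euc d) :
    Real.log (detTilt f lam (g : Euc d →L[ℝ] Euc d)) =
      lam * Real.log |(g : Euc d →L[ℝ] Euc d).det| +
        Real.log (tilt f (g : Euc d →L[ℝ] Euc d)) := by
  rw [detTilt, Real.log_mul (Real.rpow_pos_of_pos (abs_det_pos g) _).ne' (hf.tilt_pos g).ne',
    Real.log_rpow (abs_det_pos g)]

theorem IsGood.detTilt_pos (hf : IsGood f) (lam : ℝ) (g : Euc d ≃L[ℝ] Euc d) :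
    0 < detTilt f lam (g : Euc d →L[ℝ] Euc d) :=
  mul_pos (Real.rpow_pos_of_pos (abs_det_pos g) _) (hf.tilt_pos g)

theorem IsGood.log_le_logMax (hf : IsGood f) (hi : Integrable f) (hl : 0 < lam)
    (hl1 : lam < 1) (g : Euc d ≃L[ℝ] Euc d) :
    lam * Real.log |(g : Euc d →L[ℝ] Euc d).det| + Real.log (tilt f (g : Euc d →L[ℝ] Euc d)) ≤
      logMax f lam := by
  obtain ⟨e, he⟩ := hf.exists_maximiser hi hl hl1
  rw [logMax_eq he, ← hf.log_detTilt]
  exact Real.log_le_log (hf.detTilt_pos lam g) (he g)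

theorem IsGood.convexOn_logMax (hf : IsGood f) (hi : Integrable f) :
    ConvexOn ℝ (Set.Ioo 0 1) (logMax f) := by
  refine ⟨convex_Ioo 0 1, fun x hx y hy a b ha hb hab => ?_⟩
  have hm := (convex_Ioo (0 : ℝ) 1) hx hy ha hb hab
  obtain ⟨g, hg⟩ := hf.exists_maximiser hi hm.1 hm.2
  rw [logMax_eq hg, hf.log_detTilt]
  have h1 := mul_le_mul_of_nonneg_left (hf.log_le_logMax hi hx.1 hx.2 g) ha
  have h2 := mul_le_mul_of_nonneg_left (hf.log_le_logMax hi hy.1 hy.2 g) hb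
  have h3 : Real.log (tilt f (g : Euc d →L[ℝ] Euc d)) =
    (a + b) * Real.log (tilt f (g : Euc d →L[ℝ] Euc d)) := by rw [hab, one_mul]
  rw [h3]
  simp only [smul_eq_mul]
  linarith

theorem tilt_comp_symm (f : Euc d → ℝ) (g : Euc d ≃L[ℝ] Euc d) (h : Euc d →L[ℝ] Euc d) :
    tilt (fun y => f (g.symm y)) h =
      |(g : Euc d →L[ℝ] Euc d).det| * tilt f (h.comp (g : Euc d →L[ℝ] Euc d)) := by
  have := integral_comp_symm g (fun x => f x * Real.exp (-(1 / 2) * ‖h (g x)‖ ^ 2))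
  simpa only [tilt, ContinuousLinearEquiv.apply_symm_apply, ContinuousLinearMap.comp_apply,
    ContinuousLinearEquiv.coe_coe] using this

theorem det_comp (g h : Euc d →L[ℝ] Euc d) : (h.comp g).det = h.det * g.det :=
  LinearMap.det_comp _ _

/-- Second-difference bound for `logMax`. -/
theorem IsGood.logMax_second_difference (hf : IsGood f) (hi : Integrable f) (hl : 0 < lam)
    (hl1 : lam < 1) {k : ℝ} (hk0 : 0 < k) (hk : k < gapFactor lam * lam) :
    ∃ ε₀ > 0, ∀ ε, |ε| < ε₀ →
      logMax f (lam + ε) + logMax f (lam - ε) - 2 * logMax f lam ≤ d * ε ^ 2 / (2 * k) := by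
  obtain ⟨g, hg⟩ := hf.exists_maximiser hi hl hl1
  have hgd := abs_det_pos g
  have hF : IsGood fun y => f (g.symm y) := hf.comp (g.symm : Euc d →L[ℝ] Euc d)
  have hdF : ∀ (μ : ℝ) (h : Euc d →L[ℝ] Euc d), |h.det| ^ μ * tilt (fun y => f (g.symm y)) h =
      |(g : Euc d →L[ℝ] Euc d).det| ^ (1 - μ) * detTilt f μ (h.comp (g : Euc d →L[ℝ] Euc d)) := by
    intro μ h
    rw [tilt_comp_symm, detTilt, det_comp, abs_mul, Real.mul_rpow (abs_nonneg _) (abs_nonneg _),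
      Real.rpow_sub hgd, Real.rpow_one]
    have := (Real.rpow_pos_of_pos hgd μ).ne'
    field_simp
  have h11 : ∀ μ : ℝ, tilt (fun y => f (g.symm y)) 1 =
      |(g : Euc d →L[ℝ] Euc d).det| ^ (1 - μ) * detTilt f μ (g : Euc d →L[ℝ] Euc d) := by
    intro μ
    have := hdF μ 1
    rw [show (1 : Euc d →L[ℝ] Euc d).det = 1 from LinearMap.det_id, abs_one, Real.one_rpow,
      one_mul] at this
    exact this
  obtain ⟨ε₀, hε₀, hst⟩ := hF.stability hl hl1 (fun h => by
    rw [hdF, h11 lam]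
    exact mul_le_mul_of_nonneg_left (hg _) (by positivity)) hk0 hk
  have hstep : ∀ ε, |ε| < ε₀ → 0 < lam + ε → lam + ε < 1 →
      logMax f (lam + ε) ≤ (lam + ε) * Real.log |(g : Euc d →L[ℝ] Euc d).det| +
        Real.log (tilt f (g : Euc d →L[ℝ] Euc d)) + d * ε ^ 2 / (4 * k) := by
    intro ε hε h0 h1
    obtain ⟨e, he⟩ := hf.exists_maximiser hi h0 h1
    rw [logMax_eq he, ← hf.log_detTilt]
    have h2 := hst ε hε ((e : Euc d →L[ℝ] Euc d).comp (g.symm : Euc d →L[ℝ] Euc d))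
    rw [hdF, h11 (lam + ε), ContinuousLinearMap.comp_assoc,
      ContinuousLinearEquiv.coe_symm_comp_coe, ContinuousLinearMap.comp_id, mul_assoc] at h2
    have h3 := le_of_mul_le_mul_left h2 (by positivity)
    have h4 := Real.log_le_log (hf.detTilt_pos _ e) h3
    rwa [Real.log_mul (hf.detTilt_pos _ g).ne' (Real.exp_pos _).ne', Real.log_exp] at h4
  refine ⟨min ε₀ (min lam (1 - lam)), by
    have : 0 < 1 - lam := by linarith
    positivity, fun ε hε => ?_⟩
  have e1 : |ε| < ε₀ := hε.trans_le (min_le_left _ _)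
  have e2 := abs_lt.1 (hε.trans_le ((min_le_right _ _).trans (min_le_left _ _)))
  have e3 := abs_lt.1 (hε.trans_le ((min_le_right _ _).trans (min_le_right _ _)))
  have s1 := hstep ε e1 (by linarith) (by linarith)
  have s2 := hstep (-ε) (by rwa [abs_neg]) (by linarith) (by linarith)
  rw [logMax_eq hg, hf.log_detTilt]
  rw [← sub_eq_add_neg, neg_sq] at s2
  have : (d : ℝ) * ε ^ 2 / (2 * k) = d * ε ^ 2 / (4 * k) + d * ε ^ 2 / (4 * k) := by
    field_simp; ring
  linarith

end Existence

section Concavity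

/-- A continuous function whose second differences are asymptotically nonpositive is concave. -/
theorem concaveOn_of_second_difference {u : ℝ → ℝ} (hu : ContinuousOn u (Set.Ioo 0 1))
    (h : ∀ x ∈ Set.Ioo (0 : ℝ) 1, ∀ η > 0, ∃ ε₀ > 0, ∀ ε, |ε| < ε₀ →
      u (x + ε) + u (x - ε) - 2 * u x ≤ η * ε ^ 2) : ConcaveOn ℝ (Set.Ioo 0 1) u := by
  refine ⟨convex_Ioo 0 1, fun x hx y hy a b ha hb hab => ?_⟩
  have hmem : ∀ s ∈ Set.Icc (0 : ℝ) 1, x + s * (y - x) ∈ Set.Ioo (0 : ℝ) 1 := by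
    intro s hs
    have := (convex_Ioo (0 : ℝ) 1) hx hy (sub_nonneg.2 hs.2) hs.1 (by ring)
    simp only [smul_eq_mul] at this
    convert this using 1
    ring
  have key : ∀ δ > 0, 0 ≤ u (x + b * (y - x)) - (1 - b) * u x - b * u y + δ * (b * (1 - b)) := by
    intro δ hδ
    set G : ℝ → ℝ := fun s => u (x + s * (y - x)) - (1 - s) * u x - s * u y + δ * (s * (1 - s))
    have hG : ContinuousOn G (Set.Icc 0 1) := by
      have : ContinuousOn (fun s : ℝ => u (x + s * (y - x))) (Set.Icc 0 1) :=
        hu.comp (by fun_prop) hmem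
      exact ((this.sub (by fun_prop)).sub (by fun_prop)).add (by fun_prop)
    obtain ⟨p, hp, hmin⟩ := isCompact_Icc.exists_isMinOn (Set.nonempty_Icc.2 zero_le_one) hG
    have hb1 : b ∈ Set.Icc (0 : ℝ) 1 := ⟨hb, by linarith⟩
    refine le_trans ?_ (hmin hb1)
    rcases hp.1.eq_or_lt with h0 | h0
    · simp [G, ← h0]
    rcases hp.2.eq_or_lt with h1 | h1
    · simp [G, h1]
    exfalso
    obtain ⟨ε₀, hε₀, hε⟩ := h _ (hmem p hp) (δ / ((y - x) ^ 2 + 1)) (by positivity)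
    set ε := min (min p (1 - p)) (ε₀ / (2 * (|y - x| + 1)))
    have hεp : 0 < ε := by
      have : 0 < 1 - p := by linarith
      positivity
    have e1 : ε ≤ p := (min_le_left _ _).trans (min_le_left _ _)
    have e2 : ε ≤ 1 - p := (min_le_left _ _).trans (min_le_right _ _)
    have e3 : ε * (2 * (|y - x| + 1)) ≤ ε₀ := by
      rw [← le_div_iff₀ (by positivity)]
      exact min_le_right _ _
    have h2 := hε (ε * (y - x)) (by
      rw [abs_mul, abs_of_pos hεp]
      nlinarith [abs_nonneg (y - x)])
    have h3 : G p ≤ G (p + ε) := hmin ⟨by linarith, by linarith⟩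
    have h4 : G p ≤ G (p - ε) := hmin ⟨by linarith, by linarith⟩
    have h5 : δ / ((y - x) ^ 2 + 1) * (ε * (y - x)) ^ 2 ≤ δ * ε ^ 2 := by
      rw [div_mul_eq_mul_div, div_le_iff₀ (by positivity)]
      have : 0 ≤ δ * ε ^ 2 := by positivity
      nlinarith
    have h6 : 0 < δ * ε ^ 2 := by positivity
    simp only [G] at h3 h4
    rw [show x + (p + ε) * (y - x) = x + p * (y - x) + ε * (y - x) by ring] at h3
    rw [show x + (p - ε) * (y - x) = x + p * (y - x) - ε * (y - x) by ring] at h4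
    nlinarith
  have hlim : 0 ≤ u (x + b * (y - x)) - (1 - b) * u x - b * u y := by
    refine le_of_forall_pos_le_add fun δ hδ => ?_
    have := key δ hδ
    have hb1 : b * (1 - b) ≤ 1 := by nlinarith
    nlinarith
  have ha' : a = 1 - b := by linarith
  have hxy : a • x + b • y = x + b * (y - x) := by rw [ha']; simp; ring
  rw [hxy, ha']
  simp only [smul_eq_mul]
  linarith

theorem second_difference_ge {Q Q' Q'' : ℝ → ℝ} {x s : ℝ} (hx : x ∈ Set.Ioo (0 : ℝ) 1)
    (h : ∀ t ∈ Set.Ioo (0 : ℝ) 1, HasDerivAt Q (Q' t) t)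
    (h' : ∀ t ∈ Set.Ioo (0 : ℝ) 1, HasDerivAt Q' (Q'' t) t) (hc : ContinuousAt Q'' x)
    (hs : s < Q'' x) :
    ∃ ε₀ > 0, ∀ ε, |ε| < ε₀ → s * ε ^ 2 ≤ Q (x + ε) + Q (x - ε) - 2 * Q x := by
  have hev : ∀ᶠ t in nhds x, s < Q'' t ∧ t ∈ Set.Ioo (0 : ℝ) 1 :=
    (hc.eventually (lt_mem_nhds hs)).and (isOpen_Ioo.mem_nhds hx)
  obtain ⟨δ, hδ, hball⟩ := Metric.eventually_nhds_iff_ball.1 hev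
  refine ⟨δ, hδ, fun ε hε => ?_⟩
  have hd1 : ∀ t ∈ Metric.ball x δ, HasDerivAt (fun t => Q t - s / 2 * t ^ 2) (Q' t - s * t) t :=
    fun t ht => ((h t (hball t ht).2).fun_sub ((hasDerivAt_pow 2 t).const_mul (s / 2))).congr_deriv
      (by simp; ring)
  have hd2 : ∀ t ∈ Metric.ball x δ, HasDerivAt (fun t => Q' t - s * t) (Q'' t - s) t :=
    fun t ht => ((h' t (hball t ht).2).fun_sub ((hasDerivAt_id t).const_mul s)).congr_deriv (by simp)
  have hconv : ConvexOn ℝ (Metric.ball x δ) fun t => Q t - s / 2 * t ^ 2 := by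
    refine MonotoneOn.convexOn_of_deriv (convex_ball x δ)
      (fun t ht => (hd1 t ht).continuousAt.continuousWithinAt)
      (fun t ht => (hd1 t (interior_subset ht)).differentiableAt.differentiableWithinAt) ?_
    rw [Metric.isOpen_ball.interior_eq]
    have hmono : MonotoneOn (fun t => Q' t - s * t) (Metric.ball x δ) := by
      refine monotoneOn_of_deriv_nonneg (convex_ball x δ)
        (fun t ht => (hd2 t ht).continuousAt.continuousWithinAt)
        (fun t ht => (hd2 t (interior_subset ht)).differentiableAt.differentiableWithinAt) ?_
      intro t ht
      rw [(hd2 t (interior_subset ht)).deriv]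
      linarith [(hball t (interior_subset ht)).1]
    exact hmono.congr fun t ht => (hd1 t ht).deriv.symm
  have h1 : x + ε ∈ Metric.ball x δ := by simpa [Real.dist_eq] using hε
  have h2 : x - ε ∈ Metric.ball x δ := by simpa [Real.dist_eq] using hε
  have := hconv.2 h1 h2 (by norm_num : (0 : ℝ) ≤ 1 / 2) (by norm_num : (0 : ℝ) ≤ 1 / 2) (by norm_num)
  simp only [smul_eq_mul] at this
  rw [show 1 / 2 * (x + ε) + 1 / 2 * (x - ε) = x by ring] at this
  linarith

/-- A function with second derivative `1 / (2 * gapFactor x * x)`. -/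
noncomputable def compFun (x : ℝ) : ℝ :=
  1 / 2 * (x * Real.log x - x) +
    4 * ((1 - √x) * Real.log (1 - √x) - (1 - √x) -
      (1 - √x) ^ 2 / 2 * Real.log (1 - √x) + (1 - √x) ^ 2 / 4)

theorem one_sub_sqrt_pos {x : ℝ} (hx : x ∈ Set.Ioo (0 : ℝ) 1) : 0 < 1 - √x := by
  have : √x < 1 := by
    rw [Real.sqrt_lt' one_pos]
    simpa using hx.2
  linarith

theorem hasDerivAt_one_sub_sqrt {x : ℝ} (hx : x ∈ Set.Ioo (0 : ℝ) 1) :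
    HasDerivAt (fun x => 1 - √x) (-(1 / (2 * √x))) x :=
  (Real.hasDerivAt_sqrt hx.1.ne').const_sub 1

theorem hasDerivAt_compFun {x : ℝ} (hx : x ∈ Set.Ioo (0 : ℝ) 1) :
    HasDerivAt compFun (1 / 2 * Real.log x - 2 * Real.log (1 - √x)) x := by
  have hv := one_sub_sqrt_pos hx
  have hs : 0 < √x := Real.sqrt_pos.2 hx.1
  have h1 : HasDerivAt (fun x => 1 / 2 * (x * Real.log x - x)) (1 / 2 * Real.log x) x :=
    (((Real.hasDerivAt_mul_log hx.1.ne').fun_sub (hasDerivAt_id x)).const_mul (1 / 2)).congr_deriv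
      (by ring)
  have hV : HasDerivAt (fun v : ℝ => v * Real.log v - v - v ^ 2 / 2 * Real.log v + v ^ 2 / 4)
      (Real.log (1 - √x) * (1 - (1 - √x))) (1 - √x) := by
    refine ((((Real.hasDerivAt_mul_log hv.ne').fun_sub (hasDerivAt_id _)).fun_sub
      (((hasDerivAt_pow 2 (1 - √x)).div_const 2).fun_mul (Real.hasDerivAt_log hv.ne'))).fun_add
      ((hasDerivAt_pow 2 (1 - √x)).div_const 4)).congr_deriv ?_
    field_simp
    push_cast
    ring
  have h2 := ((hV.comp x (hasDerivAt_one_sub_sqrt hx)).const_mul 4)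
  refine (h1.fun_add h2).congr_deriv ?_
  field_simp
  ring

theorem hasDerivAt_deriv_compFun {x : ℝ} (hx : x ∈ Set.Ioo (0 : ℝ) 1) :
    HasDerivAt (fun x => 1 / 2 * Real.log x - 2 * Real.log (1 - √x))
      (1 / (2 * (gapFactor x * x))) x := by
  have hv := one_sub_sqrt_pos hx
  have hs : 0 < √x := Real.sqrt_pos.2 hx.1
  refine (((Real.hasDerivAt_log hx.1.ne').const_mul (1 / 2)).fun_sub
    (((hasDerivAt_one_sub_sqrt hx).log hv.ne').const_mul 2)).congr_deriv ?_
  have hx2 : √x ^ 2 = x := Real.sq_sqrt hx.1.le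
  unfold gapFactor
  have h0 := hx.1.ne'
  have h1 : (1 : ℝ) + √x ≠ 0 := by positivity
  generalize √x = s at *
  subst hx2
  have h2 := hv.ne'
  field_simp
  ring

theorem abs_compFun_le {x : ℝ} (hx : x ∈ Set.Ioo (0 : ℝ) 1) : |compFun x| ≤ 20 := by
  have hml : ∀ {t : ℝ}, t ∈ Set.Ioo (0 : ℝ) 1 → |t * Real.log t| ≤ 1 := by
    intro t ht
    have := Real.abs_log_mul_self_lt t ht.1 ht.2.le
    rw [mul_comm]
    exact this.le
  have hv := one_sub_sqrt_pos hx
  have hs : 0 < √x := Real.sqrt_pos.2 hx.1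
  have hvm : 1 - √x ∈ Set.Ioo (0 : ℝ) 1 := ⟨hv, by linarith⟩
  have h1 := abs_le.1 (hml hx)
  have h2 := abs_le.1 (hml hvm)
  have h3 : |(1 - √x) * ((1 - √x) * Real.log (1 - √x))| ≤ 1 := by
    rw [abs_mul, abs_of_pos hv]
    nlinarith [hml hvm, hvm.2, abs_nonneg ((1 - √x) * Real.log (1 - √x))]
  have h4 := abs_le.1 h3
  have h5 : (1 - √x) ^ 2 ≤ 1 := by nlinarith [hvm.1, hvm.2]
  have h6 : 0 ≤ (1 - √x) ^ 2 := sq_nonneg _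
  have := hx.1
  have := hx.2
  rw [abs_le, compFun]
  constructor <;> nlinarith

variable {d : ℕ} {f : Euc d → ℝ}

/-- `logMax` becomes concave after subtracting `d * compFun`. -/
theorem IsGood.concaveOn_logMax_sub (hf : IsGood f) (hi : Integrable f) :
    ConcaveOn ℝ (Set.Ioo 0 1) fun x => logMax f x - d * compFun x := by
  refine concaveOn_of_second_difference ?_ fun x hx η hη => ?_
  · exact ((hf.convexOn_logMax hi).continuousOn isOpen_Ioo).sub (continuousOn_const.mul
      fun x hx => (hasDerivAt_compFun hx).continuousAt.continuousWithinAt)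
  have hv := one_sub_sqrt_pos hx
  have hg : 0 < gapFactor x * x := mul_pos (div_pos hv (by positivity)) hx.1
  set q := 1 / (2 * (gapFactor x * x))
  have hq : 0 < q := by positivity
  set ν := η / (4 * (d + 1))
  have hν : 0 < ν := by positivity
  obtain ⟨ε₁, hε₁, h1⟩ := hf.logMax_second_difference hi hx.1 hx.2
    (k := 1 / (2 * (q + ν))) (by positivity) (by
      rw [div_lt_iff₀ (by positivity)]
      have : gapFactor x * x * (2 * q) = 1 := by
        simp only [q]
        field_simp
        exact div_self hg.ne'
      nlinarith)
  have hcont : ContinuousAt (fun x => 1 / (2 * (gapFactor x * x))) x := by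
    unfold gapFactor
    have h0 : (1 : ℝ) + √x ≠ 0 := by positivity
    refine ContinuousAt.div continuousAt_const ?_ (by positivity)
    exact continuousAt_const.mul ((ContinuousAt.div
      (continuousAt_const.sub Real.continuous_sqrt.continuousAt)
      (continuousAt_const.add Real.continuous_sqrt.continuousAt) h0).mul
      continuousAt_id)
  obtain ⟨ε₂, hε₂, h2⟩ := second_difference_ge (s := q - ν) hx (fun t ht => hasDerivAt_compFun ht)
    (fun t ht => hasDerivAt_deriv_compFun ht) hcont (by simp only [q]; linarith)
  refine ⟨min ε₁ ε₂, by positivity, fun ε hε => ?_⟩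
  have a1 := h1 ε (hε.trans_le (min_le_left _ _))
  have a2 := h2 ε (hε.trans_le (min_le_right _ _))
  have a3 : (d : ℝ) * ε ^ 2 / (2 * (1 / (2 * (q + ν)))) = d * (q + ν) * ε ^ 2 := by
    field_simp
  rw [a3] at a1
  have a4 := mul_le_mul_of_nonneg_left a2 (Nat.cast_nonneg (α := ℝ) d)
  have a5 : 2 * d * ν ≤ η := by
    simp only [ν]
    rw [mul_div_assoc', div_le_iff₀ (by positivity)]
    nlinarith [Nat.cast_nonneg (α := ℝ) d]
  have a6 := mul_le_mul_of_nonneg_right a5 (sq_nonneg ε)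
  linarith

end Concavity

/-- An even log-concave probability density with covariance matrix `v • 1`, `1 ≤ v ≤ 3`. -/
structure IsIsotropicDensity {d : ℕ} (v : ℝ) (f : Euc d → ℝ) : Prop where
  good : IsGood f
  integrable : Integrable f
  integral_eq_one : ∫ x, f x = 1
  integrable_norm_four : Integrable fun x => f x * ‖x‖ ^ 4
  integral_inner_sq : ∀ θ, ∫ x, f x * (inner ℝ θ x) ^ 2 = v * ‖θ‖ ^ 2
  one_le : 1 ≤ v
  le_three : v ≤ 3

theorem exp_neg_half_le {s : ℝ} (hs : 0 ≤ s) : Real.exp (-(1 / 2) * s) ≤ 1 - s / 2 + s ^ 2 / 8 := by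
  have h1 := Real.quadratic_le_exp_of_nonneg (x := s / 2) (by positivity)
  have h2 : Real.exp (-(1 / 2) * s) * Real.exp (s / 2) = 1 := by
    rw [← Real.exp_add, show -(1 / 2) * s + s / 2 = 0 by ring, Real.exp_zero]
  have h3 : (0 : ℝ) < 1 + s / 2 + (s / 2) ^ 2 / 2 := by positivity
  have h4 : (1 : ℝ) ≤ (1 - s / 2 + s ^ 2 / 8) * (1 + s / 2 + (s / 2) ^ 2 / 2) := by
    nlinarith [sq_nonneg (s ^ 2)]
  have h5 : 0 < Real.exp (-(1 / 2) * s) := Real.exp_pos _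
  have h6 : Real.exp (-(1 / 2) * s) * (1 + s / 2 + (s / 2) ^ 2 / 2) ≤ 1 :=
    (mul_le_mul_of_nonneg_left h1 h5.le).trans h2.le
  exact le_of_mul_le_mul_right (h6.trans h4) h3

namespace IsIsotropicDensity

variable {d : ℕ} {f : Euc d → ℝ} {v : ℝ}

theorem integrable_norm_sq (hf : IsIsotropicDensity v f) : Integrable fun x => f x * ‖x‖ ^ 2 := by
  have hc := hf.good.smooth.continuous
  refine (hf.integrable.fun_add hf.integrable_norm_four).mono' (by fun_prop)
    (Filter.Eventually.of_forall fun x => ?_)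
  have hp := hf.good.pos x
  rw [Real.norm_eq_abs, abs_of_nonneg (by positivity)]
  have : ‖x‖ ^ 2 ≤ 1 + ‖x‖ ^ 4 := by nlinarith [sq_nonneg (‖x‖ ^ 2 - 1)]
  nlinarith

theorem integrable_inner_sq (hf : IsIsotropicDensity v f) (θ : Euc d) :
    Integrable fun x => f x * (inner ℝ θ x) ^ 2 := by
  have hc := hf.good.smooth.continuous
  refine (hf.integrable_norm_sq.const_mul (‖θ‖ ^ 2)).mono' (by fun_prop)
    (Filter.Eventually.of_forall fun x => ?_)
  have hp := hf.good.pos x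
  rw [Real.norm_eq_abs, abs_of_nonneg (by positivity)]
  have h1 := pow_le_pow_left₀ (abs_nonneg _) (abs_real_inner_le_norm θ x) 2
  rw [sq_abs, mul_pow] at h1
  nlinarith

theorem integral_sum_inner_sq (hf : IsIsotropicDensity v f)
    (b : OrthonormalBasis (Fin d) ℝ (Euc d)) (c : Fin d → ℝ) :
    ∫ x, f x * ∑ i, c i * (inner ℝ (b i) x) ^ 2 = v * ∑ i, c i := by
  simp_rw [Finset.mul_sum]
  rw [integral_finsetSum _ fun i _ => by
    simpa [mul_left_comm] using (hf.integrable_inner_sq (b i)).const_mul (c i)]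
  refine Finset.sum_congr rfl fun i _ => ?_
  simp_rw [mul_left_comm _ (c i)]
  rw [integral_const_mul, hf.integral_inner_sq, b.norm_eq_one]
  ring

theorem integral_norm_sq (hf : IsIsotropicDensity v f) : ∫ x, f x * ‖x‖ ^ 2 = v * d := by
  have := hf.integral_sum_inner_sq (EuclideanSpace.basisFun (Fin d) ℝ) 1
  simp_rw [Pi.one_apply, one_mul, ← norm_sq_eq_sum_inner] at this
  simpa using this

theorem tilt_le_exp (hf : IsIsotropicDensity v f) {h : Euc d →L[ℝ] Euc d}
    (b : OrthonormalBasis (Fin d) ℝ (Euc d)) {c : Fin d → ℝ} (hc : ∀ i, 0 ≤ c i)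
    (hh : ∀ x, ‖h x‖ ^ 2 = ∑ i, c i * (inner ℝ (b i) x) ^ 2)
    (hT : (∑ i, c i) * ((∫ x, f x * ‖x‖ ^ 4) + 1) ≤ 2) :
    tilt f h ≤ Real.exp (-((∑ i, c i) / 4)) := by
  set T := ∑ i, c i
  have hT0 : 0 ≤ T := Finset.sum_nonneg fun i _ => hc i
  have hcont := hf.good.smooth.continuous
  have hle : ∀ x, ‖h x‖ ^ 2 ≤ T * ‖x‖ ^ 2 := by
    intro x
    rw [hh, Finset.sum_mul]
    refine Finset.sum_le_sum fun i _ => mul_le_mul_of_nonneg_left ?_ (hc i)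
    have h1 := pow_le_pow_left₀ (abs_nonneg _) (abs_real_inner_le_norm (b i) x) 2
    rwa [sq_abs, b.norm_eq_one, one_mul] at h1
  have h2 : Integrable fun x => f x * ‖h x‖ ^ 2 := by
    refine (hf.integrable_norm_sq.const_mul T).mono' (by fun_prop)
      (Filter.Eventually.of_forall fun x => ?_)
    have hp := hf.good.pos x
    rw [Real.norm_eq_abs, abs_of_nonneg (by positivity)]
    nlinarith [hle x]
  have h3 : tilt f h ≤ ∫ x, ((f x - f x * ‖h x‖ ^ 2 / 2) + T ^ 2 / 8 * (f x * ‖x‖ ^ 4)) := by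
    refine integral_mono (hf.good.integrable_tilt_of_integrable hf.integrable h)
      ((hf.integrable.sub' (h2.div_const 2)).fun_add (hf.integrable_norm_four.const_mul _))
      fun x => ?_
    have hp := hf.good.pos x
    have h4 := exp_neg_half_le (sq_nonneg ‖h x‖)
    have h5 : (‖h x‖ ^ 2) ^ 2 ≤ (T * ‖x‖ ^ 2) ^ 2 := pow_le_pow_left₀ (by positivity) (hle x) 2
    have h6 : Real.exp (-(1 / 2) * ‖h x‖ ^ 2) ≤ 1 - ‖h x‖ ^ 2 / 2 + T ^ 2 / 8 * ‖x‖ ^ 4 := by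
      nlinarith
    have := mul_le_mul_of_nonneg_left h6 hp.le
    simp only
    linarith
  rw [integral_add (hf.integrable.sub' (h2.div_const 2)) (hf.integrable_norm_four.const_mul _),
    integral_sub hf.integrable (h2.div_const 2), integral_div, integral_const_mul,
    hf.integral_eq_one] at h3
  simp_rw [hh] at h3
  rw [hf.integral_sum_inner_sq b c] at h3
  have h7 : v * T ≥ T := by nlinarith [hf.one_le]
  have h8 : T ^ 2 / 8 * (∫ x, f x * ‖x‖ ^ 4) ≤ T / 4 := by
    have : T * (T * ((∫ x, f x * ‖x‖ ^ 4) + 1)) ≤ T * 2 := mul_le_mul_of_nonneg_left hT hT0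
    nlinarith [sq_nonneg T]
  have h9 := Real.add_one_le_exp (-(T / 4))
  change tilt f h ≤ 1 - v * T / 2 + _ at h3
  linarith

theorem mul_sub_exp_le {lam α : ℝ} (hl : 0 < lam) :
    lam * α - Real.exp (2 * α) / 4 ≤ lam / 2 * Real.log lam := by
  have h1 := Real.log_le_sub_one_of_pos (x := Real.exp (2 * α) / (2 * lam)) (by positivity)
  rw [Real.log_div (Real.exp_ne_zero _) (by positivity), Real.log_exp,
    Real.log_mul two_ne_zero hl.ne'] at h1
  have h2 := mul_le_mul_of_nonneg_left h1 (show 0 ≤ lam / 2 by positivity)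
  have h3 : lam / 2 * (Real.exp (2 * α) / (2 * lam) - 1) = Real.exp (2 * α) / 4 - lam / 2 := by
    field_simp
    ring
  rw [h3] at h2
  have h4 : Real.log 2 ≤ 1 := by linarith [Real.log_two_lt_d9]
  nlinarith

theorem exists_logMax_le (hf : IsIsotropicDensity v f) :
    ∃ l₀ > 0, ∀ lam, 0 < lam → lam < l₀ → lam < 1 → logMax f lam ≤ d / 2 * (lam * Real.log lam) := by
  set M := (∫ x, f x * ‖x‖ ^ 4) + 1
  have hM : 0 < M := by
    have : 0 ≤ ∫ x, f x * ‖x‖ ^ 4 :=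
      integral_nonneg fun x => mul_nonneg (hf.good.pos x).le (by positivity)
    positivity
  set T₀ := 2 / M
  have hT₀ : 0 < T₀ := by positivity
  set C := f 0 * ∫ z : Euc d, Real.exp (-(1 / 2) * ‖z‖ ^ 2)
  have hcont : Continuous fun lam : ℝ =>
      lam * Real.log C - (1 - lam) * (T₀ / 4) - d / 2 * (lam * Real.log lam) := by
    have := Real.continuous_mul_log
    fun_prop
  have hev := hcont.continuousAt.eventually_lt (x₀ := (0 : ℝ)) (continuousAt_const (y := (0 : ℝ)))
    (by simpa using hT₀)
  obtain ⟨l₀, hl₀, hball⟩ := Metric.eventually_nhds_iff_ball.1 hev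
  refine ⟨l₀, hl₀, fun lam hl hll hl1 => ?_⟩
  have hsmall := hball lam (by simpa [abs_of_pos hl] using hll)
  obtain ⟨g, hg⟩ := hf.good.exists_maximiser hf.integrable hl hl1
  rw [logMax_eq hg, hf.good.log_detTilt]
  obtain ⟨b, α, hb, hdet⟩ := exists_dil_of_det_ne_zero (g : Euc d →L[ℝ] Euc d)
    (abs_pos.1 (abs_det_pos g))
  have htp := hf.good.tilt_pos g
  set T := ∑ i, Real.exp (2 * α i)
  by_cases hT : T ≤ T₀
  · have h1 := hf.tilt_le_exp b (fun i => (Real.exp_pos (2 * α i)).le) hb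
      ((le_div_iff₀ hM).1 hT)
    have h2 := Real.log_le_log htp h1
    rw [Real.log_exp] at h2
    rw [hdet, Real.log_exp]
    have h3 : ∑ i, (lam * α i - Real.exp (2 * α i) / 4) ≤ ∑ _i : Fin d, lam / 2 * Real.log lam :=
      Finset.sum_le_sum fun i _ => mul_sub_exp_le hl
    rw [Finset.sum_sub_distrib, ← Finset.mul_sum, ← Finset.sum_div, Finset.sum_const,
      Finset.card_univ, Fintype.card_fin, nsmul_eq_mul] at h3
    linarith
  · push Not at hT
    have hTp : 0 < T := hT₀.trans hT
    set r := √(T₀ / T)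
    have hr : r ^ 2 = T₀ / T := Real.sq_sqrt (by positivity)
    have hr1 : r ≤ 1 := Real.sqrt_le_one.2 ((div_le_one hTp).2 hT.le)
    have hr0 : 0 ≤ r := Real.sqrt_nonneg _
    have hsum : ∑ i, r ^ 2 * Real.exp (2 * α i) = T₀ := by
      rw [← Finset.mul_sum, hr]
      exact div_mul_cancel₀ _ hTp.ne'
    have h1 : tilt f (g : Euc d →L[ℝ] Euc d) ≤ tilt f (r • (g : Euc d →L[ℝ] Euc d)) := by
      refine hf.good.tilt_le_of_norm_le hf.integrable fun y => ?_
      rw [smul_apply, norm_smul, Real.norm_of_nonneg hr0]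
      exact mul_le_of_le_one_left (norm_nonneg _) hr1
    have h2 := hf.tilt_le_exp (h := r • (g : Euc d →L[ℝ] Euc d)) b
      (c := fun i => r ^ 2 * Real.exp (2 * α i)) (fun i => by positivity)
      (fun x => by
        rw [smul_apply, norm_smul, Real.norm_of_nonneg hr0, mul_pow, hb,
          Finset.mul_sum]
        exact Finset.sum_congr rfl fun i _ => by ring)
      (by
        rw [hsum]
        exact (div_mul_cancel₀ _ hM.ne').le)
    rw [hsum] at h2
    have h3 := Real.log_le_log htp (h1.trans h2)
    rw [Real.log_exp] at h3
    have h4 := Real.log_le_log (mul_pos (abs_det_pos g) htp) (hf.good.det_mul_tilt_le _)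
    rw [Real.log_mul (abs_det_pos g).ne' htp.ne'] at h4
    have h5 := mul_le_mul_of_nonneg_left h4 hl.le
    have h6 := mul_le_mul_of_nonneg_left h3 (sub_nonneg.2 hl1.le)
    simp only [C] at hsmall
    linarith

theorem log_one_sub_ge {s : ℝ} (hs : 0 ≤ s) (hs' : s ≤ 1 / 2) : -(2 * s) ≤ Real.log (1 - s) := by
  have h1 := Real.one_sub_inv_le_log_of_pos (x := 1 - s) (by linarith)
  have h2 : (1 - s)⁻¹ ≤ 1 + 2 * s := by
    rw [inv_le_iff_one_le_mul₀ (by linarith)]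
    nlinarith
  linarith

theorem logMax_half_ge (hf : IsIsotropicDensity v f) {lam : ℝ} (hl : 0 < lam) (hl1 : lam < 1)
    (hlv : lam * (v * d) ≤ 1) :
    d / 4 * (lam * Real.log lam) - lam * (v * d) ≤ logMax f (lam / 2) := by
  have hv := hf.one_le
  set b := EuclideanSpace.basisFun (Fin d) ℝ
  set g := dil b fun _ => Real.log lam / 2
  have h1 := hf.good.log_le_logMax hf.integrable (lam := lam / 2) (by linarith) (by linarith) g
  rw [det_dil, Real.abs_exp, Real.log_exp, Finset.sum_const, Finset.card_univ, Fintype.card_fin,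
    nsmul_eq_mul] at h1
  have hg : ∀ x, ‖g x‖ ^ 2 = lam * ‖x‖ ^ 2 := by
    intro x
    rw [norm_dil_sq, norm_sq_eq_sum_inner b, Finset.mul_sum]
    refine Finset.sum_congr rfl fun i _ => ?_
    rw [mul_div_cancel₀ _ two_ne_zero, Real.exp_log hl]
  have h2 : 1 - lam * (v * d) / 2 ≤ tilt f (g : Euc d →L[ℝ] Euc d) := by
    have h3 : ∫ x, (f x - lam / 2 * (f x * ‖x‖ ^ 2)) ≤ tilt f (g : Euc d →L[ℝ] Euc d) := by
      refine integral_mono (hf.integrable.sub' (hf.integrable_norm_sq.const_mul _))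
        (hf.good.integrable_tilt_of_integrable hf.integrable _) fun x => ?_
      have hp := hf.good.pos x
      have h4 := Real.add_one_le_exp (-(1 / 2) * ‖g x‖ ^ 2)
      have := mul_le_mul_of_nonneg_left h4 hp.le
      rw [hg] at this
      simp only [ContinuousLinearEquiv.coe_coe, hg]
      linarith
    rw [integral_sub hf.integrable (hf.integrable_norm_sq.const_mul _), integral_const_mul,
      hf.integral_eq_one, hf.integral_norm_sq] at h3
    linarith
  have h5 := log_one_sub_ge (s := lam * (v * d) / 2) (by positivity) (by linarith)
  have h6 := Real.log_le_log (by linarith) h2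
  linarith

theorem logMax_le (hf : IsIsotropicDensity v f) {μ : ℝ} (hμ : μ ∈ Set.Ioo (0 : ℝ) 1) :
    logMax f μ ≤ 47 * d := by
  have hv := hf.one_le
  obtain ⟨l₀, hl₀, hup⟩ := hf.exists_logMax_le
  set lam := min (min (l₀ / 2) (μ / 2)) (1 / (v * d + 1))
  have hl : 0 < lam := by
    have := hμ.1
    positivity
  have e1 : lam ≤ l₀ / 2 := (min_le_left _ _).trans (min_le_left _ _)
  have e2 : lam ≤ μ / 2 := (min_le_left _ _).trans (min_le_right _ _)
  have e3 : lam * (v * d + 1) ≤ 1 := by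
    rw [← le_div_iff₀ (by positivity)]
    exact min_le_right _ _
  have hμ0 := hμ.1
  have hμ1 := hμ.2
  have hmem : lam ∈ Set.Ioo (0 : ℝ) 1 := ⟨hl, by linarith⟩
  have hmem' : lam / 2 ∈ Set.Ioo (0 : ℝ) 1 := ⟨by linarith, by linarith⟩
  have h1 := hup lam hl (by linarith) hmem.2
  have h2 := hf.logMax_half_ge hl hmem.2 (by nlinarith)
  have hΨ : lam / 4 * (Real.log lam - Real.log 2) ≤ compFun lam - compFun (lam / 2) := by
    obtain ⟨c, hc, hceq⟩ := exists_hasDerivAt_eq_slope compFun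
      (fun x => 1 / 2 * Real.log x - 2 * Real.log (1 - √x)) (half_lt_self hl)
      (fun x hx => (hasDerivAt_compFun ⟨by linarith [hx.1], by linarith [hx.2]⟩).continuousAt.continuousWithinAt)
      (fun x hx => hasDerivAt_compFun ⟨by linarith [hx.1], by linarith [hx.2]⟩)
    have hc0 : c ∈ Set.Ioo (0 : ℝ) 1 := ⟨by linarith [hc.1], by linarith [hc.2]⟩
    rw [eq_div_iff (by linarith)] at hceq
    rw [← hceq]
    have h3 : Real.log (1 - √c) ≤ 0 := Real.log_nonpos (one_sub_sqrt_pos hc0).le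
      (by linarith [Real.sqrt_nonneg c])
    have h4 := Real.log_le_log hmem'.1 hc.1.le
    rw [Real.log_div hl.ne' two_ne_zero] at h4
    nlinarith
  have hconc := hf.good.concaveOn_logMax_sub hf.integrable
  have hslope := hconc.slope_anti_adjacent hmem' hμ (half_lt_self hl) (show lam < μ by linarith)
  have hd : (0 : ℝ) ≤ d := Nat.cast_nonneg d
  have h5 : (logMax f lam - d * compFun lam - (logMax f (lam / 2) - d * compFun (lam / 2))) /
      (lam - lam / 2) ≤ 7 * d := by
    rw [div_le_iff₀ (by linarith)]
    have h6 := mul_le_mul_of_nonneg_left hΨ hd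
    have h7 : Real.log 2 ≤ 1 := by linarith [Real.log_two_lt_d9]
    have h8 : d * lam * Real.log 2 ≤ d * lam * 1 := mul_le_mul_of_nonneg_left h7 (by positivity)
    have h9 : lam * d * v ≤ lam * d * 3 := mul_le_mul_of_nonneg_left hf.le_three (by positivity)
    nlinarith
  have h6 := hslope.trans h5
  rw [div_le_iff₀ (by linarith)] at h6
  have h7 : 7 * (d : ℝ) * (μ - lam) ≤ 7 * d * 1 :=
    mul_le_mul_of_nonneg_left (by linarith) (by positivity)
  have h8 : d / 2 * (lam * Real.log lam) ≤ 0 :=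
    mul_nonpos_of_nonneg_of_nonpos (by positivity)
      (mul_nonpos_of_nonneg_of_nonpos hl.le (Real.log_nonpos hl.le hmem.2.le))
  have h9 := mul_le_mul_of_nonneg_left (abs_le.1 (abs_compFun_le hmem)).1 hd
  have h10 := mul_le_mul_of_nonneg_left (abs_le.1 (abs_compFun_le hμ)).2 hd
  linarith

theorem one_le_integral_gaussian : 1 ≤ ∫ z : Euc d, Real.exp (-(1 / 2) * ‖z‖ ^ 2) := by
  rw [GaussianFourier.integral_rexp_neg_mul_sq_norm (by norm_num)]
  refine Real.one_le_rpow ?_ (by positivity)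
  linarith [Real.pi_gt_three]

/-- The density of an isotropic even log-concave measure is at most exponential at the origin. -/
theorem apply_zero_le (hf : IsIsotropicDensity v f) : f 0 ≤ Real.exp (47 * d) := by
  have hc := hf.good.smooth.continuous
  set b := EuclideanSpace.basisFun (Fin d) ℝ
  have h1 : ∀ a : ℝ, tilt (fun y => f ((dil b fun _ => a).symm y)) 1 ≤ Real.exp (47 * d) := by
    intro a
    rw [tilt_comp_symm]
    set g := dil b fun _ => a
    have hlim : Filter.Tendsto (fun μ : ℝ => μ * Real.log |(g : Euc d →L[ℝ] Euc d).det| +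
        Real.log (tilt f (g : Euc d →L[ℝ] Euc d))) (nhdsWithin 1 (Set.Iio 1))
        (nhds (1 * Real.log |(g : Euc d →L[ℝ] Euc d).det| +
          Real.log (tilt f (g : Euc d →L[ℝ] Euc d)))) := by
      refine Filter.Tendsto.mono_left ?_ nhdsWithin_le_nhds
      exact Continuous.tendsto (by fun_prop) 1
    have h2 := le_of_tendsto hlim (b := 47 * (d : ℝ)) (by
      filter_upwards [Ioo_mem_nhdsLT (zero_lt_one' ℝ)] with μ hμ
      exact (hf.good.log_le_logMax hf.integrable hμ.1 hμ.2 g).trans (hf.logMax_le hμ))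
    rw [one_mul, ← Real.log_mul (abs_det_pos g).ne' (hf.good.tilt_pos g).ne',
      Real.log_le_iff_le_exp (mul_pos (abs_det_pos g) (hf.good.tilt_pos g))] at h2
    exact h2
  have hnorm : ∀ (a : ℝ) (z : Euc d), ‖(dil b fun _ => a).symm z‖ ^ 2 =
      Real.exp (-(2 * a)) * ‖z‖ ^ 2 := by
    intro a z
    have h2 := norm_dil_sq b (fun _ => a) ((dil b fun _ => a).symm z)
    rw [ContinuousLinearEquiv.apply_symm_apply, ← Finset.mul_sum, ← norm_sq_eq_sum_inner] at h2
    rw [h2, ← mul_assoc, ← Real.exp_add]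
    simp
  have hg : Integrable fun z : Euc d => Real.exp (-(1 / 2) * ‖z‖ ^ 2) := by
    simpa using integrable_norm_pow_mul_gaussian (d := d) 0 (b := 1 / 2) (by norm_num)
  have hlim : Filter.Tendsto (fun a : ℝ => tilt (fun y => f ((dil b fun _ => a).symm y)) 1)
      Filter.atTop (nhds (∫ z : Euc d, f 0 * Real.exp (-(1 / 2) * ‖z‖ ^ 2))) := by
    refine tendsto_integral_filter_of_dominated_convergence
      (fun z : Euc d => f 0 * Real.exp (-(1 / 2) * ‖z‖ ^ 2))
      (Filter.Eventually.of_forall fun a => Continuous.aestronglyMeasurable ?_)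
      (Filter.Eventually.of_forall fun a => Filter.Eventually.of_forall fun z => ?_)
      (hg.const_mul _) (Filter.Eventually.of_forall fun z => ?_)
    · exact (hc.comp (dil b fun _ => a).symm.continuous).mul (by fun_prop)
    · have := hf.good.pos ((dil b fun _ => a).symm z)
      rw [Real.norm_eq_abs, abs_of_pos (by positivity)]
      exact mul_le_mul_of_nonneg_right (hf.good.le_zero _) (Real.exp_pos _).le
    · refine Filter.Tendsto.mul_const _ ((hc.tendsto 0).comp ?_)
      rw [tendsto_zero_iff_norm_tendsto_zero]
      have h3 : Filter.Tendsto (fun a : ℝ => Real.exp (-(2 * a)) * ‖z‖ ^ 2) Filter.atTop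
          (nhds (0 * ‖z‖ ^ 2)) :=
        (Real.tendsto_exp_neg_atTop_nhds_zero.comp
          (Filter.tendsto_id.const_mul_atTop two_pos)).mul_const _
      rw [zero_mul] at h3
      have h4 := h3.sqrt
      simp_rw [← hnorm, Real.sqrt_zero] at h4
      simpa [Real.sqrt_sq] using h4
  have h5 := le_of_tendsto' hlim h1
  rw [integral_const_mul] at h5
  refine le_trans ?_ h5
  exact le_mul_of_one_le_right (hf.good.pos 0).le one_le_integral_gaussian

end IsIsotropicDensity

section AutoGauss

variable {d : ℕ} {K : Set (Euc d)} {ρ : Euc d → ℝ} {b : ℝ}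

theorem contDiff_setIntegral_sub (hρ : ContDiff ℝ ∞ ρ) (hK : IsCompact K) :
    ContDiff ℝ ∞ fun x => ∫ u in K, ρ (x - u) := by
  obtain ⟨R, hR0, hR⟩ := hK.isBounded.exists_pos_norm_le
  refine contDiff_iff_contDiffAt.2 fun x₀ => ?_
  let χ : ContDiffBump (0 : Euc d) := ⟨‖x₀‖ + 1 + R, ‖x₀‖ + 2 + R, by positivity, by linarith⟩
  have hχ : IsTest (χ : Euc d → ℝ) := ⟨χ.contDiff, χ.hasCompactSupport⟩
  have h1 := contDiff_mollify (IsTest.mul_left hρ hχ) (f := K.indicator 1)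
    ((integrable_indicator_iff hK.measurableSet).2
      (integrableOn_const hK.measure_lt_top.ne)).locallyIntegrable
  refine h1.contDiffAt.congr_of_eventuallyEq ?_
  filter_upwards [Metric.ball_mem_nhds x₀ one_pos] with y hy
  rw [mollify, ← integral_indicator hK.measurableSet]
  congr 1
  ext t
  by_cases ht : t ∈ K
  · have h2 : χ (y - t) = 1 := by
      refine χ.one_of_mem_closedBall ?_
      rw [mem_closedBall_zero_iff]
      have h3 : ‖y - x₀‖ < 1 := by simpa [dist_eq_norm] using hy
      have h4 : ‖y - t‖ ≤ ‖y - x₀‖ + ‖x₀‖ + ‖t‖ := by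
        calc ‖y - t‖ = ‖(y - x₀) + x₀ - t‖ := by congr 1; abel
          _ ≤ ‖(y - x₀) + x₀‖ + ‖t‖ := norm_sub_le _ _
          _ ≤ _ := by gcongr; exact norm_add_le _ _
      have h5 := hR t ht
      show ‖y - t‖ ≤ ‖x₀‖ + 1 + R
      linarith
    simp [ht, h2]
  · simp [ht]

/-- The Gaussian smoothing of the autocorrelation of the indicator of `K`. -/
noncomputable def autoGauss (K : Set (Euc d)) (b : ℝ) (x : Euc d) : ℝ :=
  ∫ p in K ×ˢ K, Real.exp (-b * ‖x + p.1 - p.2‖ ^ 2)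

theorem continuous_autoGauss_integrand (b : ℝ) (x : Euc d) :
    Continuous fun p : Euc d × Euc d => Real.exp (-b * ‖x + p.1 - p.2‖ ^ 2) := by
  fun_prop

theorem integrableOn_autoGauss (hK : IsCompact K) (b : ℝ) (x : Euc d) :
    IntegrableOn (fun p : Euc d × Euc d => Real.exp (-b * ‖x + p.1 - p.2‖ ^ 2)) (K ×ˢ K) :=
  (continuous_autoGauss_integrand b x).continuousOn.integrableOn_compact (hK.prod hK)

theorem contDiff_autoGauss (hK : IsCompact K) : ContDiff ℝ ∞ (autoGauss K b) := by
  have h1 : ContDiff ℝ ∞ fun z : Euc d => Real.exp (-b * ‖z‖ ^ 2) :=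
    (contDiff_const.mul (contDiff_norm_sq ℝ)).exp
  have h2 := contDiff_setIntegral_sub (contDiff_setIntegral_sub h1 hK) hK.neg
  convert h2 using 2 with x
  rw [autoGauss, Measure.volume_eq_prod, setIntegral_prod]
  · have := integral_neg_eq_self
      (fun t => K.indicator (fun t => ∫ u in K, Real.exp (-b * ‖x + t - u‖ ^ 2)) t) volume
    rw [← integral_indicator hK.measurableSet, ← this,
      ← integral_indicator hK.neg.measurableSet]
    congr 1
  · exact integrableOn_autoGauss hK b x

theorem ofReal_autoGauss (hK : IsCompact K) (x : Euc d) :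
    ENNReal.ofReal (autoGauss K b x) = ∫⁻ p, (K ×ˢ K).indicator
      (fun p : Euc d × Euc d => ENNReal.ofReal (Real.exp (-b * ‖x + p.1 - p.2‖ ^ 2))) p := by
  rw [autoGauss, ofReal_integral_eq_lintegral_ofReal (integrableOn_autoGauss hK b x)
    (Filter.Eventually.of_forall fun p => (Real.exp_pos _).le),
    lintegral_indicator (hK.prod hK).measurableSet]

theorem autoGauss_nonneg (x : Euc d) : 0 ≤ autoGauss K b x :=
  integral_nonneg fun _ => (Real.exp_pos _).le

theorem autoGauss_mul_le (hK : IsCompact K) (hc : Convex ℝ K) (hb : 0 ≤ b) (x y : Euc d) :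
    autoGauss K b x * autoGauss K b y ≤ autoGauss K b ((1 / 2 : ℝ) • (x + y)) ^ 2 := by
  have hm : ∀ x : Euc d, Measurable ((K ×ˢ K).indicator
      (fun p : Euc d × Euc d => ENNReal.ofReal (Real.exp (-b * ‖x + p.1 - p.2‖ ^ 2)))) := fun x =>
    ((continuous_autoGauss_integrand b x).measurable.ennreal_ofReal).indicator
      (hK.prod hK).measurableSet
  have h := ((prekopaLeindler_euclideanSpace d).prod (prekopaLeindler_euclideanSpace d))
    _ _ _ (hm x) (hm y) (hm ((1 / 2 : ℝ) • (x + y))) fun p q => ?_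
  · rw [← ofReal_autoGauss hK, ← ofReal_autoGauss hK, ← ofReal_autoGauss hK,
      ← ENNReal.ofReal_mul (autoGauss_nonneg x), ← ENNReal.ofReal_pow (autoGauss_nonneg _),
      ENNReal.ofReal_le_ofReal_iff (by positivity)] at h
    exact h
  · by_cases hp : p ∈ K ×ˢ K
    swap
    · simp [hp]
    by_cases hq : q ∈ K ×ˢ K
    swap
    · simp [hq]
    have hmid : (1 / 2 : ℝ) • (p + q) ∈ K ×ˢ K := by
      rw [smul_add]
      exact (hc.prod hc) hp hq (by norm_num) (by norm_num) (by norm_num)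
    rw [Set.indicator_of_mem hp, Set.indicator_of_mem hq, Set.indicator_of_mem hmid,
      ← ENNReal.ofReal_mul (Real.exp_pos _).le, ← ENNReal.ofReal_pow (Real.exp_pos _).le]
    refine ENNReal.ofReal_le_ofReal ?_
    rw [← Real.exp_add, ← Real.exp_nat_mul, Real.exp_le_exp]
    set z := x + p.1 - p.2
    set w := y + q.1 - q.2
    have h1 : (1 / 2 : ℝ) • (x + y) + ((1 / 2 : ℝ) • (p + q)).1 - ((1 / 2 : ℝ) • (p + q)).2 =
        (1 / 2 : ℝ) • (z + w) := by
      simp only [z, w, Prod.smul_fst, Prod.smul_snd, Prod.fst_add, Prod.snd_add]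
      module
    rw [h1, norm_smul, mul_pow]
    have h2 := parallelogram_law_with_norm ℝ z w
    have h3 : ‖(1 / 2 : ℝ)‖ ^ 2 = 1 / 4 := by norm_num
    rw [h3]
    push_cast
    nlinarith [mul_nonneg hb (sq_nonneg ‖z - w‖)]

theorem autoGauss_neg (x : Euc d) : autoGauss K b (-x) = autoGauss K b x := by
  have h := setIntegral_prod_swap (μ := (volume : Measure (Euc d)))
    (ν := (volume : Measure (Euc d))) K K fun p => Real.exp (-b * ‖x + p.1 - p.2‖ ^ 2)
  rw [autoGauss, autoGauss, Measure.volume_eq_prod, ← h]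
  congr 1
  ext p
  rw [← norm_neg]
  congr 4
  simp only [Prod.fst_swap, Prod.snd_swap]
  abel

theorem autoGauss_pos (hK : IsCompact K) (hv : volume K ≠ 0) (x : Euc d) :
    0 < autoGauss K b x := by
  rw [autoGauss, setIntegral_pos_iff_support_of_nonneg_ae
    (Filter.Eventually.of_forall fun p => (Real.exp_pos _).le) (integrableOn_autoGauss hK b x)]
  have : (Function.support fun p : Euc d × Euc d => Real.exp (-b * ‖x + p.1 - p.2‖ ^ 2)) =
      Set.univ := Set.eq_univ_of_forall fun p => (Real.exp_pos _).ne'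
  rw [this, Set.univ_inter, Measure.volume_eq_prod, Measure.prod_prod]
  exact pos_iff_ne_zero.2 (mul_ne_zero hv hv)

theorem isGood_autoGauss (hK : IsCompact K) (hc : Convex ℝ K) (hv : volume K ≠ 0) (hb : 0 ≤ b)
    {A : ℝ} (hA : 0 < A) : IsGood fun x => A * autoGauss K b x where
  smooth := contDiff_const.mul (contDiff_autoGauss hK)
  pos x := mul_pos hA (autoGauss_pos hK hv x)
  even x := by rw [autoGauss_neg]
  logConcave x y := by
    have := mul_le_mul_of_nonneg_left (autoGauss_mul_le hK hc hb x y) (sq_nonneg A)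
    linarith

end AutoGauss

section GaussMoments

variable {d : ℕ} {b : ℝ}

/-- The total mass of the Gaussian `exp (-b‖z‖²)`. -/
noncomputable def gaussMass (d : ℕ) (b : ℝ) : ℝ := ∫ z : Euc d, Real.exp (-b * ‖z‖ ^ 2)

theorem gaussMass_eq (hb : 0 < b) : gaussMass d b = (Real.pi / b) ^ (d / 2 : ℝ) := by
  rw [gaussMass, GaussianFourier.integral_rexp_neg_mul_sq_norm hb]
  simp

theorem gaussMass_pos (hb : 0 < b) : 0 < gaussMass d b := by
  rw [gaussMass_eq hb]
  have := Real.pi_pos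
  positivity

theorem gaussMass_half_le (hb : 0 < b) : gaussMass d (b / 2) ≤ 2 ^ d * gaussMass d b := by
  have hpi := Real.pi_pos
  rw [gaussMass_eq hb, gaussMass_eq (by positivity), show Real.pi / (b / 2) = 2 * (Real.pi / b) by
    field_simp, Real.mul_rpow (by norm_num) (by positivity)]
  refine mul_le_mul_of_nonneg_right ?_ (by positivity)
  rw [← Real.rpow_natCast]
  exact Real.rpow_le_rpow_of_exponent_le (by norm_num) (by linarith [Nat.cast_nonneg (α := ℝ) d])

theorem integrable_gauss (hb : 0 < b) : Integrable fun z : Euc d => Real.exp (-b * ‖z‖ ^ 2) := by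
  simpa using integrable_norm_pow_mul_gaussian (d := d) 0 hb

theorem gauss_second_moment_le (hb : 0 < b) :
    b * ∫ z : Euc d, ‖z‖ ^ 2 * Real.exp (-b * ‖z‖ ^ 2) ≤ 2 ^ d * gaussMass d b := by
  refine le_trans ?_ (gaussMass_half_le hb)
  rw [← integral_const_mul]
  refine integral_mono ((integrable_norm_pow_mul_gaussian 2 hb).const_mul _)
    (integrable_gauss (half_pos hb)) fun z => ?_
  set t := b * ‖z‖ ^ 2
  have ht : 0 ≤ t := by positivity
  have h1 := Real.quadratic_le_exp_of_nonneg (x := t / 2) (by positivity)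
  have h2 : t ≤ Real.exp (t / 2) := by nlinarith [sq_nonneg (t - 2)]
  calc b * (‖z‖ ^ 2 * Real.exp (-b * ‖z‖ ^ 2)) = t * Real.exp (-t) := by
        simp only [t]; rw [neg_mul]; ring
    _ ≤ Real.exp (t / 2) * Real.exp (-t) := mul_le_mul_of_nonneg_right h2 (Real.exp_pos _).le
    _ = Real.exp (-(b / 2) * ‖z‖ ^ 2) := by
        rw [← Real.exp_add]
        congr 1
        simp only [t]
        ring

theorem integrable_inner_sq_gauss (hb : 0 < b) (θ : Euc d) :
    Integrable fun z : Euc d => (inner ℝ θ z) ^ 2 * Real.exp (-b * ‖z‖ ^ 2) := by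
  refine ((integrable_norm_pow_mul_gaussian 2 hb).const_mul (‖θ‖ ^ 2)).mono' (by fun_prop)
    (Filter.Eventually.of_forall fun z => ?_)
  rw [Real.norm_eq_abs, abs_of_nonneg (by positivity), ← mul_assoc, ← mul_pow]
  refine mul_le_mul_of_nonneg_right ?_ (Real.exp_pos _).le
  rw [← sq_abs]
  exact pow_le_pow_left₀ (abs_nonneg _) (abs_real_inner_le_norm θ z) 2

theorem integrable_inner_gauss (hb : 0 < b) (θ : Euc d) :
    Integrable fun z : Euc d => inner ℝ θ z * Real.exp (-b * ‖z‖ ^ 2) := by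
  refine ((integrable_norm_pow_mul_gaussian 1 hb).const_mul ‖θ‖).mono' (by fun_prop)
    (Filter.Eventually.of_forall fun z => ?_)
  rw [Real.norm_eq_abs, abs_mul, abs_of_pos (Real.exp_pos _), ← mul_assoc, pow_one]
  exact mul_le_mul_of_nonneg_right (abs_real_inner_le_norm θ z) (Real.exp_pos _).le

theorem integral_inner_gauss (θ : Euc d) :
    ∫ z : Euc d, inner ℝ θ z * Real.exp (-b * ‖z‖ ^ 2) = 0 := by
  have h := integral_neg_eq_self (fun z : Euc d => inner ℝ θ z * Real.exp (-b * ‖z‖ ^ 2)) volume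
  simp only [inner_neg_right, norm_neg, neg_mul, integral_neg] at h ⊢
  linarith

theorem integral_inner_sq_gauss_eq {e f : Euc d} (he : ‖e‖ = 1) (hf : ‖f‖ = 1) :
    ∫ z : Euc d, (inner ℝ e z) ^ 2 * Real.exp (-b * ‖z‖ ^ 2) =
      ∫ z : Euc d, (inner ℝ f z) ^ 2 * Real.exp (-b * ‖z‖ ^ 2) := by
  obtain ⟨u, i, rfl⟩ := exists_orthonormalBasis_apply_eq e he
  obtain ⟨w, j, rfl⟩ := exists_orthonormalBasis_apply_eq f hf
  set L := u.equiv w (Equiv.swap i j)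
  have hL : L (u i) = w j := by simp [L]
  have h := L.measurePreserving.integral_comp L.toHomeomorph.measurableEmbedding
    fun z : Euc d => (inner ℝ (w j) z) ^ 2 * Real.exp (-b * ‖z‖ ^ 2)
  rw [← h]
  simp only [← hL, LinearIsometryEquiv.inner_map_map, LinearIsometryEquiv.norm_map]

theorem exists_integral_inner_sq_gauss (hb : 0 < b) :
    ∃ s, 0 ≤ s ∧ s * b ≤ 2 ^ d * gaussMass d b ∧ ∀ θ : Euc d,
      ∫ z : Euc d, (inner ℝ θ z) ^ 2 * Real.exp (-b * ‖z‖ ^ 2) = s * ‖θ‖ ^ 2 := by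
  rcases Nat.eq_zero_or_pos d with rfl | hd
  · refine ⟨0, le_rfl, ?_, fun θ => ?_⟩
    · have := gaussMass_pos (d := 0) hb
      rw [zero_mul]
      positivity
    · simp [Subsingleton.elim θ 0]
  set e : Euc d := EuclideanSpace.basisFun (Fin d) ℝ ⟨0, hd⟩
  have he : ‖e‖ = 1 := OrthonormalBasis.norm_eq_one _ _
  refine ⟨∫ z : Euc d, (inner ℝ e z) ^ 2 * Real.exp (-b * ‖z‖ ^ 2),
    integral_nonneg fun z => by positivity, ?_, fun θ => ?_⟩
  · refine le_trans ?_ (gauss_second_moment_le hb)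
    rw [mul_comm]
    refine mul_le_mul_of_nonneg_left ?_ hb.le
    refine integral_mono (integrable_inner_sq_gauss hb e) (integrable_norm_pow_mul_gaussian 2 hb)
      fun z => mul_le_mul_of_nonneg_right ?_ (Real.exp_pos _).le
    rw [← sq_abs]
    have := abs_real_inner_le_norm e z
    rw [he, one_mul] at this
    exact pow_le_pow_left₀ (abs_nonneg _) this 2
  · by_cases hθ : θ = 0
    · simp [hθ]
    have hn : ‖θ‖ ≠ 0 := norm_ne_zero_iff.2 hθ
    rw [integral_inner_sq_gauss_eq he (f := ‖θ‖⁻¹ • θ) (by rw [norm_smul]; simp [hn]),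
      ← integral_mul_const]
    congr 1
    ext z
    rw [real_inner_smul_left]
    field_simp

theorem integral_inner_add_sq_gauss (hb : 0 < b) (θ : Euc d) (c : ℝ) :
    ∫ z : Euc d, (inner ℝ θ z + c) ^ 2 * Real.exp (-b * ‖z‖ ^ 2) =
      (∫ z : Euc d, (inner ℝ θ z) ^ 2 * Real.exp (-b * ‖z‖ ^ 2)) + c ^ 2 * gaussMass d b := by
  have h1 : ∀ z : Euc d, (inner ℝ θ z + c) ^ 2 * Real.exp (-b * ‖z‖ ^ 2) =
      (inner ℝ θ z) ^ 2 * Real.exp (-b * ‖z‖ ^ 2) +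
        2 * c * (inner ℝ θ z * Real.exp (-b * ‖z‖ ^ 2)) + c ^ 2 * Real.exp (-b * ‖z‖ ^ 2) :=
    fun z => by ring
  simp_rw [h1]
  rw [integral_add ((integrable_inner_sq_gauss hb θ).fun_add
      ((integrable_inner_gauss hb θ).const_mul _)) ((integrable_gauss hb).const_mul _),
    integral_add (integrable_inner_sq_gauss hb θ) ((integrable_inner_gauss hb θ).const_mul _),
    integral_const_mul, integral_const_mul, integral_inner_gauss, gaussMass]
  ring

end GaussMoments

section AutoGaussMoments

variable {d : ℕ} {b : ℝ} {K : Set (Euc d)}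

theorem exists_exp_le_gauss (hK : IsCompact K) (hb : 0 < b) :
    ∃ M, 0 ≤ M ∧ ∀ p ∈ K ×ˢ K, ∀ x : Euc d,
      Real.exp (-b * ‖x + p.1 - p.2‖ ^ 2) ≤ M * Real.exp (-(b / 2) * ‖x‖ ^ 2) := by
  obtain ⟨R, hR0, hR⟩ := hK.isBounded.exists_pos_norm_le
  refine ⟨Real.exp (4 * b * R ^ 2), (Real.exp_pos _).le, fun p hp x => ?_⟩
  rw [← Real.exp_add, Real.exp_le_exp]
  have h1 : ‖x‖ ≤ ‖x + p.1 - p.2‖ + 2 * R := by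
    calc ‖x‖ = ‖(x + p.1 - p.2) + (p.2 - p.1)‖ := by congr 1; abel
      _ ≤ ‖x + p.1 - p.2‖ + ‖p.2 - p.1‖ := norm_add_le _ _
      _ ≤ ‖x + p.1 - p.2‖ + (‖p.2‖ + ‖p.1‖) := by gcongr; exact norm_sub_le _ _
      _ ≤ _ := by linarith [hR _ hp.1, hR _ hp.2]
  have h2 : ‖x‖ ^ 2 ≤ 2 * ‖x + p.1 - p.2‖ ^ 2 + 8 * R ^ 2 := by
    have := pow_le_pow_left₀ (norm_nonneg x) h1 2
    nlinarith [sq_nonneg (‖x + p.1 - p.2‖ - 2 * R)]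
  nlinarith

theorem integrable_pow_mul_autoGauss (hK : IsCompact K) (hb : 0 < b) (n : ℕ) :
    Integrable fun x => ‖x‖ ^ n * autoGauss K b x := by
  obtain ⟨M, hM, h⟩ := exists_exp_le_gauss hK hb
  have hc : Continuous (autoGauss K b) := (contDiff_autoGauss hK).continuous
  refine ((integrable_norm_pow_mul_gaussian n (half_pos hb)).const_mul
    (volume.real (K ×ˢ K) * M)).mono' (by fun_prop) (Filter.Eventually.of_forall fun x => ?_)
  rw [Real.norm_eq_abs, abs_of_nonneg (mul_nonneg (by positivity) (autoGauss_nonneg x))]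
  have h1 : autoGauss K b x ≤ ∫ p in K ×ˢ K, M * Real.exp (-(b / 2) * ‖x‖ ^ 2) :=
    setIntegral_mono_on (integrableOn_autoGauss hK b x)
      (integrableOn_const (hK.prod hK).measure_lt_top.ne) (hK.prod hK).measurableSet
      fun p hp => h p hp x
  rw [setIntegral_const, smul_eq_mul] at h1
  have := mul_le_mul_of_nonneg_left h1 (show 0 ≤ ‖x‖ ^ n by positivity)
  linarith

theorem integral_mul_autoGauss (hK : IsCompact K) (hb : 0 < b) {G : Euc d → ℝ}
    (hG : Continuous G) {C : ℝ} {n : ℕ} (hGC : ∀ x, |G x| ≤ C * ‖x‖ ^ n) :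
    ∫ x, G x * autoGauss K b x =
      ∫ p in K ×ˢ K, ∫ z : Euc d, G (z - p.1 + p.2) * Real.exp (-b * ‖z‖ ^ 2) := by
  obtain ⟨M, hM, h⟩ := exists_exp_le_gauss hK hb
  have : IsFiniteMeasure ((volume : Measure (Euc d × Euc d)).restrict (K ×ˢ K)) :=
    ⟨by simpa using (hK.prod hK).measure_lt_top⟩
  have hInt : Integrable (Function.uncurry fun (x : Euc d) (p : Euc d × Euc d) =>
      G x * Real.exp (-b * ‖x + p.1 - p.2‖ ^ 2))
      (volume.prod ((volume : Measure (Euc d × Euc d)).restrict (K ×ˢ K))) := by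
    have h1 := ((integrable_norm_pow_mul_gaussian (d := d) n (half_pos hb)).const_mul
      (C * M)).comp_fst ((volume : Measure (Euc d × Euc d)).restrict (K ×ˢ K))
    refine h1.mono' (by fun_prop) ?_
    have h2 : ∀ᵐ q ∂((volume : Measure (Euc d)).prod
        ((volume : Measure (Euc d × Euc d)).restrict (K ×ˢ K))), q.2 ∈ K ×ˢ K :=
      Measure.quasiMeasurePreserving_snd.ae (ae_restrict_mem (hK.prod hK).measurableSet)
    filter_upwards [h2] with q hq
    rw [Function.uncurry_apply_pair, Real.norm_eq_abs, abs_mul, abs_of_pos (Real.exp_pos _)]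
    calc |G q.1| * Real.exp (-b * ‖q.1 + q.2.1 - q.2.2‖ ^ 2)
        ≤ (C * ‖q.1‖ ^ n) * (M * Real.exp (-(b / 2) * ‖q.1‖ ^ 2)) :=
          mul_le_mul (hGC _) (h _ hq _) (Real.exp_pos _).le ((abs_nonneg _).trans (hGC _))
      _ = _ := by ring
  simp only [autoGauss, ← integral_const_mul]
  rw [integral_integral_swap hInt]
  congr 1
  ext p
  have h3 := integral_add_right_eq_self (μ := (volume : Measure (Euc d)))
    (fun z => G (z - p.1 + p.2) * Real.exp (-b * ‖z‖ ^ 2)) (p.1 - p.2)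
  rw [← h3]
  congr 1
  ext x
  rw [show x + (p.1 - p.2) - p.1 + p.2 = x by abel, add_sub_assoc]

/-- A convex body with barycentre at the origin and covariance matrix the identity. -/
structure IsIsotropicBody (K : Set (Euc d)) : Prop where
  compact : IsCompact K
  convex : Convex ℝ K
  interior_nonempty : (interior K).Nonempty
  integral_inner : ∀ θ, ∫ x in K, inner ℝ θ x = 0
  integral_inner_sq : ∀ θ, ∫ x in K, (inner ℝ θ x) ^ 2 = volume.real K * ‖θ‖ ^ 2

theorem volume_real_pos (hK : IsCompact K) (hi : (interior K).Nonempty) : 0 < volume.real K :=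
  ENNReal.toReal_pos ((Measure.measure_pos_of_nonempty_interior _ hi).ne') hK.measure_lt_top.ne

theorem IsIsotropicBody.integral_inner_sub_sq (hK : IsIsotropicBody K) (θ : Euc d) :
    ∫ p in K ×ˢ K, (inner ℝ θ (p.2 - p.1)) ^ 2 = 2 * volume.real K ^ 2 * ‖θ‖ ^ 2 := by
  have hc := hK.compact
  have hi : ∀ g : Euc d × Euc d → ℝ, Continuous g → IntegrableOn g (K ×ˢ K) := fun g hg =>
    hg.continuousOn.integrableOn_compact (hc.prod hc)
  have h1 : ∀ p : Euc d × Euc d, (inner ℝ θ (p.2 - p.1)) ^ 2 =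
      (1 * (inner ℝ θ p.2) ^ 2 - 2 * (inner ℝ θ p.1 * inner ℝ θ p.2)) + (inner ℝ θ p.1) ^ 2 * 1 :=
    fun p => by rw [inner_sub_right]; ring
  simp_rw [h1]
  rw [integral_add (hi _ (by fun_prop)) (hi _ (by fun_prop)),
    integral_sub (hi _ (by fun_prop)) (hi _ (by fun_prop)), Measure.volume_eq_prod,
    setIntegral_prod_mul (fun _ => (1 : ℝ)) (fun x : Euc d => (inner ℝ θ x) ^ 2),
    integral_const_mul 2,
    setIntegral_prod_mul (fun x : Euc d => inner ℝ θ x) (fun x : Euc d => inner ℝ θ x),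
    setIntegral_prod_mul (fun x : Euc d => (inner ℝ θ x) ^ 2) (fun _ => (1 : ℝ)),
    hK.integral_inner, hK.integral_inner_sq, setIntegral_const]
  simp
  ring

theorem IsIsotropicBody.exists_isIsotropicDensity (hK : IsIsotropicBody K) (hb : 2 ^ d ≤ b) :
    ∃ v, IsIsotropicDensity v fun x =>
      1 / (volume.real K ^ 2 * gaussMass d b) * autoGauss K b x := by
  have hV := volume_real_pos hK.compact hK.interior_nonempty
  have hb0 : 0 < b := lt_of_lt_of_le (by positivity) hb
  have hZ := gaussMass_pos (d := d) hb0
  obtain ⟨s, hs0, hs1, hs⟩ := exists_integral_inner_sq_gauss (d := d) hb0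
  have hi := integrable_pow_mul_autoGauss hK.compact hb0
  refine ⟨2 + s / gaussMass d b, ?_, ?_, ?_, ?_, fun θ => ?_, ?_, ?_⟩
  · exact isGood_autoGauss hK.compact hK.convex
      (Measure.measure_pos_of_nonempty_interior _ hK.interior_nonempty).ne' hb0.le (by positivity)
  · exact Integrable.const_mul (by simpa using hi 0) _
  · rw [integral_const_mul]
    have h1 := integral_mul_autoGauss hK.compact hb0 (G := fun _ => 1) continuous_const
      (C := 1) (n := 0) (by simp)
    simp only [one_mul] at h1
    rw [h1]
    change 1 / _ * ∫ p in K ×ˢ K, gaussMass d b = 1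
    rw [setIntegral_const, Measure.volume_eq_prod, measureReal_prod_prod, smul_eq_mul]
    field_simp
  · convert (hi 4).const_mul (1 / (volume.real K ^ 2 * gaussMass d b)) using 2
    ring
  · have h1 := integral_mul_autoGauss hK.compact hb0 (G := fun x => (inner ℝ θ x) ^ 2)
      (by fun_prop) (C := ‖θ‖ ^ 2) (n := 2) (fun x => by
        rw [abs_of_nonneg (sq_nonneg _), ← mul_pow, ← sq_abs]
        exact pow_le_pow_left₀ (abs_nonneg _) (abs_real_inner_le_norm θ x) 2)
    have h2 : ∀ p : Euc d × Euc d, ∫ z : Euc d, (inner ℝ θ (z - p.1 + p.2)) ^ 2 *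
        Real.exp (-b * ‖z‖ ^ 2) = s * ‖θ‖ ^ 2 + (inner ℝ θ (p.2 - p.1)) ^ 2 * gaussMass d b := by
      intro p
      rw [← hs, ← integral_inner_add_sq_gauss hb0]
      congr 1
      ext z
      rw [← inner_add_right, show z - p.1 + p.2 = z + (p.2 - p.1) by abel]
    simp_rw [h2] at h1
    have hc := hK.compact
    have hcont : ∀ g : Euc d × Euc d → ℝ, Continuous g →
        Integrable g (volume.restrict (K ×ˢ K)) := fun g hg =>
      hg.continuousOn.integrableOn_compact (hc.prod hc)
    rw [integral_add (hcont _ continuous_const) (hcont _ (by fun_prop)),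
      integral_mul_const (gaussMass d b),
      hK.integral_inner_sub_sq, setIntegral_const, Measure.volume_eq_prod, measureReal_prod_prod,
      smul_eq_mul] at h1
    have h3 : ∀ x, 1 / (volume.real K ^ 2 * gaussMass d b) * autoGauss K b x * (inner ℝ θ x) ^ 2 =
        1 / (volume.real K ^ 2 * gaussMass d b) * ((inner ℝ θ x) ^ 2 * autoGauss K b x) :=
      fun x => by ring
    simp_rw [h3]
    rw [integral_const_mul, h1]
    field_simp
    ring
  · have : 0 ≤ s / gaussMass d b := by positivity
    linarith
  · have : s / gaussMass d b ≤ 1 := by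
      rw [div_le_one hZ]
      have h4 : s * 2 ^ d ≤ 2 ^ d * gaussMass d b :=
        (mul_le_mul_of_nonneg_left hb hs0).trans hs1
      have h5 : (0 : ℝ) < 2 ^ d := by positivity
      nlinarith
    linarith

end AutoGaussMoments

section Slicing

variable {d : ℕ} {b : ℝ} {K : Set (Euc d)}

theorem volume_real_homothety (K : Set (Euc d)) (x : Euc d) {r : ℝ} (hr : 0 ≤ r) :
    volume.real (AffineMap.homothety x r '' K) = r ^ d * volume.real K := by
  rw [measureReal_def, Measure.addHaar_image_homothety, ENNReal.toReal_mul,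
    ENNReal.toReal_ofReal (abs_nonneg _), abs_of_nonneg (by positivity), finrank_euclideanSpace_fin,
    measureReal_def]

theorem half_gaussMass_le_setIntegral {u : Euc d} {ρ : ℝ} (hρ : 0 < ρ) (hK : MeasurableSet K)
    (hb : 0 < b) (hbρ : 2 ^ (d + 1) ≤ b * ρ ^ 2) (hu : Metric.ball u ρ ⊆ K) :
    gaussMass d b / 2 ≤ ∫ y in K, Real.exp (-b * ‖0 + u - y‖ ^ 2) := by
  have hZ := gaussMass_pos (d := d) hb
  have h1 : Integrable fun y : Euc d => Real.exp (-b * ‖0 + u - y‖ ^ 2) := by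
    simpa using (integrable_gauss hb).comp_sub_left u
  have h2 : Integrable fun y : Euc d => ‖0 + u - y‖ ^ 2 * Real.exp (-b * ‖0 + u - y‖ ^ 2) := by
    simpa using (integrable_norm_pow_mul_gaussian 2 hb).comp_sub_left u
  have h3 : (∫ y : Euc d, Real.exp (-b * ‖0 + u - y‖ ^ 2)) = gaussMass d b := by
    simp only [zero_add]
    exact integral_sub_left_eq_self (fun z : Euc d => Real.exp (-b * ‖z‖ ^ 2)) volume u
  have h4 : (∫ y : Euc d, ‖0 + u - y‖ ^ 2 * Real.exp (-b * ‖0 + u - y‖ ^ 2)) =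
      ∫ z : Euc d, ‖z‖ ^ 2 * Real.exp (-b * ‖z‖ ^ 2) := by
    simp only [zero_add]
    exact integral_sub_left_eq_self (fun z : Euc d => ‖z‖ ^ 2 * Real.exp (-b * ‖z‖ ^ 2)) volume u
  have h5 : (∫ y : Euc d, (Real.exp (-b * ‖0 + u - y‖ ^ 2) -
      (ρ ^ 2)⁻¹ * (‖0 + u - y‖ ^ 2 * Real.exp (-b * ‖0 + u - y‖ ^ 2)))) ≤
      ∫ y in K, Real.exp (-b * ‖0 + u - y‖ ^ 2) := by
    rw [← integral_indicator hK]
    refine integral_mono (h1.sub' (h2.const_mul _)) (h1.indicator hK) fun y => ?_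
    have he := Real.exp_pos (-b * ‖0 + u - y‖ ^ 2)
    by_cases hy : y ∈ K
    · simp only [Set.indicator_of_mem hy]
      have : 0 ≤ (ρ ^ 2)⁻¹ * (‖0 + u - y‖ ^ 2 * Real.exp (-b * ‖0 + u - y‖ ^ 2)) := by positivity
      linarith
    · simp only [Set.indicator_of_notMem hy]
      have h6 : ρ ≤ ‖0 + u - y‖ := by
        by_contra h7
        refine hy (hu ?_)
        rw [Metric.mem_ball, dist_comm, dist_eq_norm]
        simpa using h7
      have h8 : ρ ^ 2 ≤ ‖0 + u - y‖ ^ 2 := pow_le_pow_left₀ hρ.le h6 2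
      have h9 : 1 ≤ (ρ ^ 2)⁻¹ * ‖0 + u - y‖ ^ 2 := by
        rw [le_inv_mul_iff₀ (by positivity), mul_one]
        exact h8
      nlinarith
  rw [integral_sub h1 (h2.const_mul _), integral_const_mul, h3, h4] at h5
  set M := ∫ z : Euc d, ‖z‖ ^ 2 * Real.exp (-b * ‖z‖ ^ 2)
  have h6 : b * M ≤ 2 ^ d * gaussMass d b := gauss_second_moment_le hb
  have h7 : (ρ ^ 2)⁻¹ * M ≤ gaussMass d b / 2 := by
    rw [inv_mul_le_iff₀ (by positivity)]
    have h8 : 2 ^ (d + 1) * gaussMass d b ≤ b * ρ ^ 2 * gaussMass d b :=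
      mul_le_mul_of_nonneg_right hbρ hZ.le
    rw [pow_succ] at h8
    have h9 : b * M ≤ b * (ρ ^ 2 * (gaussMass d b / 2)) := by linarith
    exact le_of_mul_le_mul_left h9 hb
  linarith

theorem exists_le_autoGauss_zero (hK : IsCompact K) (hc : Convex ℝ K)
    (hi : (interior K).Nonempty) :
    ∃ b₀ > 0, ∀ b, b₀ ≤ b →
      (1 / 2) ^ d * volume.real K * (gaussMass d b / 2) ≤ autoGauss K b 0 := by
  obtain ⟨x₀, hx₀⟩ := hi
  obtain ⟨r, hr, hball⟩ := Metric.isOpen_iff.1 isOpen_interior x₀ hx₀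
  refine ⟨2 ^ (d + 1) / (r / 2) ^ 2, by positivity, fun b hb => ?_⟩
  have hb0 : 0 < b := lt_of_lt_of_le (by positivity) hb
  rw [div_le_iff₀ (by positivity)] at hb
  set K' := AffineMap.homothety x₀ (1 / 2 : ℝ) '' K
  have hK' : ∀ u ∈ K', Metric.ball u (r / 2) ⊆ K := by
    rintro _ ⟨k, hk, rfl⟩ y hy
    have h1 : x₀ + (2 : ℝ) • (y - AffineMap.homothety x₀ (1 / 2 : ℝ) k) ∈ K := by
      refine interior_subset (hball ?_)
      rw [Metric.mem_ball, dist_eq_norm] at hy ⊢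
      rw [add_sub_cancel_left, norm_smul]
      norm_num
      linarith
    convert hc hk h1 (by norm_num : (0 : ℝ) ≤ 1 / 2) (by norm_num : (0 : ℝ) ≤ 1 / 2)
      (by norm_num) using 1
    simp only [AffineMap.homothety_apply, vsub_eq_sub, vadd_eq_add]
    module
  have hsub : K' ⊆ K := fun u hu => hK' u hu (Metric.mem_ball_self (by positivity))
  have hK'm : MeasurableSet K' := (hK.image (AffineMap.homothety_continuous _ _)).measurableSet
  have hInt := integrableOn_autoGauss hK b 0
  rw [Measure.volume_eq_prod, IntegrableOn, ← Measure.prod_restrict] at hInt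
  have hInt' := hInt.integral_prod_left
  rw [autoGauss, Measure.volume_eq_prod, setIntegral_prod _ (integrableOn_autoGauss hK b 0)]
  have h1 : ∫ u in K', gaussMass d b / 2 ≤
      ∫ u in K', ∫ y in K, Real.exp (-b * ‖0 + u - y‖ ^ 2) :=
    setIntegral_mono_on (integrableOn_const ((measure_mono hsub).trans_lt hK.measure_lt_top).ne)
      (IntegrableOn.mono_set hInt' hsub) hK'm fun u hu =>
        half_gaussMass_le_setIntegral (by positivity) hK.measurableSet hb0 hb (hK' u hu)
  rw [setIntegral_const, volume_real_homothety K x₀ (by norm_num), smul_eq_mul] at h1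
  refine h1.trans (setIntegral_mono_set hInt' ?_ hsub.eventuallyLE)
  exact Filter.Eventually.of_forall fun u => integral_nonneg fun y => (Real.exp_pos _).le

/-- The slicing theorem: isotropic convex bodies have volume at least `exp (-49 d)`. -/
theorem IsIsotropicBody.exp_le_volume (hK : IsIsotropicBody K) (hd : 1 ≤ d) :
    Real.exp (-(49 * d)) ≤ volume.real K := by
  have hV := volume_real_pos hK.compact hK.interior_nonempty
  obtain ⟨b₀, hb₀, hlow⟩ := exists_le_autoGauss_zero hK.compact hK.convex hK.interior_nonempty
  set b := max b₀ (2 ^ d)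
  have hb0 : 0 < b := lt_of_lt_of_le hb₀ (le_max_left _ _)
  have hZ := gaussMass_pos (d := d) hb0
  obtain ⟨v, hv⟩ := hK.exists_isIsotropicDensity (b := b) (le_max_right _ _)
  have h1 := hv.apply_zero_le
  have h2 := hlow b (le_max_left _ _)
  have h3 : (1 / 2) ^ d / 2 ≤ Real.exp (47 * d) * volume.real K := by
    have h4 := mul_le_mul_of_nonneg_left h2
      (show 0 ≤ 1 / (volume.real K ^ 2 * gaussMass d b) by positivity)
    have h5 := mul_le_mul_of_nonneg_right (h4.trans h1) hV.le
    have h6 : (1 / 2) ^ d / 2 = 1 / (volume.real K ^ 2 * gaussMass d b) *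
        ((1 / 2) ^ d * volume.real K * (gaussMass d b / 2)) * volume.real K := by
      field_simp
    rw [h6]
    exact h5
  have h6 : Real.exp (-(2 * d)) ≤ (1 / 2) ^ d / 2 := by
    have h7 : Real.exp (-1) ≤ 1 / 2 := by
      have := Real.exp_neg_one_lt_d9
      linarith
    have hd' : (1 : ℝ) ≤ d := by exact_mod_cast hd
    calc Real.exp (-(2 * d)) ≤ Real.exp (-d) * Real.exp (-1) := by
          rw [← Real.exp_add, Real.exp_le_exp]
          linarith
      _ = Real.exp (-1) ^ d * Real.exp (-1) := by rw [← Real.exp_nat_mul]; simp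
      _ ≤ (1 / 2) ^ d * (1 / 2) := by gcongr
      _ = _ := by ring
  have h8 : Real.exp (-(49 * d)) * Real.exp (47 * d) ≤ volume.real K * Real.exp (47 * d) := by
    rw [← Real.exp_add, show -(49 * (d : ℝ)) + 47 * d = -(2 * d) by ring]
    linarith
  exact le_of_mul_le_mul_right h8 (Real.exp_pos _)

end Slicing

section IsotropicPosition

variable {d : ℕ} {K : Set (Euc d)}

theorem setIntegral_image_sub (e : Euc d ≃L[ℝ] Euc d) (c : Euc d) (hK : MeasurableSet K)
    (G : Euc d → ℝ) :
    ∫ y in (fun x => e (x - c)) '' K, G y =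
      |(e : Euc d →L[ℝ] Euc d).det| * ∫ x in K, G (e (x - c)) := by
  rw [integral_image_eq_integral_abs_det_fderiv_smul volume hK
    (f' := fun _ => (e : Euc d →L[ℝ] Euc d)) (fun x _ => ?_) (fun x _ y _ h => ?_) G]
  · simp only [smul_eq_mul]
    rw [integral_const_mul]
  · exact ((e : Euc d →L[ℝ] Euc d).hasFDerivAt.comp x
      ((hasFDerivAt_id x).sub_const c)).hasFDerivWithinAt
  · simpa using h

theorem volume_real_image_sub (e : Euc d ≃L[ℝ] Euc d) (c : Euc d) (hK : MeasurableSet K) :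
    volume.real ((fun x => e (x - c)) '' K) =
      |(e : Euc d →L[ℝ] Euc d).det| * volume.real K := by
  simpa using setIntegral_image_sub e c hK fun _ => 1

theorem setIntegral_inner_sub_sq_pos (hK : IsCompact K) (hi : (interior K).Nonempty)
    (c : Euc d) {θ : Euc d} (hθ : θ ≠ 0) : 0 < ∫ x in K, (inner ℝ θ (x - c)) ^ 2 := by
  refine lt_of_le_of_ne (integral_nonneg fun x => sq_nonneg _) fun h0 => ?_
  have hInt : IntegrableOn (fun x => (inner ℝ θ (x - c)) ^ 2) K :=
    (by fun_prop : Continuous fun x => (inner ℝ θ (x - c)) ^ 2).continuousOn.integrableOn_compact hK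
  have h1 := (setIntegral_eq_zero_iff_of_nonneg_ae
    (Filter.Eventually.of_forall fun x => sq_nonneg _) hInt).1 h0.symm
  have h2 : Set.EqOn (fun x => (inner ℝ θ (x - c)) ^ 2) 0 (interior K) :=
    Measure.eqOn_open_of_ae_eq (ae_restrict_of_ae_restrict_of_subset interior_subset h1)
      isOpen_interior (by fun_prop) continuousOn_const
  obtain ⟨x, hx⟩ := hi
  have h3 : ∀ᶠ t : ℝ in nhds 0, x + t • θ ∈ interior K := by
    refine (by fun_prop : Continuous fun t : ℝ => x + t • θ).continuousAt ?_
    simpa using isOpen_interior.mem_nhds hx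
  obtain ⟨r, hr, h4⟩ := Metric.eventually_nhds_iff.1 h3
  have h5 := h2 (h4 (y := r / 2) (by rw [Real.dist_eq, sub_zero, abs_of_pos] <;> linarith))
  have h6 := h2 hx
  simp only [Pi.zero_apply, sq_eq_zero_iff, add_sub_right_comm, inner_add_right,
    inner_smul_right, real_inner_self_eq_norm_sq] at h5 h6
  rw [h6, zero_add] at h5
  have : 0 < r / 2 * ‖θ‖ ^ 2 := by positivity
  linarith

/-- The second moment form of `K` about `c` is diagonal in a suitable orthonormal basis. -/
theorem exists_orthonormalBasis_setIntegral_inner_mul (hK : IsCompact K) (c : Euc d) :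
    ∃ b : OrthonormalBasis (Fin d) ℝ (Euc d), ∀ i j, i ≠ j →
      ∫ x in K, inner ℝ (b i) (x - c) * inner ℝ (b j) (x - c) = 0 := by
  have hInt : ∀ θ : Euc d, IntegrableOn (fun x => inner ℝ θ (x - c) • (x - c)) K := fun θ =>
    (by fun_prop : Continuous fun x => inner ℝ θ (x - c) • (x - c)).continuousOn.integrableOn_compact
      hK
  let A : Euc d →ₗ[ℝ] Euc d :=
    { toFun := fun θ => ∫ x in K, inner ℝ θ (x - c) • (x - c)
      map_add' := fun θ φ => by
        simp only [inner_add_left, add_smul]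
        exact integral_add (hInt θ) (hInt φ)
      map_smul' := fun r θ => by
        simp only [real_inner_smul_left, mul_smul, RingHom.id_apply]
        exact integral_smul r _ }
  have hA : ∀ θ φ, inner ℝ (A θ) φ = ∫ x in K, inner ℝ θ (x - c) * inner ℝ φ (x - c) := by
    intro θ φ
    rw [real_inner_comm]
    refine (integral_inner (hInt θ) φ).symm.trans ?_
    simp only [inner_smul_right]
  have hsymm : A.IsSymmetric := fun θ φ => by
    rw [hA, real_inner_comm, hA]
    simp only [mul_comm]
  refine ⟨hsymm.eigenvectorBasis (by simp), fun i j hij => ?_⟩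
  rw [← hA, hsymm.apply_eigenvectorBasis, inner_smul_left, OrthonormalBasis.inner_eq_ite,
    if_neg hij, mul_zero]

theorem exists_isIsotropicBody_image (hK : IsCompact K) (hc : Convex ℝ K)
    (hi : (interior K).Nonempty) :
    ∃ (e : Euc d ≃L[ℝ] Euc d) (c : Euc d), IsIsotropicBody ((fun x => e (x - c)) '' K) := by
  have hV := volume_real_pos hK hi
  set V := volume.real K with hVdef
  have hcont : ∀ g : Euc d → ℝ, Continuous g → Integrable g (volume.restrict K) := fun g hg =>
    hg.continuousOn.integrableOn_compact hK
  set c : Euc d := V⁻¹ • ∫ x in K, x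
  have hid : Integrable (fun x : Euc d => x) (volume.restrict K) :=
    continuous_id.continuousOn.integrableOn_compact hK
  have hmean : ∀ θ : Euc d, ∫ x in K, inner ℝ θ (x - c) = 0 := by
    intro θ
    simp only [inner_sub_right]
    rw [integral_sub (hcont _ (by fun_prop)) (hcont _ (by fun_prop)), setIntegral_const,
      integral_inner hid, inner_smul_right, smul_eq_mul, ← hVdef, mul_inv_cancel_left₀ hV.ne',
      sub_self]
  obtain ⟨b, hb⟩ := exists_orthonormalBasis_setIntegral_inner_mul hK c
  set lam : Fin d → ℝ := fun i => ∫ x in K, (inner ℝ (b i) (x - c)) ^ 2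
  have hlam : ∀ i, 0 < lam i := fun i =>
    setIntegral_inner_sub_sq_pos hK hi c (b.orthonormal.ne_zero i)
  set α : Fin d → ℝ := fun i => Real.log (V / lam i) / 2
  have hα : ∀ i, Real.exp (α i) ^ 2 * lam i = V := fun i => by
    rw [← Real.exp_nat_mul]
    have : ((2 : ℕ) : ℝ) * α i = Real.log (V / lam i) := by simp only [α]; push_cast; ring
    rw [this, Real.exp_log (div_pos hV (hlam i)), div_mul_cancel₀ _ (hlam i).ne']
  have hexp : ∀ θ x : Euc d, inner ℝ θ (dil b α x) =
      ∑ i, inner ℝ (b i) θ * Real.exp (α i) * inner ℝ (b i) x := fun θ x => by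
    rw [← b.sum_inner_mul_inner]
    refine Finset.sum_congr rfl fun i _ => ?_
    rw [inner_dil, real_inner_comm]
    ring
  refine ⟨dil b α, c, ?_, ?_, ?_, fun θ => ?_, fun θ => ?_⟩
  · exact hK.image (by fun_prop)
  · have : (fun x => dil b α (x - c)) '' K = dil b α '' ((fun x => x - c) '' K) := by
      rw [Set.image_image]
    rw [this]
    refine Convex.linear_image ?_ (dil b α : Euc d →ₗ[ℝ] Euc d)
    simpa only [sub_eq_add_neg, add_comm] using hc.translate (-c)
  · have : (fun x => dil b α (x - c)) '' interior K ⊆ (fun x => dil b α (x - c)) '' K :=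
      Set.image_mono interior_subset
    refine (hi.image _).mono (interior_maximal this ?_)
    exact ((dil b α).toHomeomorph.isOpenMap.comp (Homeomorph.subRight c).isOpenMap) _
      isOpen_interior
  · rw [setIntegral_image_sub _ _ hK.measurableSet]
    simp only [hexp]
    rw [integral_finsetSum _ fun i _ => hcont _ (by fun_prop)]
    simp only [integral_const_mul, hmean, mul_zero, Finset.sum_const_zero]
  · rw [setIntegral_image_sub _ _ hK.measurableSet, volume_real_image_sub _ _ hK.measurableSet,
      mul_assoc]
    congr 1
    simp only [hexp, sq (Finset.sum _ _), Finset.sum_mul_sum]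
    rw [integral_finsetSum _ fun i _ => hcont _ (by fun_prop), norm_sq_eq_sum_inner b,
      Finset.mul_sum]
    refine Finset.sum_congr rfl fun i _ => ?_
    rw [integral_finsetSum _ fun i _ => hcont _ (by fun_prop), Finset.sum_eq_single i]
    · have h1 : ∀ x, inner ℝ (b i) θ * Real.exp (α i) * inner ℝ (b i) (x - c) *
          (inner ℝ (b i) θ * Real.exp (α i) * inner ℝ (b i) (x - c)) =
          inner ℝ (b i) θ ^ 2 * Real.exp (α i) ^ 2 * inner ℝ (b i) (x - c) ^ 2 := fun x => by ring
      simp only [h1]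
      rw [← hVdef, ← hα i, integral_const_mul]
      ring
    · intro j _ hj
      have h1 : ∀ x, inner ℝ (b i) θ * Real.exp (α i) * inner ℝ (b i) (x - c) *
          (inner ℝ (b j) θ * Real.exp (α j) * inner ℝ (b j) (x - c)) =
          inner ℝ (b i) θ * Real.exp (α i) * (inner ℝ (b j) θ * Real.exp (α j)) *
          (inner ℝ (b i) (x - c) * inner ℝ (b j) (x - c)) := fun x => by ring
      simp only [h1]
      rw [integral_const_mul, hb i j hj.symm, mul_zero]
    · simp

end IsotropicPosition

section Averaging

open scoped ENNReal

variable {d : ℕ} {K : Set (Euc d)}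

theorem lintegral_comp_half_smul_add {G : Euc d → ℝ≥0∞} (hG : Measurable G) (x : Euc d) :
    ∫⁻ y, G ((1 / 2 : ℝ) • (x + y)) = 2 ^ d * ∫⁻ z, G z := by
  rw [lintegral_add_left_eq_self (fun y => G ((1 / 2 : ℝ) • y)) x,
    ← lintegral_map hG (measurable_const_smul (1 / 2 : ℝ)),
    Measure.map_addHaar_smul volume (by norm_num), lintegral_smul_measure, smul_eq_mul]
  congr 1
  rw [finrank_euclideanSpace_fin, abs_of_pos (by positivity), one_div, inv_pow, inv_inv,
    ENNReal.ofReal_pow (by norm_num)]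
  norm_num

/-- If every reflection of `K` meets `K` in volume at most `Q`, then the midpoint of two
independent points of `K` has density at most `2 ^ d * Q`. -/
theorem lintegral_lintegral_midpoint_le (hK : MeasurableSet K) (hc : Convex ℝ K) {Q : ℝ≥0∞}
    (hQ : ∀ z : Euc d, volume (K ∩ (fun x => (2 : ℝ) • z - x) ⁻¹' K) ≤ Q) {φ : Euc d → ℝ≥0∞}
    (hφ : Measurable φ) :
    ∫⁻ x in K, ∫⁻ y in K, φ ((1 / 2 : ℝ) • (x + y)) ≤ 2 ^ d * Q * ∫⁻ z in K, φ z := by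
  have hpre : ∀ z : Euc d, MeasurableSet ((fun x => (2 : ℝ) • z - x) ⁻¹' K) := fun z =>
    (by fun_prop : Measurable fun x => (2 : ℝ) • z - x) hK
  have h1 : ∀ x : Euc d, ∫⁻ y in K, φ ((1 / 2 : ℝ) • (x + y)) =
      2 ^ d * ∫⁻ z, K.indicator 1 ((2 : ℝ) • z - x) * φ z := by
    intro x
    rw [← lintegral_comp_half_smul_add (by fun_prop (disch := exact hK)), ← lintegral_indicator hK]
    refine lintegral_congr fun y => ?_
    rw [show (2 : ℝ) • (1 / 2 : ℝ) • (x + y) - x = y by module]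
    by_cases hy : y ∈ K <;> simp [hy]
  simp only [h1]
  rw [lintegral_const_mul' _ _ (by simp), lintegral_lintegral_swap (by
    refine Measurable.aemeasurable ?_
    refine Measurable.mul ?_ (hφ.comp measurable_snd)
    exact (measurable_one.indicator hK).comp (by fun_prop)), mul_assoc]
  refine mul_le_mul_right ?_ _
  rw [← lintegral_indicator hK, ← lintegral_const_mul _ (hφ.indicator hK)]
  refine lintegral_mono fun z => ?_
  have hmz : Measurable fun x => K.indicator (1 : Euc d → ℝ≥0∞) ((2 : ℝ) • z - x) :=
    (measurable_one.indicator hK).comp (by fun_prop)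
  rw [lintegral_mul_const _ hmz]
  have h2 : ∫⁻ x in K, K.indicator 1 ((2 : ℝ) • z - x) =
      volume (K ∩ (fun x => (2 : ℝ) • z - x) ⁻¹' K) := by
    rw [Set.inter_comm, ← Measure.restrict_apply (hpre z), ← lintegral_indicator_one (hpre z)]
    rfl
  rw [h2]
  by_cases hz : z ∈ K
  · rw [Set.indicator_of_mem hz]
    gcongr
    exact hQ z
  · have h3 : K ∩ (fun x => (2 : ℝ) • z - x) ⁻¹' K = ∅ := by
      refine Set.eq_empty_of_forall_notMem fun x hx => hz ?_
      convert hc hx.1 hx.2 (by norm_num : (0 : ℝ) ≤ 1 / 2) (by norm_num : (0 : ℝ) ≤ 1 / 2)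
        (by norm_num) using 1
      module
    simp [h3]

/-- A centred probability measure on `K` with density at most `C` and second moment `s`. -/
structure IsCentredLaw (K : Set (Euc d)) (C : ℝ≥0∞) (s : ℝ) (μ : Measure (Euc d)) : Prop where
  prob : IsProbabilityMeasure μ
  le : μ ≤ C • volume.restrict K
  mean : ∫ x, x ∂μ = 0
  second_moment : ∫ x, ‖x‖ ^ 2 ∂μ = s

theorem IsCentredLaw.integrable {C : ℝ≥0∞} {s : ℝ} {μ : Measure (Euc d)}
    (h : IsCentredLaw K C s μ) (hK : IsCompact K) (hC : C ≠ ⊤) {E : Type*} [NormedAddCommGroup E]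
    {g : Euc d → E} (hg : Continuous g) : Integrable g μ :=
  ((hg.continuousOn.integrableOn_compact hK).smul_measure hC).mono_measure h.le

/-- The law of the midpoint of two independent points with law `μ`. -/
theorem IsCentredLaw.midpoint {C Q : ℝ≥0∞} {s : ℝ} {μ : Measure (Euc d)}
    (h : IsCentredLaw K C s μ) (hK : IsCompact K) (hc : Convex ℝ K) (hC : C ≠ ⊤)
    (hQ : ∀ z : Euc d, volume (K ∩ (fun x => (2 : ℝ) • z - x) ⁻¹' K) ≤ Q) :
    IsCentredLaw K (C ^ 2 * (2 ^ d * Q)) (s / 2)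
      ((μ.prod μ).map fun p => (1 / 2 : ℝ) • (p.1 + p.2)) := by
  have := h.prob
  have hm : Measurable fun p : Euc d × Euc d => (1 / 2 : ℝ) • (p.1 + p.2) := by fun_prop
  have hid := h.integrable hK hC (g := fun x => x) continuous_id
  have hsq := h.integrable hK hC (g := fun x => ‖x‖ ^ 2) (by fun_prop)
  refine ⟨Measure.isProbabilityMeasure_map hm.aemeasurable, ?_, ?_, ?_⟩
  · refine Measure.le_intro fun S hS _ => ?_
    have hφ : Measurable (S.indicator (1 : Euc d → ℝ≥0∞)) := measurable_one.indicator hS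
    have hφm : Measurable fun p : Euc d × Euc d =>
        S.indicator (1 : Euc d → ℝ≥0∞) ((1 / 2 : ℝ) • (p.1 + p.2)) := hφ.comp hm
    rw [← lintegral_indicator_one hS, lintegral_map hφ hm, lintegral_prod _ hφm.aemeasurable]
    calc ∫⁻ x, ∫⁻ y, S.indicator 1 ((1 / 2 : ℝ) • (x + y)) ∂μ ∂μ
        ≤ ∫⁻ x, ∫⁻ y, S.indicator 1 ((1 / 2 : ℝ) • (x + y)) ∂(C • volume.restrict K)
            ∂(C • volume.restrict K) :=
          lintegral_mono' h.le fun x => lintegral_mono' h.le le_rfl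
      _ = C ^ 2 * ∫⁻ x in K, ∫⁻ y in K, S.indicator 1 ((1 / 2 : ℝ) • (x + y)) := by
          simp only [lintegral_smul_measure, smul_eq_mul]
          rw [lintegral_const_mul' _ _ hC, sq, mul_assoc]
      _ ≤ C ^ 2 * (2 ^ d * Q * ∫⁻ z in K, S.indicator 1 z) :=
          mul_le_mul_right (lintegral_lintegral_midpoint_le hK.measurableSet hc hQ hφ) _
      _ = _ := by
          rw [lintegral_indicator_one hS, Measure.smul_apply, smul_eq_mul, ← mul_assoc]
  · rw [integral_map hm.aemeasurable (by fun_prop), integral_smul,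
      integral_add (hid.comp_fst μ) (hid.comp_snd μ), integral_fun_fst (fun x => x),
      integral_fun_snd (fun x => x)]
    simp [h.mean]
  · rw [integral_map hm.aemeasurable (by fun_prop)]
    have hin : Integrable (fun p : Euc d × Euc d => inner ℝ p.1 p.2) (μ.prod μ) := by
      refine Integrable.mono' (g := fun p => ‖p.1‖ * ‖p.2‖) (hid.norm.mul_prod hid.norm)
        (by fun_prop) (Filter.Eventually.of_forall fun p => norm_inner_le_norm _ _)
    have h0 : ∫ p : Euc d × Euc d, inner ℝ p.1 p.2 ∂(μ.prod μ) = 0 := by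
      rw [integral_prod _ hin]
      refine integral_eq_zero_of_ae (Filter.Eventually.of_forall fun x => ?_)
      simp only
      rw [integral_inner hid, h.mean, inner_zero_right]
      rfl
    have h1 : ∀ p : Euc d × Euc d, ‖(1 / 2 : ℝ) • (p.1 + p.2)‖ ^ 2 =
        1 / 4 * ‖p.1‖ ^ 2 + 1 / 4 * ‖p.2‖ ^ 2 + 1 / 2 * inner ℝ p.1 p.2 := fun p => by
      rw [norm_smul, mul_pow, norm_add_sq_real]
      norm_num
      ring
    simp only [h1]
    rw [integral_add (((hsq.comp_fst μ).const_mul _).fun_add ((hsq.comp_snd μ).const_mul _))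
      (hin.const_mul _), integral_add ((hsq.comp_fst μ).const_mul _) ((hsq.comp_snd μ).const_mul _)]
    simp only [integral_const_mul]
    rw [h0, integral_fun_fst (fun x => ‖x‖ ^ 2), integral_fun_snd (fun x => ‖x‖ ^ 2),
      h.second_moment]
    simp
    ring

end Averaging

section SymmetricIntersection

variable {d : ℕ} {K : Set (Euc d)}

theorem IsIsotropicBody.isCentredLaw (hK : IsIsotropicBody K) :
    IsCentredLaw K (ENNReal.ofReal (volume.real K)⁻¹) d
      (ENNReal.ofReal (volume.real K)⁻¹ • volume.restrict K) := by
  have hV := volume_real_pos hK.compact hK.interior_nonempty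
  have hcont : ∀ g : Euc d → ℝ, Continuous g → Integrable g (volume.restrict K) := fun g hg =>
    hg.continuousOn.integrableOn_compact hK.compact
  refine ⟨⟨?_⟩, le_rfl, ?_, ?_⟩
  · rw [Measure.smul_apply, Measure.restrict_apply_univ, smul_eq_mul,
      ← ofReal_measureReal hK.compact.measure_lt_top.ne, ← ENNReal.ofReal_mul (by positivity),
      inv_mul_cancel₀ hV.ne', ENNReal.ofReal_one]
  · rw [integral_smul_measure]
    have h1 : ∫ x in K, x = (0 : Euc d) := by
      refine ext_inner_left ℝ fun θ => ?_
      have hid : Integrable (fun x : Euc d => x) (volume.restrict K) :=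
        continuous_id.continuousOn.integrableOn_compact hK.compact
      rw [inner_zero_right, ← hK.integral_inner θ, _root_.integral_inner hid]
    rw [h1, smul_zero]
  · rw [integral_smul_measure]
    have h1 : ∫ x in K, ‖x‖ ^ 2 = volume.real K * d := by
      simp only [norm_sq_eq_sum_inner (EuclideanSpace.basisFun (Fin d) ℝ)]
      rw [integral_finsetSum _ fun i _ => hcont _ (by fun_prop)]
      simp only [hK.integral_inner_sq]
      simp [mul_comm]
    rw [h1, ENNReal.toReal_ofReal (by positivity), smul_eq_mul, inv_mul_cancel_left₀ hV.ne']

theorem IsCentredLaw.exp_le {c s β : ℝ} {μ : Measure (Euc d)} (hc : 0 ≤ c) (hβ : 0 < β)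
    (h : IsCentredLaw K (ENNReal.ofReal c) s μ) (hK : IsCompact K) :
    Real.exp (-(β * s)) ≤ c * gaussMass d β := by
  have := h.prob
  have hsq := h.integrable hK ENNReal.ofReal_ne_top (g := fun x => ‖x‖ ^ 2) (by fun_prop)
  have hg := h.integrable hK ENNReal.ofReal_ne_top (g := fun x => Real.exp (-β * ‖x‖ ^ 2))
    (by fun_prop)
  have h1 : ∫ x, Real.exp (-(β * s)) * (1 + β * s - β * ‖x‖ ^ 2) ∂μ ≤
      ∫ x, Real.exp (-β * ‖x‖ ^ 2) ∂μ := by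
    refine integral_mono (((integrable_const _).sub' (hsq.const_mul β)).const_mul _) hg fun x => ?_
    have h2 := Real.add_one_le_exp (β * s - β * ‖x‖ ^ 2)
    calc Real.exp (-(β * s)) * (1 + β * s - β * ‖x‖ ^ 2)
        ≤ Real.exp (-(β * s)) * Real.exp (β * s - β * ‖x‖ ^ 2) := by gcongr; linarith
      _ = Real.exp (-β * ‖x‖ ^ 2) := by rw [← Real.exp_add]; congr 1; ring
  rw [integral_const_mul, integral_sub (integrable_const _) (hsq.const_mul β), integral_const_mul,
    h.second_moment, integral_const, probReal_univ, one_smul, add_sub_cancel_right, mul_one] at h1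
  refine h1.trans ?_
  have hgK : Integrable (fun x : Euc d => Real.exp (-β * ‖x‖ ^ 2)) (volume.restrict K) :=
    (integrable_gauss hβ).integrableOn
  refine (integral_mono_measure h.le (Filter.Eventually.of_forall fun x => (Real.exp_pos _).le)
    (hgK.smul_measure ENNReal.ofReal_ne_top)).trans ?_
  rw [integral_smul_measure, ENNReal.toReal_ofReal hc, smul_eq_mul]
  exact mul_le_mul_of_nonneg_left (setIntegral_le_integral (integrable_gauss hβ)
    (Filter.Eventually.of_forall fun x => (Real.exp_pos _).le)) hc

theorem IsIsotropicBody.exists_isCentredLaw (hK : IsIsotropicBody K) {t : ℝ}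
    (hQ : ∀ z : Euc d, volume.real (K ∩ (fun x => (2 : ℝ) • z - x) ⁻¹' K) ≤
      Real.exp t / 2 ^ d * volume.real K) (k : ℕ) :
    ∃ μ, IsCentredLaw K (ENNReal.ofReal ((volume.real K)⁻¹ * Real.exp ((2 ^ k - 1) * t)))
      (d / 2 ^ k) μ := by
  have hV := volume_real_pos hK.compact hK.interior_nonempty
  induction k with
  | zero => exact ⟨_, by simpa using hK.isCentredLaw⟩
  | succ k ih =>
    obtain ⟨μ, hμ⟩ := ih
    have hQ' : ∀ z : Euc d, volume (K ∩ (fun x => (2 : ℝ) • z - x) ⁻¹' K) ≤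
        ENNReal.ofReal (Real.exp t / 2 ^ d * volume.real K) := fun z => by
      rw [← ofReal_measureReal
        ((measure_mono Set.inter_subset_left).trans_lt hK.compact.measure_lt_top).ne]
      exact ENNReal.ofReal_le_ofReal (hQ z)
    have h1 := hμ.midpoint hK.compact hK.convex ENNReal.ofReal_ne_top hQ'
    rw [← ENNReal.ofReal_pow (by positivity), show (2 : ENNReal) ^ d = ENNReal.ofReal (2 ^ d) by
      rw [ENNReal.ofReal_pow (by norm_num)]; norm_num, ← ENNReal.ofReal_mul (by positivity),
      ← ENNReal.ofReal_mul (by positivity), div_div, ← pow_succ] at h1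
    refine ⟨(μ.prod μ).map fun p => (1 / 2 : ℝ) • (p.1 + p.2), ?_⟩
    convert h1 using 2
    have h2 : Real.exp ((2 ^ (k + 1) - 1) * t) = Real.exp ((2 ^ k - 1) * t) ^ 2 * Real.exp t := by
      rw [← Real.exp_nat_mul, ← Real.exp_add]
      congr 1
      push_cast
      ring
    rw [h2]
    field_simp

theorem gaussMass_two_pow_lt (hd : 1 ≤ d) : gaussMass d (2 ^ 160) < Real.exp (-(51 * d)) := by
  have hpi := Real.pi_pos
  rw [gaussMass_eq (by positivity)]
  have h1 : Real.pi / 2 ^ 160 ≤ ((2 : ℝ) ^ 79)⁻¹ ^ 2 := by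
    rw [div_le_iff₀ (by positivity)]
    have := Real.pi_lt_four
    norm_num
    linarith
  calc (Real.pi / 2 ^ 160) ^ (d / 2 : ℝ) ≤ (((2 : ℝ) ^ 79)⁻¹ ^ 2) ^ (d / 2 : ℝ) :=
        Real.rpow_le_rpow (by positivity) h1 (by positivity)
    _ = ((2 : ℝ) ^ 79)⁻¹ ^ d := by
        have h2 : (0 : ℝ) ≤ ((2 : ℝ) ^ 79)⁻¹ := by positivity
        generalize ((2 : ℝ) ^ 79)⁻¹ = a at h2
        rw [← Real.rpow_natCast, ← Real.rpow_mul h2, ← Real.rpow_natCast, Nat.cast_ofNat,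
          mul_div_cancel₀ _ two_ne_zero]
    _ < Real.exp (-51) ^ d := by
        refine pow_lt_pow_left₀ ?_ (by positivity) (by omega)
        rw [Real.exp_neg]
        refine inv_strictAnti₀ (Real.exp_pos _) ?_
        calc Real.exp 51 = Real.exp 1 ^ 51 := by rw [← Real.exp_nat_mul]; norm_num
          _ ≤ 2.7182818286 ^ 51 := pow_le_pow_left₀ (Real.exp_pos _).le Real.exp_one_lt_d9.le _
          _ < 2 ^ 79 := by norm_num
    _ = _ := by rw [← Real.exp_nat_mul]; congr 1; ring

theorem IsIsotropicBody.exists_lt_volume_inter (hK : IsIsotropicBody K) (hd : 1 ≤ d) :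
    ∃ z : Euc d, Real.exp (d / 2 ^ 160) / 2 ^ d * volume.real K <
      volume.real (K ∩ (fun x => (2 : ℝ) • z - x) ⁻¹' K) := by
  by_contra! hcon
  have hV := volume_real_pos hK.compact hK.interior_nonempty
  obtain ⟨μ, hμ⟩ := hK.exists_isCentredLaw hcon 160
  have h1 := hμ.exp_le (β := 2 ^ 160) (by positivity) (by positivity) hK.compact
  have h2 := hK.exp_le_volume hd
  have h3 : (volume.real K)⁻¹ ≤ Real.exp (49 * d) := by
    rw [inv_le_comm₀ hV (Real.exp_pos _), ← Real.exp_neg]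
    exact h2
  have h4 : Real.exp ((2 ^ 160 - 1) * (d / 2 ^ 160 : ℝ)) ≤ Real.exp d := by
    rw [Real.exp_le_exp]
    have : (0 : ℝ) ≤ d / 2 ^ 160 := by positivity
    have h5 : (2 : ℝ) ^ 160 * (d / 2 ^ 160) = d := by field_simp
    linarith
  have h5 : Real.exp (-(d : ℝ)) < Real.exp (-(d : ℝ)) := by
    calc Real.exp (-(d : ℝ)) = Real.exp (-((2 : ℝ) ^ 160 * (d / 2 ^ 160))) := by
          congr 2; field_simp
      _ ≤ _ := h1
      _ < Real.exp (49 * d) * Real.exp d * Real.exp (-(51 * d)) := by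
          have h6 := gaussMass_two_pow_lt hd
          have h7 := gaussMass_pos (d := d) (b := 2 ^ 160) (by positivity)
          refine mul_lt_mul' ?_ h6 h7.le (by positivity)
          exact mul_le_mul h3 h4 (Real.exp_pos _).le (Real.exp_pos _).le
      _ = _ := by rw [← Real.exp_add, ← Real.exp_add]; congr 1; ring
  exact lt_irrefl _ h5

theorem exists_lt_volume_inter (hK : IsCompact K) (hc : Convex ℝ K) (hi : (interior K).Nonempty)
    (hd : 1 ≤ d) :
    ∃ z : Euc d, Real.exp (d / 2 ^ 160) / 2 ^ d * volume.real K <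
      volume.real (K ∩ (fun x => (2 : ℝ) • z - x) ⁻¹' K) := by
  obtain ⟨e, c, he⟩ := exists_isIsotropicBody_image hK hc hi
  obtain ⟨w, hw⟩ := he.exists_lt_volume_inter hd
  set z := e.symm w + c
  have hwz : w = e (z - c) := by simp [z]
  have hset : (fun x => e (x - c)) '' K ∩ (fun x => (2 : ℝ) • w - x) ⁻¹' ((fun x => e (x - c)) '' K)
      = (fun x => e (x - c)) '' (K ∩ (fun x => (2 : ℝ) • z - x) ⁻¹' K) := by
    ext y
    simp only [Set.mem_inter_iff, Set.mem_image, Set.mem_preimage]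
    constructor
    · rintro ⟨⟨x, hx, rfl⟩, x', hx', hxx'⟩
      refine ⟨x, ⟨hx, ?_⟩, rfl⟩
      rw [hwz, ← map_smul, ← map_sub] at hxx'
      have := e.injective hxx'
      rw [show (2 : ℝ) • z - x = x' - c + c by rw [this]; module, sub_add_cancel]
      exact hx'
    · rintro ⟨x, ⟨hx, hx'⟩, rfl⟩
      refine ⟨⟨x, hx, rfl⟩, _, hx', ?_⟩
      rw [hwz, ← map_smul, ← map_sub]
      congr 1
      module
  rw [hset, volume_real_image_sub _ _ hK.measurableSet, volume_real_image_sub _ _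
    (hK.measurableSet.inter ((by fun_prop : Measurable fun x => (2 : ℝ) • z - x) hK.measurableSet)),
    mul_left_comm] at hw
  exact ⟨z, lt_of_mul_lt_mul_left hw (abs_nonneg _)⟩

end SymmetricIntersection

section Covering

variable {d : ℕ} {K : Set (Euc d)}

/-- Some translate `y + B` with `y ∈ S` covers at least the average proportion of `U`. -/
theorem exists_le_volume_inter_sub {U B S : Set (Euc d)} (hU : MeasurableSet U)
    (hB : MeasurableSet B) (hS : MeasurableSet S) (hUf : volume U ≠ ⊤) (hBf : volume B ≠ ⊤)
    (hS0 : volume S ≠ 0) (h : ∀ u ∈ U, ∀ b ∈ B, u - b ∈ S) :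
    ∃ y : Euc d, volume.real B / volume.real S * volume.real U ≤
      volume.real (U ∩ (fun u => u - y) ⁻¹' B) := by
  have hm : Measurable fun p : Euc d × Euc d => B.indicator (1 : Euc d → ENNReal) (p.2 - p.1) :=
    (measurable_one.indicator hB).comp (by fun_prop)
  have hpre : ∀ y : Euc d, MeasurableSet ((fun u => u - y) ⁻¹' B) := fun y =>
    (by fun_prop : Measurable fun u => u - y) hB
  have h1 : ∫⁻ y in S, ∫⁻ u in U, B.indicator (1 : Euc d → ENNReal) (u - y) =
      volume B * volume U := by
    rw [lintegral_lintegral_swap hm.aemeasurable, ← setLIntegral_const]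
    refine setLIntegral_congr_fun hU fun u hu => ?_
    rw [← lintegral_indicator hS]
    have h2 : ∀ y, S.indicator (fun y => B.indicator (1 : Euc d → ENNReal) (u - y)) y =
        B.indicator 1 (u - y) := fun y => by
      by_cases hy : y ∈ S
      · rw [Set.indicator_of_mem hy]
      · rw [Set.indicator_of_notMem hy, Set.indicator_of_notMem]
        exact fun hb => hy (by simpa using h u hu _ hb)
    simp only [h2]
    rw [lintegral_sub_left_eq_self (fun z => B.indicator (1 : Euc d → ENNReal) z) u,
      lintegral_indicator_one hB]
  obtain ⟨y, -, hy⟩ := exists_setLAverage_le hS0 hS.nullMeasurableSet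
    (h1.trans_ne (ENNReal.mul_ne_top hBf hUf))
  refine ⟨y, ?_⟩
  have h2 : ∫⁻ u in U, B.indicator (1 : Euc d → ENNReal) (u - y) =
      volume (U ∩ (fun u => u - y) ⁻¹' B) := by
    rw [Set.inter_comm, ← Measure.restrict_apply (hpre y), ← lintegral_indicator_one (hpre y)]
    rfl
  rw [setLAverage_eq, h1, h2] at hy
  have h3 := ENNReal.toReal_mono ((measure_mono Set.inter_subset_left).trans_lt hUf.lt_top).ne hy
  rw [ENNReal.toReal_div, ENNReal.toReal_mul] at h3
  rwa [div_mul_eq_mul_div]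

theorem exists_volume_diff_iUnion_le {L B S : Set (Euc d)} (hL : MeasurableSet L)
    (hB : MeasurableSet B) (hS : MeasurableSet S) (hLf : volume L ≠ ⊤) (hBf : volume B ≠ ⊤)
    (hS0 : volume S ≠ 0) (h : ∀ u ∈ L, ∀ b ∈ B, u - b ∈ S)
    (hBS : volume.real B ≤ volume.real S) (M : ℕ) :
    ∃ y : Fin M → Euc d, volume.real (L \ ⋃ i, (fun u => u - y i) ⁻¹' B) ≤
      (1 - volume.real B / volume.real S) ^ M * volume.real L := by
  induction M with
  | zero => exact ⟨0, by simp⟩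
  | succ M ih =>
    obtain ⟨y, hy⟩ := ih
    set p := volume.real B / volume.real S
    have hp : p ≤ 1 := div_le_one_of_le₀ hBS measureReal_nonneg
    set U := L \ ⋃ i, (fun u => u - y i) ⁻¹' B
    have hpre : ∀ y : Euc d, MeasurableSet ((fun u => u - y) ⁻¹' B) := fun y =>
      (by fun_prop : Measurable fun u => u - y) hB
    have hU : MeasurableSet U := hL.diff (MeasurableSet.iUnion fun i => hpre _)
    have hUf : volume U ≠ ⊤ := ((measure_mono Set.sdiff_subset).trans_lt hLf.lt_top).ne
    obtain ⟨v, hv⟩ := exists_le_volume_inter_sub hU hB hS hUf hBf hS0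
      fun u hu b hb => h u hu.1 b hb
    refine ⟨Fin.cons v y, ?_⟩
    have h1 : (L \ ⋃ i, (fun u => u - (Fin.cons v y : Fin (M + 1) → Euc d) i) ⁻¹' B) =
        U \ (fun u => u - v) ⁻¹' B := by
      ext u
      simp [U, Fin.forall_fin_succ]
      tauto
    have h2 := measureReal_sdiff_add_inter (μ := volume) (s := U) (hpre v) hUf
    rw [h1, pow_succ']
    calc volume.real (U \ (fun u => u - v) ⁻¹' B) ≤ (1 - p) * volume.real U := by linarith
      _ ≤ (1 - p) * ((1 - p) ^ M * volume.real L) :=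
        mul_le_mul_of_nonneg_left hy (by linarith)
      _ = _ := by ring

/-- The symmetric part of `K` about `z`. -/
def symmPart (K : Set (Euc d)) (z : Euc d) : Set (Euc d) := {u | z + u ∈ K ∧ z - u ∈ K}

theorem volume_real_symmPart (K : Set (Euc d)) (z : Euc d) :
    volume.real (symmPart K z) = volume.real (K ∩ (fun x => (2 : ℝ) • z - x) ⁻¹' K) := by
  have : symmPart K z = (fun u => z + u) ⁻¹' (K ∩ (fun x => (2 : ℝ) • z - x) ⁻¹' K) := by
    ext u
    simp only [symmPart, Set.mem_ofPred_eq, Set.mem_preimage, Set.mem_inter_iff]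
    rw [show (2 : ℝ) • z - (z + u) = z - u by module]
  rw [this, measureReal_def, measure_preimage_add, measureReal_def]

theorem isCompact_symmPart (hK : IsCompact K) (z : Euc d) : IsCompact (symmPart K z) := by
  have h1 : symmPart K z = (Homeomorph.addLeft z) ⁻¹' K ∩ (Homeomorph.subLeft z) ⁻¹' K := rfl
  rw [h1]
  exact ((Homeomorph.isCompact_preimage _).2 hK).inter ((Homeomorph.isCompact_preimage _).2 hK)

theorem neg_mem_symmPart {z u : Euc d} (hu : u ∈ symmPart K z) : -u ∈ symmPart K z := by
  simpa [symmPart, sub_eq_add_neg] using And.symm hu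

theorem smul_add_smul_mem_symmPart (hc : Convex ℝ K) {z u v : Euc d} (hu : u ∈ symmPart K z)
    (hv : v ∈ symmPart K z) {s t : ℝ} (hs : 0 ≤ s) (ht : 0 ≤ t) (hst : s + t ≤ 1) :
    s • u + t • v ∈ symmPart K z := by
  have hz : z ∈ K := by
    convert hc hu.1 hu.2 (by norm_num : (0 : ℝ) ≤ 1 / 2) (by norm_num : (0 : ℝ) ≤ 1 / 2)
      (by norm_num) using 1
    module
  have key : ∀ x ∈ K, ∀ y ∈ K, s • x + t • y + (1 - s - t) • z ∈ K := by
    intro x hx y hy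
    have h1 := hc.sum_mem (t := Finset.univ) (w := ![s, t, 1 - s - t]) (z := ![x, y, z])
      (by simp [Fin.forall_fin_succ, hs, ht]; linarith) (by simp [Fin.sum_univ_succ])
      (by simp [Fin.forall_fin_succ, hx, hy, hz])
    simpa [Fin.sum_univ_succ, add_assoc] using h1
  constructor
  · convert key _ hu.1 _ hv.1 using 1
    module
  · convert key _ hu.2 _ hv.2 using 1
    module

/-- Greedy covering of `K` by translates of its interior. -/
theorem exists_covering (hK : IsCompact K) (hc : Convex ℝ K) (hi : (interior K).Nonempty)
    (z : Euc d) {δ : ℝ} (hδ : 0 < δ) (hδ' : 2 * δ < 1) {M : ℕ}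
    (hM : (1 - (1 - 2 * δ) ^ d * volume.real (symmPart K z) / (2 ^ d * volume.real K)) ^ M *
      (2 ^ d * volume.real K) < δ ^ d * volume.real (symmPart K z)) :
    ∃ x : Fin M → Euc d, K ⊆ ⋃ i, (x i +ᵥ interior K) := by
  have hV := volume_real_pos hK hi
  set B := symmPart K z
  have hBc : IsCompact B := isCompact_symmPart hK z
  set S := AffineMap.homothety z (2 : ℝ) '' K
  have hSc : IsCompact S := hK.image (AffineMap.homothety_continuous _ _)
  have hSv : volume.real S = 2 ^ d * volume.real K := volume_real_homothety K z (by norm_num)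
  have hKB : ∀ k ∈ K, ∀ b ∈ B, k + b ∈ S := by
    intro k hk b hb
    refine ⟨_, hc hk hb.1 (by norm_num : (0 : ℝ) ≤ 1 / 2) (by norm_num : (0 : ℝ) ≤ 1 / 2)
      (by norm_num), ?_⟩
    simp only [AffineMap.homothety_apply, vsub_eq_sub, vadd_eq_add]
    module
  set L := K + δ • B
  set B' := (1 - 2 * δ) • B
  have hLc : IsCompact L := hK.add (hBc.smul δ)
  have hB'c : IsCompact B' := hBc.smul _
  have hsm : ∀ r : ℝ, 0 ≤ r → volume.real (r • B) = r ^ d * volume.real B := fun r hr => by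
    rw [measureReal_def, Measure.addHaar_smul, ENNReal.toReal_mul,
      ENNReal.toReal_ofReal (abs_nonneg _), abs_of_nonneg (by positivity),
      finrank_euclideanSpace_fin, measureReal_def]
  have hLB : ∀ u ∈ L, ∀ b ∈ B', u - b ∈ S := by
    rintro _ ⟨k, hk, _, ⟨b, hb, rfl⟩, rfl⟩ _ ⟨b', hb', rfl⟩
    have := hKB k hk _ (smul_add_smul_mem_symmPart hc hb (neg_mem_symmPart hb') hδ.le
      (by linarith : 0 ≤ 1 - 2 * δ) (by linarith))
    convert this using 1
    simp only
    module
  have hLS : volume.real L ≤ volume.real S := by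
    refine measureReal_mono ?_ hSc.measure_lt_top.ne
    rintro _ ⟨k, hk, _, ⟨b, hb, rfl⟩, rfl⟩
    have := hKB k hk _ (smul_add_smul_mem_symmPart hc hb hb hδ.le le_rfl (by linarith))
    simpa using this
  have hBK : volume.real B ≤ volume.real K := by
    rw [volume_real_symmPart]
    exact measureReal_mono Set.inter_subset_left hK.measure_lt_top.ne
  have hB'S : volume.real B' ≤ volume.real S := by
    rw [hsm _ (by linarith), hSv]
    have h1 : (1 - 2 * δ) ^ d ≤ 1 := pow_le_one₀ (by linarith) (by linarith)
    have h2 : (1 : ℝ) ≤ 2 ^ d := one_le_pow₀ (by norm_num)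
    have h3 : 0 ≤ volume.real B := measureReal_nonneg
    nlinarith
  have hS0 : volume S ≠ 0 := fun h0 => by
    have : 0 < volume.real S := by rw [hSv]; positivity
    rw [measureReal_def, h0] at this
    simp at this
  obtain ⟨y, hy⟩ := exists_volume_diff_iUnion_le hLc.measurableSet hB'c.measurableSet
    hSc.measurableSet hLc.measure_lt_top.ne hB'c.measure_lt_top.ne hS0 hLB
    hB'S M
  have hsmall : volume.real (L \ ⋃ i, (fun u => u - y i) ⁻¹' B') < volume.real (δ • B) := by
    rw [hsm _ hδ.le]
    refine lt_of_le_of_lt ?_ hM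
    refine hy.trans ?_
    rw [hsm _ (by linarith), hSv] at *
    refine mul_le_mul_of_nonneg_left hLS (pow_nonneg ?_ _)
    rw [sub_nonneg]
    exact div_le_one_of_le₀ hB'S (by positivity)
  obtain ⟨w, hw⟩ := hi
  refine ⟨fun i => y i - (1 - δ) • z - δ • w, fun x hx => ?_⟩
  have h1 : ∃ b ∈ B, ∃ i, x + δ • b - y i ∈ B' := by
    by_contra! hcon
    have h2 : x +ᵥ (δ • B) ⊆ L \ ⋃ i, (fun u => u - y i) ⁻¹' B' := by
      rintro _ ⟨_, ⟨b, hb, rfl⟩, rfl⟩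
      refine ⟨Set.add_mem_add hx (Set.smul_mem_smul_set hb), ?_⟩
      simp only [Set.mem_iUnion, not_exists]
      exact fun i => hcon b hb i
    have h3 := measureReal_mono (μ := volume) h2
      ((measure_mono Set.sdiff_subset).trans_lt hLc.measure_lt_top).ne
    rw [measureReal_def, measure_vadd, ← measureReal_def] at h3
    linarith
  obtain ⟨b, hb, i, b', hb', hbb'⟩ := h1
  rw [Set.mem_iUnion]
  refine ⟨i, ?_⟩
  rw [Set.mem_vadd_set_iff_neg_vadd_mem, vadd_eq_add]
  have hδ1 : 0 < 1 - δ := by linarith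
  have h4 : (δ / (1 - δ)) • (-b) + ((1 - 2 * δ) / (1 - δ)) • b' ∈ B :=
    smul_add_smul_mem_symmPart hc (neg_mem_symmPart hb) hb' (by positivity)
      (div_nonneg (by linarith) hδ1.le) (by
        rw [← add_div]
        exact div_le_one_of_le₀ (by linarith) hδ1.le)
  have h5 := hc.combo_self_interior_mem_interior h4.1 hw hδ1.le hδ (by ring)
  convert h5 using 1
  have h6 : x = y i + (1 - 2 * δ) • b' - δ • b := by
    simp only at hbb'
    rw [hbb']
    abel
  rw [h6, smul_add, smul_add, smul_smul, smul_smul, mul_div_cancel₀ _ hδ1.ne',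
    mul_div_cancel₀ _ hδ1.ne']
  module

end Covering

theorem exists_covering_card_le {d : ℕ} {K : Set (Euc d)} (hK : IsCompact K) (hc : Convex ℝ K)
    (hi : (interior K).Nonempty) (hd : 1 ≤ d) :
    ∃ (M : ℕ) (x : Fin M → Euc d), K ⊆ ⋃ i, (x i +ᵥ interior K) ∧
      (M : ℝ) ≤ 32 * d ^ 2 * 4 ^ d * Real.exp (-(d / 2 ^ 160)) + 1 := by
  obtain ⟨z, hz⟩ := exists_lt_volume_inter hK hc hi hd
  rw [← volume_real_symmPart] at hz
  have hV := volume_real_pos hK hi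
  have hBK : volume.real (symmPart K z) ≤ volume.real K := by
    rw [volume_real_symmPart]
    exact measureReal_mono Set.inter_subset_left hK.measure_lt_top.ne
  have hd' : (1 : ℝ) ≤ d := by exact_mod_cast hd
  set V := volume.real K
  set β := volume.real (symmPart K z)
  set ε : ℝ := d / 2 ^ 160 with hε
  have hE : 1 ≤ Real.exp ε := Real.one_le_exp (by positivity)
  set δ : ℝ := 1 / (4 * d) with hδdef
  have hδ : 0 < δ := by positivity
  have hδd : δ * d = 1 / 4 := by rw [hδdef]; field_simp
  have hδ' : 2 * δ < 1 := by nlinarith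
  set M := ⌊32 * d ^ 2 * 4 ^ d * Real.exp (-ε)⌋₊ + 1 with hMdef
  have hMlt : 32 * d ^ 2 * 4 ^ d * Real.exp (-ε) < M := by
    rw [hMdef]
    exact_mod_cast Nat.lt_floor_add_one _
  have hMle : (M : ℝ) ≤ 32 * d ^ 2 * 4 ^ d * Real.exp (-ε) + 1 := by
    rw [hMdef, Nat.cast_add, Nat.cast_one]
    gcongr
    exact Nat.floor_le (by positivity)
  have hhalf : 1 / 2 ≤ (1 - 2 * δ) ^ d := by
    have := one_add_mul_le_pow (a := -(2 * δ)) (by linarith) d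
    rw [← sub_eq_add_neg] at this
    linarith
  have hone : (1 - 2 * δ) ^ d ≤ 1 := pow_le_one₀ (by linarith) (by linarith)
  have hβ : 0 < β := lt_trans (by positivity) hz
  set p := (1 - 2 * δ) ^ d * β / (2 ^ d * V) with hp
  have hp1 : p ≤ 1 := by
    refine div_le_one_of_le₀ ?_ (by positivity)
    have h2 : (1 : ℝ) ≤ 2 ^ d := one_le_pow₀ (by norm_num)
    nlinarith
  have h4 : (4 : ℝ) ^ d = 2 ^ d * 2 ^ d := by rw [← mul_pow]; norm_num
  have hp0 : Real.exp ε / (2 * 4 ^ d) ≤ p := by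
    rw [hp, le_div_iff₀ (by positivity)]
    calc Real.exp ε / (2 * 4 ^ d) * (2 ^ d * V) = 1 / 2 * (Real.exp ε / 2 ^ d * V) := by
          rw [h4]; field_simp
      _ ≤ (1 - 2 * δ) ^ d * β := by gcongr
  have hpM : 16 * (d : ℝ) ^ 2 ≤ p * M := by
    calc 16 * (d : ℝ) ^ 2 = Real.exp ε / (2 * 4 ^ d) * (32 * d ^ 2 * 4 ^ d * Real.exp (-ε)) := by
          rw [Real.exp_neg]
          have := Real.exp_pos ε
          field_simp
          norm_num
      _ ≤ p * M := by gcongr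
  obtain ⟨x, hx⟩ := exists_covering hK hc hi z hδ hδ' (M := M) (by
    calc (1 - p) ^ M * (2 ^ d * V) ≤ Real.exp (-p) ^ M * (2 ^ d * V) := by
          gcongr
          exact Real.one_sub_le_exp_neg p
      _ ≤ Real.exp (-(16 * d)) ^ d * (2 ^ d * V) := by
          rw [← Real.exp_nat_mul, ← Real.exp_nat_mul]
          refine mul_le_mul_of_nonneg_right (Real.exp_le_exp.2 ?_) (by positivity)
          linarith
      _ ≤ (1 / (16 * d)) ^ d * (2 ^ d * V) := by
          gcongr
          rw [Real.exp_neg, one_div]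
          refine inv_anti₀ (by positivity) ?_
          linarith [Real.add_one_le_exp (16 * (d : ℝ))]
      _ = δ ^ d * (1 / 2 ^ d * V) := by
          rw [hδdef, show (1 : ℝ) / (16 * d) = 1 / (4 * d) * (1 / 4) by field_simp; norm_num,
            mul_pow, one_div_pow (4 : ℝ), h4]
          field_simp
      _ ≤ δ ^ d * (Real.exp ε / 2 ^ d * V) := by gcongr
      _ < δ ^ d * β := by gcongr)
  exact ⟨M, x, hx, hMle⟩

theorem eventually_mul_sq_le_exp :
    ∃ d₀ : ℕ, ∀ d ≥ d₀, 33 * (d : ℝ) ^ 2 ≤ Real.exp (1 / 2 ^ 161 * d) := by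
  have h1 := (isLittleO_pow_exp_pos_mul_atTop (b := 1 / 2 ^ 161) 2 (by positivity)).bound
    (show (0 : ℝ) < 1 / 33 by norm_num)
  obtain ⟨d₀, h2⟩ := Filter.eventually_atTop.1 (tendsto_natCast_atTop_atTop.eventually h1)
  refine ⟨d₀, fun d hd => ?_⟩
  have h3 := h2 d hd
  rw [Real.norm_eq_abs, Real.norm_eq_abs, abs_of_nonneg (by positivity), Real.abs_exp] at h3
  linarith

/-- There exist `c > 0` and `d₀` such that for every `d ≥ d₀` and every convex body
`K ⊆ ℝ^d`, we have `N(K) ≤ exp(-c d / (log d)^8) · 4^d`. -/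
theorem hadwiger_polylog :
    ∃ c : ℝ, 0 < c ∧ ∃ d₀ : ℕ, ∀ d : ℕ, d₀ ≤ d →
      ∀ K : Set (EuclideanSpace ℝ (Fin d)),
        IsCompact K → Convex ℝ K → (interior K).Nonempty →
        (coveringNumber K : ℝ) ≤ Real.exp (-c * d / (Real.log d) ^ 8) * 4 ^ d := by
  obtain ⟨d₀, hd₀⟩ := eventually_mul_sq_le_exp
  refine ⟨1 / 2 ^ 161, by positivity, max d₀ 3, fun d hd K hK hc hi => ?_⟩
  have hd3 : 3 ≤ d := (le_max_right _ _).trans hd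
  obtain ⟨M, x, hx, hM⟩ := exists_covering_card_le hK hc hi (by omega)
  have h1 : coveringNumber K ≤ M := Nat.sInf_le ⟨x, hx⟩
  have h2 : (coveringNumber K : ℝ) ≤ M := by exact_mod_cast h1
  have h3 := hd₀ d ((le_max_left _ _).trans hd)
  have hd1 : (1 : ℝ) ≤ d := by
    have : 1 ≤ d := by omega
    exact_mod_cast this
  have hlog : 1 ≤ Real.log d := by
    rw [Real.le_log_iff_exp_le (by positivity)]
    have : (3 : ℝ) ≤ d := by exact_mod_cast hd3
    linarith [Real.exp_one_lt_d9]
  have h4 : Real.exp (-(1 / 2 ^ 161) * d) ≤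
      Real.exp (-(1 / 2 ^ 161) * d / (Real.log d) ^ 8) := by
    rw [Real.exp_le_exp, neg_mul, neg_div, neg_le_neg_iff]
    exact div_le_self (by positivity) (one_le_pow₀ hlog)
  have h5 : (1 : ℝ) ≤ d ^ 2 * 4 ^ d * Real.exp (-(d / 2 ^ 160)) := by
    have h6 : Real.exp (d / 2 ^ 160) ≤ 4 ^ d := by
      calc Real.exp (d / 2 ^ 160) ≤ Real.exp d := by
            rw [Real.exp_le_exp]
            exact div_le_self (by positivity) (one_le_pow₀ (by norm_num))
        _ = Real.exp 1 ^ d := by rw [← Real.exp_nat_mul, mul_one]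
        _ ≤ 4 ^ d := by
            gcongr
            linarith [Real.exp_one_lt_d9]
    calc (1 : ℝ) = Real.exp (d / 2 ^ 160) * Real.exp (-(d / 2 ^ 160)) := by
          rw [← Real.exp_add, add_neg_cancel, Real.exp_zero]
      _ ≤ d ^ 2 * 4 ^ d * Real.exp (-(d / 2 ^ 160)) := by
          gcongr
          exact h6.trans (le_mul_of_one_le_left (by positivity) (one_le_pow₀ hd1))
  calc (coveringNumber K : ℝ) ≤ 33 * d ^ 2 * (4 ^ d * Real.exp (-(d / 2 ^ 160))) := by linarith
    _ ≤ Real.exp (1 / 2 ^ 161 * d) * (4 ^ d * Real.exp (-(d / 2 ^ 160))) := by gcongr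
    _ = Real.exp (-(1 / 2 ^ 161) * d) * 4 ^ d := by
        rw [mul_left_comm, ← Real.exp_add, mul_comm]
        congr 2
        ring
    _ ≤ _ := by gcongr
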